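/- There exists ε* > 0, depending only on σ and θ, such that for every ε ∈ (0, ε*) and every z⁽⁰⁾ ∈ Θ_ε with ‖z⁽⁰⁾‖_σ ≤ ε, setting T_ε := ε^{−r_ε/3}, there exists a solution z ∈ C([−T_ε, T_ε]; 𝒢) of (NLSP) with z(0) = z⁽⁰⁾, and this solution satisfies, for all |t| ≤ T_ε: ‖z(t)‖_σ ≤ 2‖z(0)‖_σ and ∑_{a∈ℤ} e^{σ|a|^θ} · | |z_a(t)|² − |z_a(0)|² |^{1/2} ≤ ‖z(0)‖_σ^{3/2}. -/

import Mathlib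

noncomputable section

attribute [local instance] Classical.propDecidable

open scoped BigOperators

/-- The Gevrey weight `e^(σ |a|^θ)`. -/
def wt (σ θ : ℝ) (a : ℤ) : ℝ := Real.exp (σ * |(a : ℝ)| ^ θ)

/-- The Gevrey norm `‖z‖_σ = 2 ∑_a e^(σ|a|^θ) |z_a|`. -/
def gNorm (σ θ : ℝ) (z : ℤ → ℂ) : ℝ := 2 * ∑' a : ℤ, wt σ θ a * ‖z a‖

/-- Membership in the Gevrey space `𝒢`. -/
def inG (σ θ : ℝ) (z : ℤ → ℂ) : Prop := Summable fun a : ℤ => wt σ θ a * ‖z a‖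

/-- `z_{(δ,a)}`: `z_a` if `δ = 1`, the conjugate if `δ = -1`. -/
def idxVal (z : ℤ → ℂ) (p : ℤ × ℤ) : ℂ :=
  if p.1 = 1 then z p.2 else (starRingEnd ℂ) (z p.2)

/-- The monomial `z_𝐣`. -/
def zProd {n : ℕ} (z : ℤ → ℂ) (j : Fin n → ℤ × ℤ) : ℂ := ∏ α, idxVal z (j α)

/-- The signs of the multi-index belong to `𝕌₂ = {-1, 1}`. -/
def isU2 {n : ℕ} (j : Fin n → ℤ × ℤ) : Prop := ∀ α, (j α).1 = 1 ∨ (j α).1 = -1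

/-- Zero momentum multi-indices (the set `M_m`, with `n = 2m`). -/
def inM {n : ℕ} (j : Fin n → ℤ × ℤ) : Prop :=
  isU2 j ∧ ∑ α, (j α).1 = 0 ∧ ∑ α, (j α).1 * (j α).2 = 0

/-- Resonant multi-indices (the set `R_m`, with `n = 2m`). -/
def inR {n : ℕ} (j : Fin n → ℤ × ℤ) : Prop :=
  inM j ∧ ∑ α, (j α).1 * (j α).2 ^ 2 = 0

/-- Integrable multi-indices: the entries can be paired as `{(δ,a), (-δ,a)}`. -/
def integ {n : ℕ} (j : Fin n → ℤ × ℤ) : Prop :=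
  ∃ φ : Equiv.Perm (Fin n), ∀ α, j (φ α) = (-(j α).1, (j α).2)

/-- `⟨a⟩ = max(1, |a|)`. -/
def brk (a : ℤ) : ℕ := max 1 a.natAbs

/-- The modulated frequencies `ω_𝐣^M(z)` with finite cut-off `M`. -/
def omegaM (M : ℝ) {n : ℕ} (j : Fin n → ℤ × ℤ) (z : ℤ → ℂ) : ℝ :=
  ∑ β, ((j β).1 : ℝ) *
    ∑' a : ℤ, if a ≠ (j β).2 ∧ |(a : ℝ)| ≤ M then
      ‖z a‖ ^ 2 / ((a : ℝ) - ((j β).2 : ℝ)) ^ 2 else 0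

/-- The modulated frequencies `ω_𝐣^∞(z)`. -/
def omegaInf {n : ℕ} (j : Fin n → ℤ × ℤ) (z : ℤ → ℂ) : ℝ :=
  ∑ β, ((j β).1 : ℝ) *
    ∑' a : ℤ, if a ≠ (j β).2 then
      ‖z a‖ ^ 2 / ((a : ℝ) - ((j β).2 : ℝ)) ^ 2 else 0

/-- The projection `Π_M` on the modes `|a| ≤ M`. -/
def PiM (M : ℝ) (z : ℤ → ℂ) : ℤ → ℂ := fun a => if |(a : ℝ)| ≤ M then z a else 0

/-- The optimal order `r_ε`. -/
def rEps (σ θ ε : ℝ) : ℕ :=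
  Nat.floor ((min 1 σ * θ * (1 - θ) / 500) * Real.log ε⁻¹ / Real.log (Real.log ε⁻¹))

/-- The truncation parameter `N_ε`. -/
def NEps (θ ε : ℝ) : ℝ := Real.log ε⁻¹ ^ ((2 : ℝ) / θ)

/-- The truncation parameter `L_ε = 6 r_ε N_ε²`. -/
def LEps (σ θ ε : ℝ) : ℝ := 6 * (rEps σ θ ε : ℝ) * NEps θ ε ^ 2

/-- `δ_ε = ε^(5/2)`. -/
def dEps (ε : ℝ) : ℝ := ε ^ ((5 : ℝ) / 2)

/-- Membership in the non-resonant set `𝔙_δ^{r,M}`: for every non-integrable resonant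
multi-index `𝐣` with at most `r` entries and `μ₁(𝐣) ≤ M`, one has `|ω_𝐣^M(z)| > δ`. -/
def inV (δ r M : ℝ) (z : ℤ → ℂ) : Prop :=
  ∀ m : ℕ, 1 ≤ m → ∀ j : Fin (2 * m) → ℤ × ℤ,
    inR j → ¬ integ j → (2 * m : ℝ) ≤ r → (∀ β, (brk ((j β).2) : ℝ) ≤ M) →
    δ < |omegaM M j z|

/-- The set `Θ_ε` of good initial data. -/
def inTheta (σ θ ε : ℝ) (z : ℤ → ℂ) : Prop :=
  inV (10 * dEps ε) (6 * (rEps σ θ ε : ℝ)) (LEps σ θ ε) (PiM (LEps σ θ ε) z)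


/-- The time horizon `T_ε = ε^{-r_ε/3}`. -/
def TEps (σ θ ε : ℝ) : ℝ := ε ^ (-(rEps σ θ ε : ℝ) / 3)

/-! ### Convolution estimates and convolution-closed majorants -/

/-- The bijection `(a, b, d) ↦ (b, b + d - a, d)` of `ℤ³`. -/
def convEquiv : ℤ × ℤ × ℤ ≃ ℤ × ℤ × ℤ where
  toFun p := (p.2.1, p.2.1 + p.2.2 - p.1, p.2.2)
  invFun q := (q.1 + q.2.2 - q.2.1, q.1, q.2.2)
  left_inv p := by ext <;> simp
  right_inv p := by ext <;> simp

theorem conv_summable_of_weight {ν f g h : ℤ → ℝ} (hν : ∀ a, 0 ≤ ν a)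
    (hsub : ∀ a b d, ν a ≤ ν b * ν (b + d - a) * ν d)
    (hf : ∀ a, 0 ≤ f a) (hg : ∀ a, 0 ≤ g a) (hh : ∀ a, 0 ≤ h a)
    (hfs : Summable fun a => ν a * f a) (hgs : Summable fun a => ν a * g a)
    (hhs : Summable fun a => ν a * h a) :
    (Summable fun p : ℤ × ℤ × ℤ =>
      ν p.1 * (f p.2.1 * g (p.2.1 + p.2.2 - p.1) * h p.2.2)) ∧
    ∑' p : ℤ × ℤ × ℤ, ν p.1 * (f p.2.1 * g (p.2.1 + p.2.2 - p.1) * h p.2.2) ≤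
      (∑' a, ν a * f a) * (∑' a, ν a * g a) * (∑' a, ν a * h a) := by
  have nf : ∀ a, 0 ≤ ν a * f a := fun a => mul_nonneg (hν a) (hf a)
  have ng : ∀ a, 0 ≤ ν a * g a := fun a => mul_nonneg (hν a) (hg a)
  have nh : ∀ a, 0 ≤ ν a * h a := fun a => mul_nonneg (hν a) (hh a)
  have s1 : Summable fun q : ℤ × ℤ => (ν q.1 * g q.1) * (ν q.2 * h q.2) :=
    hgs.mul_of_nonneg hhs ng nh
  have s2 : Summable fun q : ℤ × ℤ × ℤ =>
      (ν q.1 * f q.1) * ((ν q.2.1 * g q.2.1) * (ν q.2.2 * h q.2.2)) :=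
    hfs.mul_of_nonneg s1 nf (fun q => mul_nonneg (ng _) (nh _))
  have e2 : ∑' q : ℤ × ℤ × ℤ,
      (ν q.1 * f q.1) * ((ν q.2.1 * g q.2.1) * (ν q.2.2 * h q.2.2)) =
      (∑' a, ν a * f a) * (∑' a, ν a * g a) * (∑' a, ν a * h a) := by
    rw [mul_assoc, hgs.tsum_mul_tsum hhs s1, hfs.tsum_mul_tsum s1 s2]
  have hle : ∀ p : ℤ × ℤ × ℤ,
      ν p.1 * (f p.2.1 * g (p.2.1 + p.2.2 - p.1) * h p.2.2) ≤
      (fun q : ℤ × ℤ × ℤ =>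
        (ν q.1 * f q.1) * ((ν q.2.1 * g q.2.1) * (ν q.2.2 * h q.2.2))) (convEquiv p) := by
    intro p
    have h0 : 0 ≤ f p.2.1 * g (p.2.1 + p.2.2 - p.1) * h p.2.2 :=
      mul_nonneg (mul_nonneg (hf _) (hg _)) (hh _)
    calc _ ≤ _ := mul_le_mul_of_nonneg_right (hsub p.1 p.2.1 p.2.2) h0
      _ = _ := by simp only [convEquiv, Equiv.coe_fn_mk]; ring
  have s3 := (convEquiv.summable_iff).2 s2
  have s4 := Summable.of_nonneg_of_le (fun p => mul_nonneg (hν _)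
    (mul_nonneg (mul_nonneg (hf _) (hg _)) (hh _))) hle s3
  refine ⟨s4, ?_⟩
  rw [← e2, ← convEquiv.tsum_eq fun q : ℤ × ℤ × ℤ =>
      (ν q.1 * f q.1) * ((ν q.2.1 * g q.2.1) * (ν q.2.2 * h q.2.2))]
  exact s4.tsum_le_tsum hle s3

/-- The cubic convolution `a ↦ ∑_{b,d} U_b U_{b+d-a} U_d`. -/
def conv3 (U : ℤ → ℝ) (a : ℤ) : ℝ := ∑' x : ℤ × ℤ, U x.1 * U (x.1 + x.2 - a) * U x.2

theorem conv3_nonneg {U : ℤ → ℝ} (hU : ∀ a, 0 ≤ U a) (a : ℤ) : 0 ≤ conv3 U a :=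
  tsum_nonneg fun _ => mul_nonneg (mul_nonneg (hU _) (hU _)) (hU _)

theorem conv3_summable {ν U : ℤ → ℝ} (hν : ∀ a, 1 ≤ ν a)
    (hsub : ∀ a b d, ν a ≤ ν b * ν (b + d - a) * ν d) (hU : ∀ a, 0 ≤ U a)
    (hs : Summable fun a => ν a * U a) (a : ℤ) :
    Summable fun x : ℤ × ℤ => U x.1 * U (x.1 + x.2 - a) * U x.2 := by
  have hν0 : ∀ a, 0 ≤ ν a := fun a => zero_le_one.trans (hν a)
  have h := (conv_summable_of_weight hν0 hsub hU hU hU hs hs hs).1.prod_factor a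
  have h2 := h.mul_left (ν a)⁻¹
  refine h2.congr fun x => ?_
  have : ν a ≠ 0 := (zero_lt_one.trans_le (hν a)).ne'
  field_simp

theorem weight_conv3_le {ν U : ℤ → ℝ} (hν : ∀ a, 1 ≤ ν a)
    (hsub : ∀ a b d, ν a ≤ ν b * ν (b + d - a) * ν d) (hU : ∀ a, 0 ≤ U a)
    (hs : Summable fun a => ν a * U a) :
    (Summable fun a => ν a * conv3 U a) ∧
      ∑' a, ν a * conv3 U a ≤ (∑' a, ν a * U a) ^ 3 := by
  have hν0 : ∀ a, 0 ≤ ν a := fun a => zero_le_one.trans (hν a)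
  obtain ⟨h1, h2⟩ := conv_summable_of_weight hν0 hsub hU hU hU hs hs hs
  have e : (fun a => ν a * conv3 U a) = fun a => ∑' x : ℤ × ℤ,
      ν a * (U x.1 * U (x.1 + x.2 - a) * U x.2) := by
    funext a; rw [conv3, tsum_mul_left]
  rw [e]
  refine ⟨h1.prod, ?_⟩
  rw [← h1.tsum_prod' h1.prod_factor]
  exact h2.trans (by rw [pow_succ, pow_two])

/-- Iteration producing a convolution-closed majorant. -/
def majIter (y : ℤ → ℝ) (c : ℝ) : ℕ → ℤ → ℝ
  | 0 => fun _ => 0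
  | n + 1 => fun a => y a + c * conv3 (majIter y c n) a

theorem exists_conv_majorant {ν y : ℤ → ℝ} {ρ : ℝ} (hρ : 0 < ρ) (hν : ∀ a, 1 ≤ ν a)
    (hsub : ∀ a b d, ν a ≤ ν b * ν (b + d - a) * ν d) (hy : ∀ a, 0 ≤ y a)
    (hys : Summable fun a => ν a * y a) (hyρ : ∑' a, ν a * y a ≤ ρ) :
    ∃ Y : ℤ → ℝ, (∀ a, y a ≤ Y a) ∧ (Summable fun a => ν a * Y a) ∧
      ∑' a, ν a * Y a ≤ 2 * ρ ∧
      (∀ a, Summable fun x : ℤ × ℤ => Y x.1 * Y (x.1 + x.2 - a) * Y x.2) ∧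
      ∀ a, conv3 Y a ≤ 8 * ρ ^ 2 * Y a := by
  set c : ℝ := (8 * ρ ^ 2)⁻¹ with hc
  have hc0 : 0 < c := by positivity
  have hν0 : ∀ a, 0 ≤ ν a := fun a => zero_le_one.trans (hν a)
  have key : ∀ n, (∀ a, 0 ≤ majIter y c n a) ∧ (Summable fun a => ν a * majIter y c n a) ∧
      ∑' a, ν a * majIter y c n a ≤ 2 * ρ := by
    intro n
    induction n with
    | zero => simp [majIter, summable_zero, hρ.le]
    | succ n ih =>
      obtain ⟨i1, i2, i3⟩ := ih
      obtain ⟨w1, w2⟩ := weight_conv3_le hν hsub i1 i2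
      have e : (fun a => ν a * majIter y c (n + 1) a) =
          fun a => ν a * y a + c * (ν a * conv3 (majIter y c n) a) := by
        funext a; simp only [majIter]; ring
      refine ⟨fun a => add_nonneg (hy a) (mul_nonneg hc0.le (conv3_nonneg i1 a)), ?_, ?_⟩
      · rw [e]; exact hys.add (w1.mul_left c)
      · rw [e, hys.tsum_add (w1.mul_left c), tsum_mul_left]
        have p0 : 0 ≤ ∑' a, ν a * majIter y c n a :=
          tsum_nonneg fun a => mul_nonneg (hν0 a) (i1 a)
        have : (∑' a, ν a * majIter y c n a) ^ 3 ≤ (2 * ρ) ^ 3 := pow_le_pow_left₀ p0 i3 3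
        have h3 : c * ∑' a, ν a * conv3 (majIter y c n) a ≤ c * (2 * ρ) ^ 3 :=
          mul_le_mul_of_nonneg_left (w2.trans this) hc0.le
        have h4 : c * (2 * ρ) ^ 3 = ρ := by rw [hc]; field_simp; norm_num
        linarith
  have pw : ∀ n a, majIter y c n a ≤ 2 * ρ := by
    intro n a
    obtain ⟨i1, i2, i3⟩ := key n
    have h1 := i2.le_tsum a (fun b _ => mul_nonneg (hν0 b) (i1 b))
    have h2 : majIter y c n a ≤ ν a * majIter y c n a :=
      le_mul_of_one_le_left (i1 a) (hν a)
    linarith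
  have mono_conv : ∀ (U V : ℤ → ℝ), (∀ a, 0 ≤ U a) → (∀ a, U a ≤ V a) →
      (Summable fun a => ν a * U a) → (Summable fun a => ν a * V a) →
      ∀ a, conv3 U a ≤ conv3 V a := by
    intro U V hU hUV sU sV a
    have hV : ∀ a, 0 ≤ V a := fun a => (hU a).trans (hUV a)
    refine (conv3_summable hν hsub hU sU a).tsum_le_tsum (fun x => ?_)
      (conv3_summable hν hsub hV sV a)
    exact mul_le_mul (mul_le_mul (hUV _) (hUV _) (hU _) (hV _)) (hUV _) (hU _)
      (mul_nonneg (hV _) (hV _))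
  have mono : ∀ n a, majIter y c n a ≤ majIter y c (n + 1) a := by
    intro n
    induction n with
    | zero => intro a; simpa [majIter] using (key 1).1 a
    | succ n ih =>
      intro a
      simp only [majIter]
      have := mono_conv _ _ (key n).1 ih (key n).2.1 (key (n + 1)).2.1 a
      have := mul_le_mul_of_nonneg_left this hc0.le
      simp only [majIter] at this
      linarith
  have monoa : ∀ a, Monotone fun n => majIter y c n a := fun a =>
    monotone_nat_of_le_succ fun n => mono n a
  have bdd : ∀ a, BddAbove (Set.range fun n => majIter y c n a) := fun a =>
    ⟨2 * ρ, by rintro _ ⟨n, rfl⟩; exact pw n a⟩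
  let Y : ℤ → ℝ := fun a => ⨆ n, majIter y c n a
  have lim : ∀ a, Filter.Tendsto (fun n => majIter y c n a) Filter.atTop (nhds (Y a)) :=
    fun a => tendsto_atTop_ciSup (monoa a) (bdd a)
  have leY : ∀ n a, majIter y c n a ≤ Y a := fun n a => le_ciSup (bdd a) n
  have Y0 : ∀ a, 0 ≤ Y a := fun a => (key 0).1 a |>.trans (leY 0 a)
  have fin1 : ∀ s : Finset ℤ, ∑ a ∈ s, ν a * Y a ≤ 2 * ρ := by
    intro s
    have ht : Filter.Tendsto (fun n => ∑ a ∈ s, ν a * majIter y c n a) Filter.atTop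
        (nhds (∑ a ∈ s, ν a * Y a)) :=
      tendsto_finsetSum _ fun a _ => (lim a).const_mul _
    refine le_of_tendsto' ht fun n => ?_
    exact ((key n).2.1.sum_le_tsum s fun a _ => mul_nonneg (hν0 a) ((key n).1 a)).trans
      (key n).2.2
  have sY : Summable fun a => ν a * Y a :=
    summable_of_sum_le (fun a => mul_nonneg (hν0 a) (Y0 a)) fin1
  refine ⟨Y, fun a => ?_, sY, ?_, conv3_summable hν hsub Y0 sY, fun a => ?_⟩
  · refine le_trans ?_ (leY 1 a)
    simp only [majIter]
    have := mul_nonneg hc0.le (conv3_nonneg (key 0).1 a)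
    simp only [majIter] at this
    linarith
  · exact sY.tsum_le_of_sum_le fin1
  · refine (conv3_summable hν hsub Y0 sY a).tsum_le_of_sum_le fun s => ?_
    have ht : Filter.Tendsto (fun n => ∑ x ∈ s, majIter y c n x.1 *
        majIter y c n (x.1 + x.2 - a) * majIter y c n x.2) Filter.atTop
        (nhds (∑ x ∈ s, Y x.1 * Y (x.1 + x.2 - a) * Y x.2)) :=
      tendsto_finsetSum _ fun x _ => ((lim _).mul (lim _)).mul (lim _)
    refine le_of_tendsto' ht fun n => ?_
    have h1 := (conv3_summable hν hsub (key n).1 (key n).2.1 a).sum_le_tsum s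
      (fun x _ => mul_nonneg (mul_nonneg ((key n).1 _) ((key n).1 _)) ((key n).1 _))
    have h2 : c * conv3 (majIter y c n) a ≤ Y a := by
      refine le_trans ?_ (leY (n + 1) a)
      simp only [majIter]
      linarith [hy a]
    have h3 : conv3 (majIter y c n) a ≤ 8 * ρ ^ 2 * Y a := by
      have := mul_le_mul_of_nonneg_left h2 (by positivity : (0 : ℝ) ≤ 8 * ρ ^ 2)
      rwa [← mul_assoc, hc, mul_inv_cancel₀ (by positivity), one_mul] at this
    exact h1.trans h3

/-! ### Sub-multiplicative weights -/

theorem exp_weight_le {φ : ℝ → ℝ} {σ : ℝ} (hσ : 0 ≤ σ)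
    (hmono : ∀ x y, 0 ≤ x → x ≤ y → φ x ≤ φ y)
    (hsub : ∀ x y, 0 ≤ x → 0 ≤ y → φ (x + y) ≤ φ x + φ y) (a b d : ℤ) :
    Real.exp (σ * φ |(a : ℝ)|) ≤ Real.exp (σ * φ |(b : ℝ)|) *
      Real.exp (σ * φ |((b + d - a : ℤ) : ℝ)|) * Real.exp (σ * φ |(d : ℝ)|) := by
  rw [← Real.exp_add, ← Real.exp_add, ← mul_add, ← mul_add]
  refine Real.exp_le_exp.2 (mul_le_mul_of_nonneg_left ?_ hσ)
  have h1 : |(a : ℝ)| ≤ |(b : ℝ)| + |((b + d - a : ℤ) : ℝ)| + |(d : ℝ)| := by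
    have : (a : ℝ) = b - ((b + d - a : ℤ) : ℝ) + d := by push_cast; ring
    calc |(a : ℝ)| = |(b : ℝ) - ((b + d - a : ℤ) : ℝ) + d| := by rw [← this]
      _ ≤ |(b : ℝ) - ((b + d - a : ℤ) : ℝ)| + |(d : ℝ)| := abs_add_le _ _
      _ ≤ _ := by gcongr; exact abs_sub _ _
  refine (hmono _ _ (abs_nonneg _) h1).trans ?_
  refine (hsub _ _ (by positivity) (abs_nonneg _)).trans ?_
  gcongr
  exact hsub _ _ (abs_nonneg _) (abs_nonneg _)

theorem rpow_add_le_theta {θ x y : ℝ} (h0 : 0 < θ) (h1 : θ < 1) (hy : 0 ≤ y) (hx : 0 < x)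
    (hyx : y ≤ x) : (x + y) ^ θ ≤ x ^ θ + θ * y ^ θ := by
  have hs0 : 0 ≤ y / x := by positivity
  have hs1 : y / x ≤ 1 := (div_le_one hx).2 hyx
  have e1 : x + y = x * (1 + y / x) := by field_simp
  have e2 : y ^ θ = x ^ θ * (y / x) ^ θ := by
    rw [← Real.mul_rpow hx.le hs0]; congr 1; field_simp
  rw [e1, Real.mul_rpow hx.le (by positivity), e2]
  have b1 : (1 + y / x) ^ θ ≤ 1 + θ * (y / x) :=
    rpow_one_add_le_one_add_mul_self (by linarith) h0.le h1.le
  have b2 : y / x ≤ (y / x) ^ θ := by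
    rcases hs0.eq_or_lt with h | h
    · rw [← h, Real.zero_rpow h0.ne']
    · calc y / x = (y / x) ^ (1 : ℝ) := (Real.rpow_one _).symm
        _ ≤ _ := Real.rpow_le_rpow_of_exponent_ge h hs1 h1.le
  have hx0 : 0 ≤ x ^ θ := Real.rpow_nonneg hx.le _
  have b3 : θ * (y / x) ≤ θ * (y / x) ^ θ := mul_le_mul_of_nonneg_left b2 h0.le
  nlinarith [mul_le_mul_of_nonneg_left (b1.trans (add_le_add_right b3 1)) hx0]

theorem wt_submul {σ θ : ℝ} (hσ : 0 < σ) (h0 : 0 < θ) (h1 : θ < 1) (a b d : ℤ) :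
    wt σ θ a ≤ wt σ θ b * wt σ θ (b + d - a) * wt σ θ d :=
  exp_weight_le (φ := fun x => x ^ θ) hσ.le
    (fun _ _ hx hxy => Real.rpow_le_rpow hx hxy h0.le)
    (fun _ _ hx hy => Real.rpow_add_le_add_rpow hx hy h0.le h1.le) a b d

theorem one_le_wt {σ θ : ℝ} (hσ : 0 < σ) (a : ℤ) : 1 ≤ wt σ θ a :=
  Real.one_le_exp (mul_nonneg hσ.le (Real.rpow_nonneg (abs_nonneg _) _))

/-- A sub-additive modification of `x ↦ x^θ` which is lowered by `(1-θ) N^θ` beyond `N`. -/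
def lowPow (θ N x : ℝ) : ℝ :=
  if x ≤ N then min (x ^ θ) (θ * N ^ θ) else x ^ θ - (1 - θ) * N ^ θ

/-- The exponential weight associated with `lowPow`. -/
def lowWt (σ θ N : ℝ) (a : ℤ) : ℝ := Real.exp (σ * lowPow θ N |(a : ℝ)|)

theorem lowPow_nonneg {θ N x : ℝ} (h0 : 0 < θ) (hN : 0 < N) (hx : 0 ≤ x) :
    0 ≤ lowPow θ N x := by
  unfold lowPow
  have hN' : 0 ≤ N ^ θ := Real.rpow_nonneg hN.le _
  split_ifs with h
  · exact le_min (Real.rpow_nonneg hx _) (by positivity)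
  · have := Real.rpow_le_rpow hN.le (not_le.1 h).le h0.le
    nlinarith

theorem lowPow_mono {θ N x y : ℝ} (h0 : 0 < θ) (hN : 0 < N) (hx : 0 ≤ x) (hxy : x ≤ y) :
    lowPow θ N x ≤ lowPow θ N y := by
  have hxy' := Real.rpow_le_rpow hx hxy h0.le
  unfold lowPow
  split_ifs with h1 h2 h2
  · exact min_le_min_right _ hxy'
  · have := Real.rpow_le_rpow hN.le (not_le.1 h2).le h0.le
    exact (min_le_right _ _).trans (by linarith)
  · exact absurd (hxy.trans h2) h1
  · linarith

theorem lowPow_add_le_of_le {θ N x y : ℝ} (h0 : 0 < θ) (h1 : θ < 1) (hN : 0 < N)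
    (hy : 0 ≤ y) (hyx : y ≤ x) : lowPow θ N (x + y) ≤ lowPow θ N x + lowPow θ N y := by
  rcases hy.eq_or_lt with h | hy0
  · subst h; simpa using lowPow_nonneg h0 hN le_rfl
  have hx : 0 < x := hy0.trans_le hyx
  have hadd := rpow_add_le_theta h0 h1 hy hx hyx
  have hadd' := Real.rpow_add_le_add_rpow hx.le hy h0.le h1.le
  have hN' : 0 < N ^ θ := Real.rpow_pos_of_pos hN _
  have hx' : 0 < x ^ θ := Real.rpow_pos_of_pos hx _
  have hy' : 0 < y ^ θ := Real.rpow_pos_of_pos hy0 _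
  have up : ∀ u, u ≤ N → 0 ≤ u → θ * u ^ θ ≤ min (u ^ θ) (θ * N ^ θ) := fun u hu hu0 => by
    have := Real.rpow_le_rpow hu0 hu h0.le
    have hu' : 0 ≤ u ^ θ := Real.rpow_nonneg hu0 _
    exact le_min (by nlinarith) (by nlinarith)
  have up2 : θ * y ^ θ ≤ lowPow θ N y := by
    unfold lowPow
    split_ifs with h
    · exact up y h hy
    · have := Real.rpow_le_rpow hN.le (not_le.1 h).le h0.le
      nlinarith
  by_cases hxyN : x + y ≤ N
  · have hxN : x ≤ N := by linarith
    have hyN : y ≤ N := by linarith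
    simp only [lowPow, hxyN, hxN, hyN, if_true]
    rcases min_cases (x ^ θ) (θ * N ^ θ) with ⟨e, _⟩ | ⟨e, _⟩ <;>
    rcases min_cases (y ^ θ) (θ * N ^ θ) with ⟨e', _⟩ | ⟨e', _⟩ <;> rw [e, e']
    · exact (min_le_left _ _).trans hadd'
    · exact (min_le_right _ _).trans (by linarith)
    · exact (min_le_right _ _).trans (by linarith)
    · exact (min_le_right _ _).trans (by nlinarith)
  · have e : lowPow θ N (x + y) = (x + y) ^ θ - (1 - θ) * N ^ θ := by
      simp only [lowPow, hxyN, if_false]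
    rw [e]
    have hx2 : x ^ θ - (1 - θ) * N ^ θ ≤ lowPow θ N x := by
      unfold lowPow
      split_ifs with h
      · have := Real.rpow_le_rpow hx.le h h0.le
        exact le_min (by nlinarith) (by nlinarith)
      · exact le_rfl
    linarith

theorem lowPow_add_le {θ N x y : ℝ} (h0 : 0 < θ) (h1 : θ < 1) (hN : 0 < N)
    (hx : 0 ≤ x) (hy : 0 ≤ y) : lowPow θ N (x + y) ≤ lowPow θ N x + lowPow θ N y := by
  rcases le_total y x with h | h
  · exact lowPow_add_le_of_le h0 h1 hN hy h
  · rw [add_comm x y, add_comm (lowPow θ N x)]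
    exact lowPow_add_le_of_le h0 h1 hN hx h

theorem lowWt_submul {σ θ N : ℝ} (hσ : 0 < σ) (h0 : 0 < θ) (h1 : θ < 1) (hN : 0 < N)
    (a b d : ℤ) :
    lowWt σ θ N a ≤ lowWt σ θ N b * lowWt σ θ N (b + d - a) * lowWt σ θ N d :=
  exp_weight_le (φ := lowPow θ N) hσ.le (fun _ _ hx hxy => lowPow_mono h0 hN hx hxy)
    (fun _ _ hx hy => lowPow_add_le h0 h1 hN hx hy) a b d

theorem one_le_lowWt {σ θ N : ℝ} (hσ : 0 < σ) (h0 : 0 < θ) (hN : 0 < N) (a : ℤ) :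
    1 ≤ lowWt σ θ N a :=
  Real.one_le_exp (mul_nonneg hσ.le (lowPow_nonneg h0 hN (abs_nonneg _)))

theorem lowWt_le_wt {σ θ N : ℝ} (hσ : 0 < σ) (h1 : θ < 1) (hN : 0 < N) (a : ℤ) :
    lowWt σ θ N a ≤ wt σ θ a := by
  refine Real.exp_le_exp.2 (mul_le_mul_of_nonneg_left ?_ hσ.le)
  have hN' : 0 < N ^ θ := Real.rpow_pos_of_pos hN _
  unfold lowPow
  split_ifs
  · exact min_le_left _ _
  · nlinarith

theorem lowWt_mul_le_wt {σ θ N : ℝ} {a : ℤ} (ha : N < |(a : ℝ)|) :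
    lowWt σ θ N a * Real.exp (σ * (1 - θ) * N ^ θ) = wt σ θ a := by
  rw [lowWt, wt, ← Real.exp_add, lowPow, if_neg (not_le.2 ha)]
  congr 1; ring

theorem wt_le_mul_lowWt {σ θ N : ℝ} (hσ : 0 < σ) (h0 : 0 < θ) (h1 : θ < 1) (hN : 0 < N)
    (a : ℤ) : wt σ θ a ≤ Real.exp (σ * (1 - θ) * N ^ θ) * lowWt σ θ N a := by
  rw [lowWt, wt, ← Real.exp_add, mul_assoc, ← mul_add]
  refine Real.exp_le_exp.2 (mul_le_mul_of_nonneg_left ?_ hσ.le)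
  have hN' : 0 < N ^ θ := Real.rpow_pos_of_pos hN _
  unfold lowPow
  split_ifs with h
  · have := Real.rpow_le_rpow (abs_nonneg _) h h0.le
    rcases min_cases (|(a : ℝ)| ^ θ) (θ * N ^ θ) with ⟨e, _⟩ | ⟨e, _⟩ <;> rw [e] <;> nlinarith
  · linarith

/-! ### Monomials and their time derivatives -/

/-- The sign attached to a conjugation flag. -/
def sg (b : Bool) : ℤ := if b then 1 else -1

/-- Complex conjugation of an index. -/
def flipI (i : Bool × ℤ) : Bool × ℤ := (!i.1, i.2)

/-- The coordinate `z_a` or its conjugate. -/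
def wv (z : ℤ → ℂ) (i : Bool × ℤ) : ℂ :=
  if i.1 then z i.2 else (starRingEnd ℂ) (z i.2)

/-- The monomial indexed by a multiset of indices. -/
def mon (z : ℤ → ℂ) (S : Multiset (Bool × ℤ)) : ℂ := (S.map (wv z)).prod

/-- The interaction kernel `(a - e)⁻²`, zero on the diagonal. -/
def qk (a e : ℤ) : ℝ := (((a : ℝ) - e) ^ 2)⁻¹

/-- The coefficients of the nonlinearity without its diagonal part. -/
def cf (a : ℤ) (x : ℤ × ℤ) : ℝ := if x.1 = a then 0 else qk a x.2

/-- The three indices replacing `i` in the nonlinearity. -/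
def trip (i : Bool × ℤ) (x : ℤ × ℤ) : Multiset (Bool × ℤ) :=
  {(i.1, x.1), (!i.1, x.1 + x.2 - i.2), (i.1, x.2)}

/-- The multi-index obtained from `S` by substituting the nonlinearity for `i`. -/
def kid (S : Multiset (Bool × ℤ)) (i : Bool × ℤ) (x : ℤ × ℤ) : Multiset (Bool × ℤ) :=
  trip i x + S.erase i

/-- The multi-index of `|z_e|²`. -/
def sq2 (e : ℤ) : Multiset (Bool × ℤ) := {(true, e), (false, e)}

/-- The frequency modulation. -/
def Om (z : ℤ → ℂ) (a : ℤ) : ℝ := ∑' e, qk a e * ‖z e‖ ^ 2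

/-- The non-diagonal part of the nonlinearity. -/
def Nn (z : ℤ → ℂ) (a : ℤ) : ℂ :=
  ∑' x : ℤ × ℤ, (cf a x : ℂ) * (z x.1 * (starRingEnd ℂ) (z (x.1 + x.2 - a)) * z x.2)

/-- The vector field of the equation. -/
def vf (z : ℤ → ℂ) (a : ℤ) : ℂ := Complex.I * (((a : ℂ) ^ 2 + Om z a) * z a + Nn z a)

/-- The unperturbed resonance function. -/
def dl (S : Multiset (Bool × ℤ)) : ℤ := (S.map fun i => sg i.1 * i.2 ^ 2).sum

/-- The momentum. -/
def mo (S : Multiset (Bool × ℤ)) : ℤ := (S.map fun i => sg i.1 * i.2).sum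

/-- The charge. -/
def ch (S : Multiset (Bool × ℤ)) : ℤ := (S.map fun i => sg i.1).sum

/-- The modulated frequency of a multi-index. -/
def fr (z : ℤ → ℂ) (S : Multiset (Bool × ℤ)) : ℝ := (S.map fun i => sg i.1 * Om z i.2).sum

/-- The contribution of the non-diagonal nonlinearity to `-(Re z_S)'`. -/
def RR (z : ℤ → ℂ) (S : Multiset (Bool × ℤ)) : ℝ :=
  (S.map fun i => (sg i.1 : ℝ) * ∑' x, cf i.2 x * (mon z (kid S i x)).im).sum

theorem qk_nonneg (a e : ℤ) : 0 ≤ qk a e := by unfold qk; positivity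

theorem qk_self (a : ℤ) : qk a a = 0 := by simp [qk]

theorem qk_le_one (a e : ℤ) : qk a e ≤ 1 := by
  unfold qk
  by_cases h : a = e
  · simp [h]
  · apply inv_le_one_of_one_le₀
    have h1 : (1 : ℤ) ≤ (a - e) ^ 2 := by
      have : a - e ≠ 0 := sub_ne_zero.2 h
      have := sq_pos_of_ne_zero this
      omega
    exact_mod_cast h1

theorem cf_nonneg (a : ℤ) (x : ℤ × ℤ) : 0 ≤ cf a x := by
  unfold cf; split_ifs
  · exact le_rfl
  · exact qk_nonneg _ _

theorem cf_le_one (a : ℤ) (x : ℤ × ℤ) : cf a x ≤ 1 := by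
  unfold cf; split_ifs
  · exact zero_le_one
  · exact qk_le_one _ _

theorem mon_add (z : ℤ → ℂ) (S R : Multiset (Bool × ℤ)) : mon z (S + R) = mon z S * mon z R := by
  simp [mon]

theorem norm_wv (z : ℤ → ℂ) (i : Bool × ℤ) : ‖wv z i‖ = ‖z i.2‖ := by
  unfold wv; split_ifs <;> simp

theorem wv_flipI (z : ℤ → ℂ) (i : Bool × ℤ) : wv z (flipI i) = (starRingEnd ℂ) (wv z i) := by
  rcases i with ⟨b, a⟩; cases b <;> simp [wv, flipI]

theorem mon_flip (z : ℤ → ℂ) (S : Multiset (Bool × ℤ)) :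
    mon z (S.map flipI) = (starRingEnd ℂ) (mon z S) := by
  induction S using Multiset.induction_on with
  | empty => simp [mon]
  | cons i S ih =>
    simp only [mon, Multiset.map_cons, Multiset.prod_cons, map_mul] at ih ⊢
    rw [ih, wv_flipI]

theorem mon_im_eq_zero (z : ℤ → ℂ) {S : Multiset (Bool × ℤ)} (h : S.map flipI = S) :
    (mon z S).im = 0 := by
  have := mon_flip z S
  rw [h] at this
  exact Complex.conj_eq_iff_im.1 this.symm

theorem mon_sq2 (z : ℤ → ℂ) (e : ℤ) : mon z (sq2 e) = ((‖z e‖ ^ 2 : ℝ) : ℂ) := by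
  simp [mon, sq2, wv, Complex.mul_conj, Complex.normSq_eq_norm_sq]

theorem norm_mon_le {z : ℤ → ℂ} {y : ℤ → ℝ} (h : ∀ a, ‖z a‖ ≤ y a) (S : Multiset (Bool × ℤ)) :
    ‖mon z S‖ ≤ (S.map fun i => y i.2).prod := by
  induction S using Multiset.induction_on with
  | empty => simp [mon]
  | cons i S ih =>
    simp only [mon, Multiset.map_cons, Multiset.prod_cons, norm_mul] at ih ⊢
    rw [norm_wv]
    exact mul_le_mul (h _) ih (norm_nonneg _) ((norm_nonneg _).trans (h _))

theorem mon_kid {z : ℤ → ℂ} (S : Multiset (Bool × ℤ)) (i : Bool × ℤ) (x : ℤ × ℤ) :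
    mon z (kid S i x) = mon z (trip i x) * mon z (S.erase i) := mon_add _ _ _

theorem kid_add {S R : Multiset (Bool × ℤ)} {i : Bool × ℤ} (hi : i ∈ S) (x : ℤ × ℤ) :
    kid (S + R) i x = kid S i x + R := by
  rw [kid, kid, Multiset.erase_add_left_pos _ hi, add_assoc]

theorem re_mul_im_eq (z : ℤ → ℂ) (S R : Multiset (Bool × ℤ)) :
    (mon z S).re * (mon z R).im =
      2⁻¹ * ((mon z (R + S)).im + (mon z (R + S.map flipI)).im) := by
  rw [mon_add, mon_add, mon_flip]
  simp only [Complex.mul_im, Complex.conj_re, Complex.conj_im]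
  ring

theorem HasDerivAt.multiset_map_prod {ι : Type*} [DecidableEq ι] {g : ι → ℝ → ℂ} {g' : ι → ℂ} {t : ℝ}
    (S : Multiset ι) (h : ∀ i ∈ S, HasDerivAt (g i) (g' i) t) :
    HasDerivAt (fun s => (S.map fun i => g i s).prod)
      ((S.map fun i => ((S.erase i).map fun k => g k t).prod * g' i).sum) t := by
  have := (HasFDerivAt.multiset_prod (u := S) (g := g)
    (g' := fun i => ContinuousLinearMap.toSpanSingleton ℝ (g' i)) (x := t)
    (fun i hi => (h i hi).hasFDerivAt)).hasDerivAt
  refine this.congr_deriv ?_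
  generalize hF : (fun i => (Multiset.map (fun x => g x t) (S.erase i)).prod •
    ContinuousLinearMap.toSpanSingleton ℝ (g' i)) = F
  have hF' : (fun i => (Multiset.map (fun k => g k t) (S.erase i)).prod * g' i) =
      fun i => F i 1 := by
    rw [← hF]; funext i; simp
  rw [hF']
  generalize S = R
  induction R using Multiset.induction_on with
  | empty => simp
  | cons i R ih => simp [ih]

theorem hasDerivAt_wv {z : ℝ → ℤ → ℂ} {t : ℝ}
    (h : ∀ a, HasDerivAt (fun s => z s a) (vf (z t) a) t)
    (i : Bool × ℤ) :
    HasDerivAt (fun s => wv (z s) i)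
      (Complex.I * (sg i.1 * (((i.2 : ℂ) ^ 2 + Om (z t) i.2) * wv (z t) i +
        ∑' x, (cf i.2 x : ℂ) * mon (z t) (trip i x)))) t := by
  rcases i with ⟨b, a⟩
  cases b
  · have := (h a).star
    refine (this.congr_deriv ?_).congr_of_eventuallyEq (.of_forall fun s => by simp [wv])
    simp only [wv, sg, Bool.false_eq_true, if_false, vf, Nn, star_mul', star_add,
      Complex.star_def, Complex.conj_I, map_pow,
      Complex.conj_ofReal, map_intCast]
    rw [Complex.conj_tsum]
    simp only [map_mul, Complex.conj_ofReal, Complex.conj_conj, trip, mon, Multiset.insert_eq_cons,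
      Multiset.map_cons, Multiset.map_singleton, Multiset.prod_cons, Multiset.prod_singleton, wv,
      Bool.not_false, if_true, Bool.false_eq_true, if_false]
    push_cast
    simp only [mul_assoc]
    ring
  · refine ((h a).congr_deriv ?_).congr_of_eventuallyEq (.of_forall fun s => by simp [wv])
    simp only [wv, sg, vf, Nn, trip, mon, Multiset.insert_eq_cons, Bool.not_true,
      Multiset.map_cons, Multiset.map_singleton, Multiset.prod_cons, Multiset.prod_singleton,
      if_true, Bool.false_eq_true, if_false]
    push_cast
    simp only [mul_assoc, one_mul]

theorem hasDerivAt_mon_re {z : ℝ → ℤ → ℂ} {t : ℝ}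
    (h : ∀ a, HasDerivAt (fun s => z s a) (vf (z t) a) t)
    (hs : ∀ a, Summable fun x : ℤ × ℤ =>
      ‖z t x.1‖ * ‖z t (x.1 + x.2 - a)‖ * ‖z t x.2‖) (S : Multiset (Bool × ℤ)) :
    HasDerivAt (fun s => (mon (z s) S).re)
      (-(dl S + fr (z t) S) * (mon (z t) S).im - RR (z t) S) t := by
  have h1 := HasDerivAt.multiset_map_prod (g := fun i s => wv (z s) i) S
    (fun i _ => hasDerivAt_wv h i)
  have h2 := (Complex.reCLM.hasFDerivAt.comp_hasDerivAt t h1)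
  have e : (Complex.reCLM ((S.map fun i => ((S.erase i).map fun k => wv (z t) k).prod *
      (Complex.I * (sg i.1 * (((i.2 : ℂ) ^ 2 + Om (z t) i.2) * wv (z t) i +
        ∑' x, (cf i.2 x : ℂ) * mon (z t) (trip i x))))).sum)) =
      (-(dl S + fr (z t) S) * (mon (z t) S).im - RR (z t) S) := by
    rw [map_multiset_sum, Multiset.map_map, dl, fr, RR]
    have e2 : ∀ i ∈ S, (Complex.reCLM ∘ fun i => ((S.erase i).map fun k => wv (z t) k).prod *
      (Complex.I * (sg i.1 * (((i.2 : ℂ) ^ 2 + Om (z t) i.2) * wv (z t) i +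
        ∑' x, (cf i.2 x : ℂ) * mon (z t) (trip i x))))) i =
        (fun i : Bool × ℤ => -(((sg i.1 * i.2 ^ 2 : ℤ) : ℝ) + sg i.1 * Om (z t) i.2) *
          (mon (z t) S).im - sg i.1 * ∑' x, cf i.2 x * (mon (z t) (kid S i x)).im) i := by
      intro i hi
      have s0 : Summable fun x => (cf i.2 x : ℂ) * mon (z t) (trip i x) := by
        refine Summable.of_norm_bounded (hs i.2) fun x => ?_
        rw [norm_mul, Complex.norm_real, Real.norm_of_nonneg (cf_nonneg _ _)]
        have : ‖mon (z t) (trip i x)‖ =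
            ‖z t x.1‖ * ‖z t (x.1 + x.2 - i.2)‖ * ‖z t x.2‖ := by
          simp [mon, trip, norm_wv, mul_assoc]
        rw [← this]
        exact mul_le_of_le_one_left (norm_nonneg _) (cf_le_one _ _)
      have s1 : mon (z t) (S.erase i) * wv (z t) i = mon (z t) S := by
        conv_rhs => rw [← Multiset.cons_erase hi]
        simp [mon, mul_comm]
      have s2 : mon (z t) (S.erase i) * ∑' x, (cf i.2 x : ℂ) * mon (z t) (trip i x) =
          ∑' x, (cf i.2 x : ℂ) * mon (z t) (kid S i x) := by
        rw [← tsum_mul_left]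
        refine tsum_congr fun x => ?_
        rw [mon_kid]; ring
      have s3 : Summable fun x => (cf i.2 x : ℂ) * mon (z t) (kid S i x) := by
        refine (s0.mul_left (mon (z t) (S.erase i))).congr fun x => ?_
        rw [mon_kid]; ring
      have s4 : (∑' x, (cf i.2 x : ℂ) * mon (z t) (kid S i x)).im =
          ∑' x, cf i.2 x * (mon (z t) (kid S i x)).im := by
        rw [Complex.im_tsum s3]
        refine tsum_congr fun x => ?_
        simp
      have s5 : mon (z t) (S.erase i) *
      (Complex.I * (sg i.1 * (((i.2 : ℂ) ^ 2 + Om (z t) i.2) * wv (z t) i +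
        ∑' x, (cf i.2 x : ℂ) * mon (z t) (trip i x)))) =
        Complex.I * ((((sg i.1 : ℝ) * ((i.2 : ℝ) ^ 2 + Om (z t) i.2) : ℝ) : ℂ) * mon (z t) S +
        ((sg i.1 : ℝ) : ℂ) * ∑' x, (cf i.2 x : ℂ) * mon (z t) (kid S i x)) := by
        rw [← s1, ← s2]; push_cast; ring
      simp only [Function.comp_apply, Complex.reCLM_apply]
      change (mon (z t) (S.erase i) * _).re = _
      rw [s5, Complex.I_mul_re, Complex.add_im, Complex.im_ofReal_mul, Complex.im_ofReal_mul, s4]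
      push_cast; ring
    rw [Multiset.map_congr rfl e2, Multiset.sum_map_sub, Multiset.sum_map_mul_right]
    congr 1
    congr 1
    rw [Multiset.sum_map_neg, Multiset.sum_map_add]
    congr 2
    change _ = Int.castAddHom ℝ _
    rw [map_multiset_sum, Multiset.map_map]
    rfl
  rw [← e]
  exact h2

/-! ### Functions with controlled size and controlled primitive -/

/-- `f` is continuous on `(-τ, τ)`, bounded by `u`, and its primitive vanishing at zero is bounded
by `B`. -/
structure Tame (τ : ℝ) (f : ℝ → ℝ) (u B : ℝ) : Prop where
  cont : ContinuousOn f (Set.Ioo (-τ) τ)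
  bd : ∀ t ∈ Set.Ioo (-τ) τ, |f t| ≤ u
  int : ∀ t ∈ Set.Ioo (-τ) τ, |∫ s in (0 : ℝ)..t, f s| ≤ B

theorem uIcc_subset_Ioo_symm {τ t : ℝ} (ht : t ∈ Set.Ioo (-τ) τ) :
    Set.uIcc 0 t ⊆ Set.Ioo (-τ) τ := by
  have h0 : (0 : ℝ) ∈ Set.Ioo (-τ) τ := ⟨by linarith [ht.1, ht.2], by linarith [ht.1, ht.2]⟩
  exact Set.OrdConnected.uIcc_subset inferInstance h0 ht

theorem ContinuousOn.intervalIntegrable_Ioo_symm {τ t : ℝ} {f : ℝ → ℝ}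
    (hf : ContinuousOn f (Set.Ioo (-τ) τ)) (ht : t ∈ Set.Ioo (-τ) τ) :
    IntervalIntegrable f MeasureTheory.volume 0 t :=
  (hf.mono (uIcc_subset_Ioo_symm ht)).intervalIntegrable

namespace Tame

variable {τ : ℝ}

theorem congr {f g : ℝ → ℝ} {u B : ℝ} (h : Tame τ f u B)
    (hfg : ∀ t ∈ Set.Ioo (-τ) τ, g t = f t) : Tame τ g u B where
  cont := h.cont.congr hfg
  bd t ht := by rw [hfg t ht]; exact h.bd t ht
  int t ht := by
    rw [intervalIntegral.integral_congr fun s hs => hfg s (uIcc_subset_Ioo_symm ht hs)]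
    exact h.int t ht

theorem mono {f : ℝ → ℝ} {u B u' B' : ℝ} (h : Tame τ f u B) (hu : u ≤ u') (hB : B ≤ B') :
    Tame τ f u' B' :=
  ⟨h.cont, fun t ht => (h.bd t ht).trans hu, fun t ht => (h.int t ht).trans hB⟩

theorem zero {u B : ℝ} (hu : 0 ≤ u) (hB : 0 ≤ B) : Tame τ (fun _ => 0) u B :=
  ⟨continuousOn_const, fun _ _ => by simpa using hu, fun _ _ => by simpa using hB⟩

theorem of_bound {f : ℝ → ℝ} {u : ℝ} (hc : ContinuousOn f (Set.Ioo (-τ) τ))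
    (hb : ∀ t ∈ Set.Ioo (-τ) τ, |f t| ≤ u) : Tame τ f u (τ * u) := by
  refine ⟨hc, hb, fun t ht => ?_⟩
  have hu : 0 ≤ u := (abs_nonneg _).trans (hb t ht)
  have h1 := intervalIntegral.norm_integral_le_of_norm_le_const (a := 0) (b := t) (C := u)
    (f := f) fun s hs => hb s (uIcc_subset_Ioo_symm ht (Set.uIoc_subset_uIcc hs))
  rw [Real.norm_eq_abs, sub_zero, mul_comm] at h1
  exact h1.trans (mul_le_mul_of_nonneg_right (abs_lt.2 ht).le hu)

theorem add {f g : ℝ → ℝ} {u B u' B' : ℝ} (hf : Tame τ f u B) (hg : Tame τ g u' B') :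
    Tame τ (fun t => f t + g t) (u + u') (B + B') := by
  refine ⟨hf.cont.add hg.cont, fun t ht => ?_, fun t ht => ?_⟩
  · exact (abs_add_le _ _).trans (add_le_add (hf.bd t ht) (hg.bd t ht))
  · rw [intervalIntegral.integral_add (hf.cont.intervalIntegrable_Ioo_symm ht)
      (hg.cont.intervalIntegrable_Ioo_symm ht)]
    exact (abs_add_le _ _).trans (add_le_add (hf.int t ht) (hg.int t ht))

theorem const_mul {f : ℝ → ℝ} {u B : ℝ} (hf : Tame τ f u B) (c : ℝ) :
    Tame τ (fun t => c * f t) (|c| * u) (|c| * B) := by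
  refine ⟨hf.cont.const_mul c, fun t ht => ?_, fun t ht => ?_⟩
  · rw [abs_mul]; exact mul_le_mul_of_nonneg_left (hf.bd t ht) (abs_nonneg _)
  · rw [intervalIntegral.integral_const_mul, abs_mul]
    exact mul_le_mul_of_nonneg_left (hf.int t ht) (abs_nonneg _)

theorem const_mul_le_one (hτ : 0 < τ) {f : ℝ → ℝ} {u B : ℝ} (hf : Tame τ f u B) {c : ℝ}
    (hc : |c| ≤ 1) : Tame τ (fun t => c * f t) u B := by
  have h0 : (0 : ℝ) ∈ Set.Ioo (-τ) τ := ⟨by linarith, hτ⟩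
  exact (hf.const_mul c).mono
    (mul_le_of_le_one_left ((abs_nonneg _).trans (hf.bd 0 h0)) hc)
    (mul_le_of_le_one_left ((abs_nonneg _).trans (hf.int 0 h0)) hc)

theorem multiset_sum {ι : Type*} (S : Multiset ι) {f : ι → ℝ → ℝ} {u B : ℝ}
    (h : ∀ i ∈ S, Tame τ (f i) u B) :
    Tame τ (fun t => (S.map fun i => f i t).sum) (S.card * u) (S.card * B) := by
  induction S using Multiset.induction_on with
  | empty => simpa using Tame.zero le_rfl le_rfl
  | cons i S ih =>
    have := (h i (Multiset.mem_cons_self _ _)).add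
      (ih fun k hk => h k (Multiset.mem_cons_of_mem hk))
    simp only [Multiset.map_cons, Multiset.sum_cons, Multiset.card_cons]
    refine this.mono (le_of_eq ?_) (le_of_eq ?_) <;> push_cast <;> ring

theorem tsum {ι : Type*} [Countable ι] {f : ι → ℝ → ℝ} {u B : ι → ℝ}
    (h : ∀ i, Tame τ (f i) (u i) (B i)) (hu : Summable u) (hB : Summable B) :
    Tame τ (fun t => ∑' i, f i t) (∑' i, u i) (∑' i, B i) := by
  refine ⟨continuousOn_tsum (fun i => (h i).cont) hu fun i t ht => (h i).bd t ht,
    fun t ht => tsum_of_norm_bounded (f := fun i => f i t) hu.hasSum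
      fun i => (h i).bd t ht, fun t ht => ?_⟩
  have hsub : Set.uIoc 0 t ⊆ Set.Ioo (-τ) τ :=
    Set.uIoc_subset_uIcc.trans (uIcc_subset_Ioo_symm ht)
  have hs := intervalIntegral.hasSum_integral_of_dominated_convergence
    (μ := MeasureTheory.volume) (a := 0) (b := t) (F := f)
    (f := fun s => ∑' i, f i s) (fun i _ => u i)
    (fun i => ((h i).cont.mono hsub).aestronglyMeasurable measurableSet_uIoc)
    (fun i => .of_forall fun s hs => (h i).bd s (hsub hs))
    (.of_forall fun s _ => hu) (by simp)
    (.of_forall fun s hs => (Summable.of_norm_bounded hu fun i => (h i).bd s (hsub hs)).hasSum)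
  rw [← hs.tsum_eq]
  exact tsum_of_norm_bounded (f := fun i => ∫ s in (0 : ℝ)..t, f i s) hB.hasSum
    fun i => (h i).int t ht

end Tame

/-! ### Flows together with a functional controlling monomials -/

/-- A solution on `(-τ, τ)` of the equation, dominated by `y`, together with a functional `Q`
on multi-indices which dominates monomials and is almost preserved by substitution. -/
structure ModeFlow (z : ℝ → ℤ → ℂ) (τ : ℝ) (y : ℤ → ℝ) (Q : Multiset (Bool × ℤ) → ℝ)
    (κ η : ℝ) : Prop where
  pos : 0 < τ
  kap : 0 ≤ κ
  eta : 0 ≤ η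
  ode : ∀ t ∈ Set.Ioo (-τ) τ, ∀ a, HasDerivAt (fun s => z s a) (vf (z t) a) t
  bd : ∀ t ∈ Set.Ioo (-τ) τ, ∀ a, ‖z t a‖ ≤ y a
  nonneg : ∀ S, 0 ≤ Q S
  sum_kid : ∀ S, ∀ i ∈ S, Summable fun x => Q (kid S i x)
  tsum_kid : ∀ S, ∀ i ∈ S, ∑' x, Q (kid S i x) ≤ κ * Q S
  sum_sq2 : ∀ S, Summable fun e => Q (sq2 e + S)
  tsum_sq2 : ∀ S, ∑' e, Q (sq2 e + S) ≤ η * Q S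
  dom : ∀ S : Multiset (Bool × ℤ), (S.map fun i => y i.2).prod ≤ Q S
  flip : ∀ S R, Q (R + S.map flipI) = Q (R + S)

namespace ModeFlow

variable {z : ℝ → ℤ → ℂ} {τ : ℝ} {y : ℤ → ℝ} {Q : Multiset (Bool × ℤ) → ℝ} {κ η : ℝ}

theorem norm_mon (F : ModeFlow z τ y Q κ η) {t : ℝ} (ht : t ∈ Set.Ioo (-τ) τ)
    (S : Multiset (Bool × ℤ)) : ‖mon (z t) S‖ ≤ Q S :=
  (norm_mon_le (F.bd t ht) S).trans (F.dom S)

theorem continuousOn_mon (F : ModeFlow z τ y Q κ η) (S : Multiset (Bool × ℤ)) :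
    ContinuousOn (fun t => mon (z t) S) (Set.Ioo (-τ) τ) := by
  induction S using Multiset.induction_on with
  | empty => simpa [mon] using continuousOn_const
  | cons i S ih =>
    simp only [mon, Multiset.map_cons, Multiset.prod_cons] at ih ⊢
    refine ContinuousOn.mul ?_ ih
    have hc : ContinuousOn (fun t => z t i.2) (Set.Ioo (-τ) τ) :=
      fun t ht => (F.ode t ht i.2).continuousAt.continuousWithinAt
    rcases i with ⟨b, a⟩
    cases b
    · simpa [wv, Function.comp_def] using Complex.continuous_conj.comp_continuousOn hc
    · simpa [wv] using hc

theorem tame_RR (F : ModeFlow z τ y Q κ η) {g : ℝ → ℝ} {S R : Multiset (Bool × ℤ)} {u c : ℝ}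
    (hu : 0 ≤ u) (hc : 0 ≤ c)
    (h : ∀ i ∈ S, ∀ x : ℤ × ℤ, x.1 ≠ i.2 → x.2 ≠ i.2 →
      Tame τ (fun t => g t * (mon (z t) (kid S i x)).im) (u * Q (kid (S + R) i x))
        (c * Q (kid (S + R) i x))) :
    Tame τ (fun t => g t * RR (z t) S) (S.card * (κ * u * Q (S + R)))
      (S.card * (κ * c * Q (S + R))) := by
  have key : ∀ i ∈ S, Tame τ (fun t => (sg i.1 : ℝ) * ∑' x,
      cf i.2 x * (g t * (mon (z t) (kid S i x)).im)) (κ * u * Q (S + R))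
      (κ * c * Q (S + R)) := by
    intro i hi
    have hi' : i ∈ S + R := Multiset.mem_add.2 (Or.inl hi)
    have h1 : ∀ x : ℤ × ℤ, Tame τ (fun t => cf i.2 x * (g t * (mon (z t) (kid S i x)).im))
        (u * Q (kid (S + R) i x)) (c * Q (kid (S + R) i x)) := by
      intro x
      by_cases hx : x.1 ≠ i.2 ∧ x.2 ≠ i.2
      · refine (h i hi x hx.1 hx.2).const_mul_le_one F.pos ?_
        rw [abs_of_nonneg (cf_nonneg _ _)]; exact cf_le_one _ _
      · have h0 : cf i.2 x = 0 := by
          unfold cf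
          split_ifs with h2
          · rfl
          · have : x.2 = i.2 := by by_contra h3; exact hx ⟨h2, h3⟩
            rw [this, qk_self]
        simp only [h0, zero_mul]
        exact Tame.zero (mul_nonneg hu (F.nonneg _)) (mul_nonneg hc (F.nonneg _))
    have h2 := Tame.tsum h1 ((F.sum_kid _ i hi').mul_left u) ((F.sum_kid _ i hi').mul_left c)
    rw [tsum_mul_left, tsum_mul_left] at h2
    refine (h2.const_mul_le_one F.pos ?_).mono ?_ ?_
    · unfold sg; split_ifs <;> simp
    · have := mul_le_mul_of_nonneg_left (F.tsum_kid _ i hi') hu; linarith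
    · have := mul_le_mul_of_nonneg_left (F.tsum_kid _ i hi') hc; linarith
  refine (Tame.multiset_sum S key).congr fun t _ => ?_
  rw [RR, ← Multiset.sum_map_mul_left]
  congr 1
  refine Multiset.map_congr rfl fun i _ => ?_
  rw [mul_left_comm, ← tsum_mul_left]
  congr 1
  exact tsum_congr fun x => by ring

theorem tame_RR_one (F : ModeFlow z τ y Q κ η) (S : Multiset (Bool × ℤ)) :
    Tame τ (fun t => RR (z t) S) (S.card * (κ * Q S)) (S.card * (κ * τ * Q S)) := by
  have := F.tame_RR (g := fun _ => 1) (S := S) (R := 0) (u := 1) (c := τ) zero_le_one F.pos.le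
    (fun i _ x _ _ => by
      simp only [add_zero, one_mul]
      refine Tame.of_bound ?_ fun t ht => ?_
      · exact Complex.continuous_im.comp_continuousOn (F.continuousOn_mon _)
      · exact (Complex.abs_im_le_norm _).trans (F.norm_mon ht _))
  simpa using this

theorem summable_norm_sq (F : ModeFlow z τ y Q κ η) {t : ℝ} (ht : t ∈ Set.Ioo (-τ) τ) :
    Summable fun e => ‖z t e‖ ^ 2 := by
  refine Summable.of_nonneg_of_le (fun _ => by positivity) (fun e => ?_) (F.sum_sq2 0)
  have := F.norm_mon ht (sq2 e)
  rw [mon_sq2, Complex.norm_real, Real.norm_of_nonneg (by positivity)] at this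
  simpa using this

theorem summable_triple (F : ModeFlow z τ y Q κ η) {t : ℝ} (ht : t ∈ Set.Ioo (-τ) τ) (a : ℤ) :
    Summable fun x : ℤ × ℤ => ‖z t x.1‖ * ‖z t (x.1 + x.2 - a)‖ * ‖z t x.2‖ := by
  refine Summable.of_nonneg_of_le (fun _ => by positivity) (fun x => ?_)
    (F.sum_kid {(true, a)} (true, a) (Multiset.mem_singleton_self _))
  have := F.norm_mon ht (kid {(true, a)} (true, a) x)
  refine le_trans (le_of_eq ?_) this
  simp [mon, kid, trip, norm_wv, mul_assoc]

theorem hasDerivAt_re (F : ModeFlow z τ y Q κ η) {t : ℝ} (ht : t ∈ Set.Ioo (-τ) τ)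
    (S : Multiset (Bool × ℤ)) :
    HasDerivAt (fun s => (mon (z s) S).re)
      (-(dl S + fr (z t) S) * (mon (z t) S).im - RR (z t) S) t :=
  hasDerivAt_mon_re (F.ode t ht) (F.summable_triple ht) S

theorem hasDerivAt_norm_sq (F : ModeFlow z τ y Q κ η) {t : ℝ} (ht : t ∈ Set.Ioo (-τ) τ) (e : ℤ) :
    HasDerivAt (fun s => ‖z s e‖ ^ 2) (-RR (z t) (sq2 e)) t := by
  have := F.hasDerivAt_re ht (sq2 e)
  simpa only [mon_sq2, Complex.ofReal_re, Complex.ofReal_im, mul_zero, zero_sub] using this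

/-- The derivative of a modulated frequency, up to sign. -/
def _root_.FR (z : ℤ → ℂ) (k : Multiset (Bool × ℤ)) : ℝ :=
  (k.map fun i => (sg i.1 : ℝ) * ∑' e, qk i.2 e * RR z (sq2 e)).sum

theorem hasDerivAt_Om (F : ModeFlow z τ y Q κ η) {t : ℝ} (ht : t ∈ Set.Ioo (-τ) τ) (a : ℤ) :
    HasDerivAt (fun s => Om (z s) a) (-∑' e, qk a e * RR (z t) (sq2 e)) t := by
  have hb : ∀ e, ∀ s ∈ Set.Ioo (-τ) τ,
      ‖qk a e * -RR (z s) (sq2 e)‖ ≤ 2 * κ * Q (sq2 e + 0) := by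
    intro e s hs
    rw [norm_mul, norm_neg, Real.norm_of_nonneg (qk_nonneg _ _)]
    refine (mul_le_of_le_one_left (norm_nonneg _) (qk_le_one _ _)).trans ?_
    have := (F.tame_RR_one (sq2 e)).bd s hs
    simpa [sq2, mul_assoc] using this
  have := hasDerivAt_tsum_of_isPreconnected ((F.sum_sq2 0).mul_left (2 * κ)) isOpen_Ioo
    isPreconnected_Ioo (g := fun e s => qk a e * ‖z s e‖ ^ 2)
    (g' := fun e s => qk a e * -RR (z s) (sq2 e))
    (fun e s hs => (F.hasDerivAt_norm_sq hs e).const_mul _) hb ht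
    (Summable.of_nonneg_of_le (fun e => mul_nonneg (qk_nonneg _ _) (by positivity))
      (fun e => mul_le_of_le_one_left (by positivity) (qk_le_one _ _)) (F.summable_norm_sq ht)) ht
  refine this.congr_deriv ?_
  rw [← tsum_neg]
  exact tsum_congr fun e => by ring

theorem hasDerivAt_fr (F : ModeFlow z τ y Q κ η) {t : ℝ} (ht : t ∈ Set.Ioo (-τ) τ)
    (k : Multiset (Bool × ℤ)) : HasDerivAt (fun s => fr (z s) k) (-FR (z t) k) t := by
  induction k using Multiset.induction_on with
  | empty => simpa [fr, FR] using hasDerivAt_const t (0 : ℝ)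
  | cons i S ih =>
    have h1 := (((F.hasDerivAt_Om ht i.2).const_mul (sg i.1 : ℝ)).add ih)
    simp only [fr, FR, Multiset.map_cons, Multiset.sum_cons] at h1 ⊢
    refine h1.congr_deriv ?_
    ring

end ModeFlow

/-- The product of the inverses of the modulated frequencies indexed by `D`. -/
def GD (z : ℤ → ℂ) (D : Multiset (Multiset (Bool × ℤ))) : ℝ := (D.map fun k => (fr z k)⁻¹).prod

/-- Multi-indices with at most `n` entries whose frequency stays above `δ` in modulus. -/
def Adm (z : ℝ → ℤ → ℂ) (τ δ : ℝ) (n : ℕ) (k : Multiset (Bool × ℤ)) : Prop :=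
  k.card ≤ n ∧ ∀ t ∈ Set.Ioo (-τ) τ, δ ≤ |fr (z t) k|

namespace ModeFlow

variable {z : ℝ → ℤ → ℂ} {τ : ℝ} {y : ℤ → ℝ} {Q : Multiset (Bool × ℤ) → ℝ} {κ η δ : ℝ} {n : ℕ}

theorem abs_GD_le (hδ : 0 < δ) {D : Multiset (Multiset (Bool × ℤ))}
    (hD : ∀ k ∈ D, Adm z τ δ n k) {t : ℝ} (ht : t ∈ Set.Ioo (-τ) τ) :
    |GD (z t) D| ≤ δ⁻¹ ^ D.card := by
  induction D using Multiset.induction_on with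
  | empty => simp [GD]
  | cons k D ih =>
    have h1 := ih fun l hl => hD l (Multiset.mem_cons_of_mem hl)
    have h2 := (hD k (Multiset.mem_cons_self _ _)).2 t ht
    simp only [GD, Multiset.map_cons, Multiset.prod_cons, Multiset.card_cons, abs_mul, abs_inv,
      pow_succ'] at h1 ⊢
    exact mul_le_mul (inv_anti₀ hδ h2) h1 (abs_nonneg _) (by positivity)

theorem hasDerivAt_GD (F : ModeFlow z τ y Q κ η) (hδ : 0 < δ) {D : Multiset (Multiset (Bool × ℤ))}
    (hD : ∀ k ∈ D, Adm z τ δ n k) {t : ℝ} (ht : t ∈ Set.Ioo (-τ) τ) :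
    HasDerivAt (fun s => GD (z s) D) ((D.map fun k => FR (z t) k * (fr (z t) k)⁻¹).sum *
      GD (z t) D) t := by
  induction D using Multiset.induction_on with
  | empty => simpa [GD] using hasDerivAt_const t (1 : ℝ)
  | cons k D ih =>
    have h1 := ih fun l hl => hD l (Multiset.mem_cons_of_mem hl)
    have h2 := (hD k (Multiset.mem_cons_self _ _)).2 t ht
    have h3 : fr (z t) k ≠ 0 := abs_pos.1 (hδ.trans_le h2)
    have h4 := ((F.hasDerivAt_fr ht k).fun_inv h3).mul h1
    simp only [GD, Multiset.map_cons, Multiset.prod_cons, Multiset.sum_cons] at h4 ⊢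
    refine h4.congr_deriv ?_
    field_simp

theorem continuousOn_GD (F : ModeFlow z τ y Q κ η) (hδ : 0 < δ)
    {D : Multiset (Multiset (Bool × ℤ))} (hD : ∀ k ∈ D, Adm z τ δ n k) :
    ContinuousOn (fun s => GD (z s) D) (Set.Ioo (-τ) τ) :=
  fun _ ht => (F.hasDerivAt_GD hδ hD ht).continuousAt.continuousWithinAt

theorem tame_GD_mon (F : ModeFlow z τ y Q κ η) (hδ : 0 < δ)
    {D : Multiset (Multiset (Bool × ℤ))} (hD : ∀ k ∈ D, Adm z τ δ n k)
    (S : Multiset (Bool × ℤ)) {B : ℝ}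
    (h : ∀ t ∈ Set.Ioo (-τ) τ, |∫ s in (0 : ℝ)..t, GD (z s) D * (mon (z s) S).im| ≤ B) :
    Tame τ (fun t => GD (z t) D * (mon (z t) S).im) (δ⁻¹ ^ D.card * Q S) B := by
  refine ⟨(F.continuousOn_GD hδ hD).mul
    (Complex.continuous_im.comp_continuousOn (F.continuousOn_mon S)), fun t ht => ?_, h⟩
  rw [abs_mul]
  exact mul_le_mul (abs_GD_le hδ hD ht)
    ((Complex.abs_im_le_norm _).trans (F.norm_mon ht _)) (abs_nonneg _) (by positivity)

end ModeFlow

/-! ### Reversible integration by parts -/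

theorem sg_not (b : Bool) : sg (!b) = -sg b := by cases b <;> simp [sg]

theorem card_kid {S : Multiset (Bool × ℤ)} {i : Bool × ℤ} (hi : i ∈ S) (x : ℤ × ℤ) :
    (kid S i x).card = S.card + 2 := by
  have h := Multiset.card_erase_add_one hi
  simp only [kid, trip, Multiset.card_add, Multiset.insert_eq_cons, Multiset.card_cons,
    Multiset.card_singleton]
  omega

theorem ch_kid {S : Multiset (Bool × ℤ)} {i : Bool × ℤ} (hi : i ∈ S) (x : ℤ × ℤ) :
    ch (kid S i x) = ch S := by
  conv_rhs => rw [← Multiset.cons_erase hi]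
  simp only [ch, kid, trip, Multiset.insert_eq_cons, Multiset.map_add, Multiset.map_cons,
    Multiset.map_singleton, Multiset.sum_add, Multiset.sum_cons, Multiset.sum_singleton, sg_not]
  ring

theorem mo_kid {S : Multiset (Bool × ℤ)} {i : Bool × ℤ} (hi : i ∈ S) (x : ℤ × ℤ) :
    mo (kid S i x) = mo S := by
  conv_rhs => rw [← Multiset.cons_erase hi]
  simp only [mo, kid, trip, Multiset.insert_eq_cons, Multiset.map_add, Multiset.map_cons,
    Multiset.map_singleton, Multiset.sum_add, Multiset.sum_cons, Multiset.sum_singleton, sg_not]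
  ring

theorem dl_kid {S : Multiset (Bool × ℤ)} {i : Bool × ℤ} (hi : i ∈ S) (x : ℤ × ℤ) :
    dl (kid S i x) = dl S - sg i.1 * (2 * (x.1 - i.2) * (x.2 - i.2)) := by
  conv_rhs => rw [← Multiset.cons_erase hi]
  simp only [dl, kid, trip, Multiset.insert_eq_cons, Multiset.map_add, Multiset.map_cons,
    Multiset.map_singleton, Multiset.sum_add, Multiset.sum_cons, Multiset.sum_singleton, sg_not]
  ring

theorem dl_kid_ne {S : Multiset (Bool × ℤ)} {i : Bool × ℤ} (hi : i ∈ S) {x : ℤ × ℤ}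
    (h0 : dl S = 0) (h1 : x.1 ≠ i.2) (h2 : x.2 ≠ i.2) : dl (kid S i x) ≠ 0 := by
  rw [dl_kid hi, h0, zero_sub, neg_ne_zero]
  have : sg i.1 ≠ 0 := by unfold sg; split_ifs <;> simp
  exact mul_ne_zero this (mul_ne_zero (mul_ne_zero two_ne_zero (sub_ne_zero.2 h1))
    (sub_ne_zero.2 h2))

theorem dl_add (S R : Multiset (Bool × ℤ)) : dl (S + R) = dl S + dl R := by simp [dl]
theorem mo_add (S R : Multiset (Bool × ℤ)) : mo (S + R) = mo S + mo R := by simp [mo]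
theorem ch_add (S R : Multiset (Bool × ℤ)) : ch (S + R) = ch S + ch R := by simp [ch]
theorem dl_sq2 (e : ℤ) : dl (sq2 e) = 0 := by simp [dl, sq2, sg]
theorem mo_sq2 (e : ℤ) : mo (sq2 e) = 0 := by simp [mo, sq2, sg]
theorem ch_sq2 (e : ℤ) : ch (sq2 e) = 0 := by simp [ch, sq2, sg]
theorem card_sq2 (e : ℤ) : (sq2 e).card = 2 := by simp [sq2]

theorem dl_flip (S : Multiset (Bool × ℤ)) : dl (S.map flipI) = -dl S := by
  simp [dl, flipI, sg_not, Function.comp_def, Multiset.sum_map_neg]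
theorem mo_flip (S : Multiset (Bool × ℤ)) : mo (S.map flipI) = -mo S := by
  simp [mo, flipI, sg_not, Function.comp_def, Multiset.sum_map_neg]
theorem ch_flip (S : Multiset (Bool × ℤ)) : ch (S.map flipI) = -ch S := by
  simp [ch, flipI, sg_not, Function.comp_def, Multiset.sum_map_neg]

theorem mem_sq2_snd {e : ℤ} {j : Bool × ℤ} (hj : j ∈ sq2 e) : j.2 = e := by
  simp only [sq2, Multiset.insert_eq_cons, Multiset.mem_cons, Multiset.mem_singleton] at hj
  rcases hj with rfl | rfl <;> rfl

namespace ModeFlow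

variable {z : ℝ → ℤ → ℂ} {τ : ℝ} {y : ℤ → ℝ} {Q : Multiset (Bool × ℤ) → ℝ} {κ η δ : ℝ} {n : ℕ}

theorem tame_fr (F : ModeFlow z τ y Q κ η) (hδ : 0 < δ)
    {D : Multiset (Multiset (Bool × ℤ))} (hD : ∀ k ∈ D, Adm z τ δ n k)
    {S : Multiset (Bool × ℤ)} {c : ℝ} (hc : 0 ≤ c)
    (h : ∀ e, ∀ t ∈ Set.Ioo (-τ) τ,
      |∫ s in (0 : ℝ)..t, GD (z s) D * (mon (z s) (sq2 e + S)).im| ≤ c * Q (sq2 e + S)) :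
    Tame τ (fun t => GD (z t) D * (fr (z t) S * (mon (z t) S).im))
      (S.card * (δ⁻¹ ^ D.card * (η * Q S))) (S.card * (c * (η * Q S))) := by
  have key : ∀ i ∈ S, Tame τ (fun t => (sg i.1 : ℝ) * ∑' e,
      qk i.2 e * (GD (z t) D * (mon (z t) (sq2 e + S)).im)) (δ⁻¹ ^ D.card * (η * Q S))
      (c * (η * Q S)) := by
    intro i _
    have h2 := Tame.tsum (fun e => (F.tame_GD_mon hδ hD (sq2 e + S) (h e)).const_mul_le_one F.pos
      (c := qk i.2 e) (by rw [abs_of_nonneg (qk_nonneg _ _)]; exact qk_le_one _ _))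
      ((F.sum_sq2 S).mul_left _) ((F.sum_sq2 S).mul_left c)
    rw [tsum_mul_left, tsum_mul_left] at h2
    refine (h2.const_mul_le_one F.pos ?_).mono ?_ ?_
    · unfold sg; split_ifs <;> simp
    · exact mul_le_mul_of_nonneg_left (F.tsum_sq2 S) (by positivity)
    · exact mul_le_mul_of_nonneg_left (F.tsum_sq2 S) hc
  refine (Tame.multiset_sum S key).congr fun t _ => ?_
  rw [fr, ← Multiset.sum_map_mul_right, ← Multiset.sum_map_mul_left]
  congr 1
  refine Multiset.map_congr rfl fun i _ => ?_
  have : GD (z t) D * (sg i.1 * Om (z t) i.2 * (mon (z t) S).im) =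
      sg i.1 * ((GD (z t) D * (mon (z t) S).im) * Om (z t) i.2) := by ring
  rw [this, Om, ← tsum_mul_left]
  congr 1
  refine tsum_congr fun e => ?_
  rw [mon_add, mon_sq2, Complex.im_ofReal_mul]
  ring

theorem tame_deriv_GD (F : ModeFlow z τ y Q κ η) (hδ : 0 < δ)
    {D : Multiset (Multiset (Bool × ℤ))} (hD : ∀ k ∈ D, Adm z τ δ n k)
    {S : Multiset (Bool × ℤ)} {c : ℝ} (hc : 0 ≤ c)
    (h : ∀ k ∈ D, ∀ e, ∀ j ∈ sq2 e, ∀ x : ℤ × ℤ, x.1 ≠ e → x.2 ≠ e →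
      ∀ R, R = S ∨ R = S.map flipI → ∀ t ∈ Set.Ioo (-τ) τ,
      |∫ s in (0 : ℝ)..t, GD (z s) (k ::ₘ D) * (mon (z s) (kid (sq2 e + R) j x)).im| ≤
        c * Q (kid (sq2 e + R) j x)) :
    Tame τ (fun t => (D.map fun k => FR (z t) k * (fr (z t) k)⁻¹).sum * GD (z t) D *
      (mon (z t) S).re) (D.card * (n * (2 * κ * η * δ⁻¹ ^ (D.card + 1) * Q S)))
      (D.card * (n * (2 * κ * η * c * Q S))) := by
  have hκ := F.kap
  have hη := F.eta
  have key : ∀ k ∈ D, Tame τ (fun t => (k.map fun i => (sg i.1 : ℝ) * ∑' e,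
      qk i.2 e * ((GD (z t) (k ::ₘ D) * (mon (z t) S).re) * RR (z t) (sq2 e))).sum)
      (n * (2 * κ * η * δ⁻¹ ^ (D.card + 1) * Q S)) (n * (2 * κ * η * c * Q S)) := by
    intro k hk
    have hD' : ∀ l ∈ k ::ₘ D, Adm z τ δ n l := fun l hl => by
      rcases Multiset.mem_cons.1 hl with rfl | hl
      · exact hD _ hk
      · exact hD _ hl
    have h1 : ∀ e, Tame τ
        (fun t => (GD (z t) (k ::ₘ D) * (mon (z t) S).re) * RR (z t) (sq2 e))
        (2 * κ * δ⁻¹ ^ (D.card + 1) * Q (sq2 e + S)) (2 * κ * c * Q (sq2 e + S)) := by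
      intro e
      refine (F.tame_RR (S := sq2 e) (R := S) (u := δ⁻¹ ^ (D.card + 1)) (by positivity) hc
        fun j hj x hx1 hx2 => ?_).mono (le_of_eq ?_) (le_of_eq ?_)
      · rw [mem_sq2_snd hj] at hx1 hx2
        have qe : Q (kid (sq2 e + S.map flipI) j x) = Q (kid (sq2 e + S) j x) := by
          rw [kid_add hj, kid_add hj, F.flip]
        have t1 := F.tame_GD_mon hδ hD' _ (h k hk e j hj x hx1 hx2 S (Or.inl rfl))
        have t2 := F.tame_GD_mon hδ hD' _ (h k hk e j hj x hx1 hx2 _ (Or.inr rfl))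
        rw [qe] at t2
        refine (((t1.add t2).const_mul 2⁻¹).congr fun t _ => ?_).mono (le_of_eq ?_) (le_of_eq ?_)
        · rw [mul_assoc, re_mul_im_eq, kid_add hj, kid_add hj]; ring
        · rw [Multiset.card_cons, abs_of_pos (by norm_num)]; ring
        · rw [abs_of_pos (by norm_num)]; ring
      · rw [card_sq2]; push_cast; ring
      · rw [card_sq2]; push_cast; ring
    have h2 : ∀ i ∈ k, Tame τ (fun t => (sg i.1 : ℝ) * ∑' e,
        qk i.2 e * ((GD (z t) (k ::ₘ D) * (mon (z t) S).re) * RR (z t) (sq2 e)))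
        (2 * κ * δ⁻¹ ^ (D.card + 1) * (η * Q S)) (2 * κ * c * (η * Q S)) := by
      intro i _
      have h2 := Tame.tsum (fun e => (h1 e).const_mul_le_one F.pos
        (c := qk i.2 e) (by rw [abs_of_nonneg (qk_nonneg _ _)]; exact qk_le_one _ _))
        ((F.sum_sq2 S).mul_left _) ((F.sum_sq2 S).mul_left _)
      rw [tsum_mul_left, tsum_mul_left] at h2
      refine (h2.const_mul_le_one F.pos ?_).mono ?_ ?_
      · unfold sg; split_ifs <;> simp
      · exact mul_le_mul_of_nonneg_left (F.tsum_sq2 S) (by positivity)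
      · exact mul_le_mul_of_nonneg_left (F.tsum_sq2 S) (by positivity)
    have hQ := F.nonneg S
    have hn : (k.card : ℝ) ≤ n := by exact_mod_cast (hD k hk).1
    refine (Tame.multiset_sum k h2).mono ?_ ?_
    · calc _ ≤ (n : ℝ) * (2 * κ * δ⁻¹ ^ (D.card + 1) * (η * Q S)) :=
            mul_le_mul_of_nonneg_right hn (by positivity)
        _ = _ := by ring
    · calc _ ≤ (n : ℝ) * (2 * κ * c * (η * Q S)) :=
            mul_le_mul_of_nonneg_right hn (by positivity)
        _ = _ := by ring
  refine (Tame.multiset_sum D key).congr fun t _ => ?_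
  rw [mul_assoc, ← Multiset.sum_map_mul_right]
  congr 1
  refine Multiset.map_congr rfl fun k _ => ?_
  rw [mul_assoc, FR, ← Multiset.sum_map_mul_right]
  congr 1
  refine Multiset.map_congr rfl fun i _ => ?_
  rw [mul_assoc]
  congr 1
  rw [← tsum_mul_right]
  refine tsum_congr fun e => ?_
  simp only [GD, Multiset.map_cons, Multiset.prod_cons]
  ring

theorem abs_integral_le_of_tame (F : ModeFlow z τ y Q κ η) (hδ : 0 < δ)
    {D : Multiset (Multiset (Bool × ℤ))} (hD : ∀ k ∈ D, Adm z τ δ n k)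
    {S : Multiset (Bool × ℤ)} {uA BA uB BB : ℝ}
    (hA : Tame τ (fun t => (D.map fun k => FR (z t) k * (fr (z t) k)⁻¹).sum * GD (z t) D *
      (mon (z t) S).re) uA BA)
    (hB : Tame τ (fun t => GD (z t) D * RR (z t) S) uB BB) {t : ℝ}
    (ht : t ∈ Set.Ioo (-τ) τ) :
    |∫ s in (0 : ℝ)..t, GD (z s) D * ((dl S + fr (z s) S) * (mon (z s) S).im)| ≤
      2 * δ⁻¹ ^ D.card * Q S + BA + BB := by
  have hsub := uIcc_subset_Ioo_symm ht
  have h0 : (0 : ℝ) ∈ Set.Ioo (-τ) τ := hsub Set.left_mem_uIcc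
  have cfr : ContinuousOn (fun s => fr (z s) S) (Set.Ioo (-τ) τ) :=
    fun s hs => (F.hasDerivAt_fr hs S).continuousAt.continuousWithinAt
  have cC : ContinuousOn (fun s => GD (z s) D * ((dl S + fr (z s) S) * (mon (z s) S).im))
      (Set.Ioo (-τ) τ) :=
    (F.continuousOn_GD hδ hD).mul ((continuousOn_const.add cfr).mul
      (Complex.continuous_im.comp_continuousOn (F.continuousOn_mon S)))
  have iA := hA.cont.intervalIntegrable_Ioo_symm ht
  have iB := hB.cont.intervalIntegrable_Ioo_symm ht
  have iC := cC.intervalIntegrable_Ioo_symm ht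
  have ftc := intervalIntegral.integral_eq_sub_of_hasDerivAt
    (f := fun s => GD (z s) D * (mon (z s) S).re)
    (fun s hs => ((F.hasDerivAt_GD hδ hD (hsub hs)).mul
      (F.hasDerivAt_re (hsub hs) S)).congr_deriv (g' := (D.map fun k => FR (z s) k *
        (fr (z s) k)⁻¹).sum * GD (z s) D * (mon (z s) S).re -
        GD (z s) D * RR (z s) S - GD (z s) D * ((dl S + fr (z s) S) * (mon (z s) S).im))
        (by ring)) ((iA.sub iB).sub iC)
  rw [intervalIntegral.integral_sub (iA.sub iB) iC, intervalIntegral.integral_sub iA iB] at ftc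
  have hend : ∀ s ∈ Set.Ioo (-τ) τ, |GD (z s) D * (mon (z s) S).re| ≤ δ⁻¹ ^ D.card * Q S := by
    intro s hs
    rw [abs_mul]
    exact mul_le_mul (abs_GD_le hδ hD hs)
      ((Complex.abs_re_le_norm _).trans (F.norm_mon hs _)) (abs_nonneg _) (by positivity)
  have e1 := abs_le.1 (hend t ht)
  have e2 := abs_le.1 (hend 0 h0)
  have e3 := abs_le.1 (hA.int t ht)
  have e4 := abs_le.1 (hB.int t ht)
  rw [abs_le]
  constructor <;> linarith [e1.1, e1.2, e2.1, e2.2, e3.1, e3.2, e4.1, e4.2]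

/-- Integration by parts on a monomial with non-zero unperturbed frequency. -/
theorem nonresonant_step (F : ModeFlow z τ y Q κ η) (hδ : 0 < δ)
    {D : Multiset (Multiset (Bool × ℤ))} (hD : ∀ k ∈ D, Adm z τ δ n k)
    {S : Multiset (Bool × ℤ)} (hS : dl S ≠ 0) {c₁ c₂ : ℝ} (hc₁ : 0 ≤ c₁) (hc₂ : 0 ≤ c₂)
    (h1 : ∀ i ∈ S, ∀ x : ℤ × ℤ, ∀ t ∈ Set.Ioo (-τ) τ,
      |∫ s in (0 : ℝ)..t, GD (z s) D * (mon (z s) (kid S i x)).im| ≤ c₁ * Q (kid S i x))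
    (h2 : ∀ e, ∀ t ∈ Set.Ioo (-τ) τ,
      |∫ s in (0 : ℝ)..t, GD (z s) D * (mon (z s) (sq2 e + S)).im| ≤ c₁ * Q (sq2 e + S))
    (h3 : ∀ k ∈ D, ∀ e, ∀ j ∈ sq2 e, ∀ x : ℤ × ℤ, x.1 ≠ e → x.2 ≠ e →
      ∀ R, R = S ∨ R = S.map flipI → ∀ t ∈ Set.Ioo (-τ) τ,
      |∫ s in (0 : ℝ)..t, GD (z s) (k ::ₘ D) * (mon (z s) (kid (sq2 e + R) j x)).im| ≤
        c₂ * Q (kid (sq2 e + R) j x)) {t : ℝ} (ht : t ∈ Set.Ioo (-τ) τ) :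
    |∫ s in (0 : ℝ)..t, GD (z s) D * (mon (z s) S).im| ≤
      (2 * δ⁻¹ ^ D.card + S.card * (κ + η) * c₁ + D.card * n * (2 * κ * η) * c₂) * Q S := by
  have hA := F.tame_deriv_GD hδ hD hc₂ h3
  have hB := F.tame_RR (g := fun t => GD (z t) D) (S := S) (R := 0) (u := δ⁻¹ ^ D.card)
    (by positivity) hc₁ (fun i hi x _ _ => by
      rw [add_zero]; exact F.tame_GD_mon hδ hD _ (h1 i hi x))
  rw [add_zero] at hB
  have hC := F.tame_fr hδ hD hc₁ h2
  have hI := F.abs_integral_le_of_tame hδ hD hA hB ht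
  have cM : ContinuousOn (fun s => GD (z s) D * (mon (z s) S).im) (Set.Ioo (-τ) τ) :=
    (F.continuousOn_GD hδ hD).mul
      (Complex.continuous_im.comp_continuousOn (F.continuousOn_mon S))
  have e : ∫ s in (0 : ℝ)..t, GD (z s) D * ((dl S + fr (z s) S) * (mon (z s) S).im) =
      dl S * (∫ s in (0 : ℝ)..t, GD (z s) D * (mon (z s) S).im) +
      ∫ s in (0 : ℝ)..t, GD (z s) D * (fr (z s) S * (mon (z s) S).im) := by
    rw [← intervalIntegral.integral_const_mul, ← intervalIntegral.integral_add
      ((cM.intervalIntegrable_Ioo_symm ht).const_mul _)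
      (hC.cont.intervalIntegrable_Ioo_symm ht)]
    exact intervalIntegral.integral_congr fun s _ => by ring
  rw [e] at hI
  have hd : (1 : ℝ) ≤ |(dl S : ℝ)| := by
    have := Int.one_le_abs hS
    exact_mod_cast this
  set X := ∫ s in (0 : ℝ)..t, GD (z s) D * (mon (z s) S).im
  have e1 : |X| ≤ |(dl S : ℝ) * X| := by
    rw [abs_mul]; exact le_mul_of_one_le_left (abs_nonneg _) hd
  have e2 := hC.int t ht
  have e3 := abs_sub_abs_le_abs_sub ((dl S : ℝ) * X)
    (-∫ s in (0 : ℝ)..t, GD (z s) D * (fr (z s) S * (mon (z s) S).im))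
  rw [abs_neg, sub_neg_eq_add] at e3
  linarith

/-- Integration by parts on a monomial with zero unperturbed frequency, using the modulated
frequency. -/
theorem resonant_step (F : ModeFlow z τ y Q κ η) (hδ : 0 < δ)
    {D : Multiset (Multiset (Bool × ℤ))} {S : Multiset (Bool × ℤ)}
    (hD : ∀ k ∈ S ::ₘ D, Adm z τ δ n k) (hS : dl S = 0) {c₁ c₂ : ℝ} (hc₁ : 0 ≤ c₁) (hc₂ : 0 ≤ c₂)
    (h1 : ∀ i ∈ S, ∀ x : ℤ × ℤ, x.1 ≠ i.2 → x.2 ≠ i.2 → ∀ t ∈ Set.Ioo (-τ) τ,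
      |∫ s in (0 : ℝ)..t, GD (z s) (S ::ₘ D) * (mon (z s) (kid S i x)).im| ≤
        c₁ * Q (kid S i x))
    (h3 : ∀ k ∈ S ::ₘ D, ∀ e, ∀ j ∈ sq2 e, ∀ x : ℤ × ℤ, x.1 ≠ e → x.2 ≠ e →
      ∀ R, R = S ∨ R = S.map flipI → ∀ t ∈ Set.Ioo (-τ) τ,
      |∫ s in (0 : ℝ)..t, GD (z s) (k ::ₘ S ::ₘ D) * (mon (z s) (kid (sq2 e + R) j x)).im| ≤
        c₂ * Q (kid (sq2 e + R) j x)) {t : ℝ} (ht : t ∈ Set.Ioo (-τ) τ) :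
    |∫ s in (0 : ℝ)..t, GD (z s) D * (mon (z s) S).im| ≤
      (2 * δ⁻¹ ^ (D.card + 1) + S.card * κ * c₁ + (D.card + 1) * n * (2 * κ * η) * c₂) * Q S := by
  have hA := F.tame_deriv_GD hδ hD hc₂ h3
  have hB := F.tame_RR (g := fun t => GD (z t) (S ::ₘ D)) (S := S) (R := 0)
    (u := δ⁻¹ ^ (S ::ₘ D).card) (by positivity) hc₁ (fun i hi x hx1 hx2 => by
      rw [add_zero]; exact F.tame_GD_mon hδ hD _ (h1 i hi x hx1 hx2))
  rw [add_zero] at hB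
  have hI := F.abs_integral_le_of_tame hδ hD hA hB ht
  have e : ∫ s in (0 : ℝ)..t, GD (z s) (S ::ₘ D) * ((dl S + fr (z s) S) * (mon (z s) S).im) =
      ∫ s in (0 : ℝ)..t, GD (z s) D * (mon (z s) S).im := by
    refine intervalIntegral.integral_congr fun s hs => ?_
    have h2 := (hD S (Multiset.mem_cons_self _ _)).2 s (uIcc_subset_Ioo_symm ht hs)
    have h3 : fr (z s) S ≠ 0 := abs_pos.1 (hδ.trans_le h2)
    simp only [hS, GD, Multiset.map_cons, Multiset.prod_cons, Int.cast_zero, zero_add]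
    field_simp
  rw [e, Multiset.card_cons] at hI
  push_cast at hI
  linarith

end ModeFlow

namespace ModeFlow

variable {z : ℝ → ℤ → ℂ} {τ : ℝ} {y : ℤ → ℝ} {Q : Multiset (Bool × ℤ) → ℝ} {κ η δ : ℝ}

theorem abs_integral_le_of_norm_mon_le (F : ModeFlow z τ y Q κ η) (hδ : 0 < δ) {n : ℕ}
    {D : Multiset (Multiset (Bool × ℤ))} (hD : ∀ k ∈ D, Adm z τ δ n k)
    {S : Multiset (Bool × ℤ)} {C T : ℝ} (hT : τ ≤ T)
    (h : ∀ t ∈ Set.Ioo (-τ) τ, T * ‖mon (z t) S‖ ≤ C) {t : ℝ} (ht : t ∈ Set.Ioo (-τ) τ) :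
    |∫ s in (0 : ℝ)..t, GD (z s) D * (mon (z s) S).im| ≤ δ⁻¹ ^ D.card * C := by
  have hT0 : 0 < T := F.pos.trans_le hT
  have hb : ∀ s ∈ Set.Ioo (-τ) τ, |GD (z s) D * (mon (z s) S).im| ≤
      δ⁻¹ ^ D.card * (C / T) := by
    intro s hs
    rw [abs_mul]
    refine mul_le_mul (abs_GD_le hδ hD hs) ((Complex.abs_im_le_norm _).trans ?_)
      (abs_nonneg _) (by positivity)
    rw [le_div_iff₀ hT0, mul_comm]
    exact h s hs
  have h0 := (Tame.of_bound ((F.continuousOn_GD hδ hD).mul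
    (Complex.continuous_im.comp_continuousOn (F.continuousOn_mon S))) hb).int t ht
  have h1 : 0 ≤ δ⁻¹ ^ D.card * (C / T) := (abs_nonneg _).trans (hb t ht)
  refine h0.trans ((mul_le_mul_of_nonneg_right hT h1).trans (le_of_eq ?_))
  field_simp

/-- Iterated integration by parts: the time integrals of all monomials are controlled by
`Q`, with constants `Cn m` and `Cr m` subject to a recursion. -/
theorem abs_integral_mon_le (F : ModeFlow z τ y Q κ η) (hδ : 0 < δ) {M : ℕ} {T : ℝ}
    (hT : τ ≤ T) {Cn Cr : ℕ → ℝ}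
    (hlow : ∀ S, ch S = 0 → mo S = 0 → dl S = 0 → S.card ≤ 2 * M → S.map flipI ≠ S →
      Adm z τ δ (2 * M) S ∨ ∀ t ∈ Set.Ioo (-τ) τ, T * ‖mon (z t) S‖ ≤ Q S)
    (hn : ∀ m, 1 ≤ Cn m) (hnr : ∀ m, Cn m ≤ Cr m) (hleaf : ∀ m, M < m → T ≤ Cn m)
    (hrecn : ∀ m ≤ M, 2 + 2 * M * (κ + η) * Cr (m + 1) +
      M * (2 * M) * (2 * κ * η) * δ⁻¹ * Cr (m + 2) ≤ Cn m)
    (hrecr : ∀ m ≤ M, δ⁻¹ * (2 + 2 * M * κ * Cn (m + 1) +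
      (M + 1) * (2 * M) * (2 * κ * η) * δ⁻¹ * Cn (m + 2)) ≤ Cr m)
    (d : ℕ) : ∀ m, M + 1 ≤ m + d → ∀ S : Multiset (Bool × ℤ), S.card = 2 * m → ch S = 0 →
      mo S = 0 → ∀ D : Multiset (Multiset (Bool × ℤ)), (∀ k ∈ D, Adm z τ δ (2 * M) k) →
      D.card ≤ m → ∀ t ∈ Set.Ioo (-τ) τ,
      (dl S ≠ 0 → |∫ s in (0 : ℝ)..t, GD (z s) D * (mon (z s) S).im| ≤
        Cn m * δ⁻¹ ^ D.card * Q S) ∧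
      |∫ s in (0 : ℝ)..t, GD (z s) D * (mon (z s) S).im| ≤ Cr m * δ⁻¹ ^ D.card * Q S := by
  have hκ := F.kap
  have hη := F.eta
  have hn0 : ∀ m, 0 ≤ Cn m := fun m => zero_le_one.trans (hn m)
  have hr0 : ∀ m, 0 ≤ Cr m := fun m => (hn0 m).trans (hnr m)
  have leaf : ∀ m, M < m → ∀ S : Multiset (Bool × ℤ),
      ∀ D : Multiset (Multiset (Bool × ℤ)), (∀ k ∈ D, Adm z τ δ (2 * M) k) →
      ∀ t ∈ Set.Ioo (-τ) τ,
      (dl S ≠ 0 → |∫ s in (0 : ℝ)..t, GD (z s) D * (mon (z s) S).im| ≤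
        Cn m * δ⁻¹ ^ D.card * Q S) ∧
      |∫ s in (0 : ℝ)..t, GD (z s) D * (mon (z s) S).im| ≤ Cr m * δ⁻¹ ^ D.card * Q S := by
    intro m hm S D hD t ht
    have hQ := F.nonneg S
    have h1 := F.abs_integral_le_of_norm_mon_le hδ hD (S := S) hT (C := T * Q S)
      (fun s hs => mul_le_mul_of_nonneg_left (F.norm_mon hs S) (F.pos.le.trans hT)) ht
    have h2 : δ⁻¹ ^ D.card * (T * Q S) ≤ Cn m * δ⁻¹ ^ D.card * Q S := by
      have := mul_le_mul_of_nonneg_right (hleaf m hm)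
        (by positivity : 0 ≤ δ⁻¹ ^ D.card * Q S)
      linarith
    have h3 : Cn m * δ⁻¹ ^ D.card * Q S ≤ Cr m * δ⁻¹ ^ D.card * Q S := by
      gcongr; exact hnr m
    exact ⟨fun _ => h1.trans h2, (h1.trans h2).trans h3⟩
  induction d with
  | zero => exact fun m hm S _ _ _ D hD _ => leaf m (by omega) S D hD
  | succ d ih =>
    intro m hm S hS hch hmo D hD hDm t ht
    by_cases hmM : M < m
    · exact leaf m hmM S D hD t ht
    have hmM' : m ≤ M := not_lt.1 hmM
    have hmR : (m : ℝ) ≤ M := by exact_mod_cast hmM'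
    have hDR : (D.card : ℝ) ≤ M := by exact_mod_cast hDm.trans hmM'
    have hSR : (S.card : ℝ) ≤ 2 * M := by rw [hS]; push_cast; linarith
    have hQ := F.nonneg S
    have hδ' : 0 < δ⁻¹ := inv_pos.2 hδ
    have hp : (0 : ℝ) < δ⁻¹ ^ D.card := pow_pos hδ' _
    have hRS : ∀ R, R = S ∨ R = S.map flipI → R.card = 2 * m ∧ ch R = 0 ∧ mo R = 0 ∧
        (dl S = 0 → dl R = 0) := by
      rintro R (rfl | rfl)
      · exact ⟨hS, hch, hmo, id⟩
      · refine ⟨by simpa using hS, by rw [ch_flip, hch, neg_zero],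
          by rw [mo_flip, hmo, neg_zero], fun h => by rw [dl_flip, h, neg_zero]⟩
    by_cases hdl : dl S ≠ 0
    · have h := F.nonresonant_step hδ hD hdl
        (c₁ := Cr (m + 1) * δ⁻¹ ^ D.card) (c₂ := Cr (m + 2) * δ⁻¹ ^ (D.card + 1))
        (mul_nonneg (hr0 _) hp.le) (mul_nonneg (hr0 _) (by positivity))
        (fun i hi x s hs => (ih (m + 1) (by omega) _ (by rw [card_kid hi, hS]; ring)
          (by rw [ch_kid hi, hch]) (by rw [mo_kid hi, hmo]) D hD (by omega) s hs).2)
        (fun e s hs => (ih (m + 1) (by omega) _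
          (by rw [Multiset.card_add, card_sq2, hS]; ring)
          (by rw [ch_add, ch_sq2, hch]; rfl) (by rw [mo_add, mo_sq2, hmo]; rfl)
          D hD (by omega) s hs).2)
        (fun k hk e j hj x _ _ R hR s hs => by
          obtain ⟨r1, r2, r3, _⟩ := hRS R hR
          have hj' : j ∈ sq2 e + R := Multiset.mem_add.2 (Or.inl hj)
          have := (ih (m + 2) (by omega) (kid (sq2 e + R) j x)
            (by rw [card_kid hj', Multiset.card_add, card_sq2, r1]; ring)
            (by rw [ch_kid hj', ch_add, ch_sq2, r2]; rfl)
            (by rw [mo_kid hj', mo_add, mo_sq2, r3]; rfl) (k ::ₘ D)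
            (fun l hl => by
              rcases Multiset.mem_cons.1 hl with rfl | hl
              · exact hD _ hk
              · exact hD _ hl)
            (by rw [Multiset.card_cons]; omega) s hs).2
          rwa [Multiset.card_cons] at this) ht
      have hb : |∫ s in (0 : ℝ)..t, GD (z s) D * (mon (z s) S).im| ≤
          Cn m * δ⁻¹ ^ D.card * Q S := by
        refine h.trans (mul_le_mul_of_nonneg_right ?_ hQ)
        have a1 : S.card * (κ + η) * (Cr (m + 1) * δ⁻¹ ^ D.card) ≤
            2 * M * (κ + η) * (Cr (m + 1) * δ⁻¹ ^ D.card) := by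
          have := hr0 (m + 1); gcongr
        have a2 : D.card * ((2 * M : ℕ) : ℝ) * (2 * κ * η) *
            (Cr (m + 2) * δ⁻¹ ^ (D.card + 1)) ≤
            M * (2 * M) * (2 * κ * η) * (Cr (m + 2) * δ⁻¹ ^ (D.card + 1)) := by
          have := hr0 (m + 2); push_cast; gcongr
        have a3 := mul_le_mul_of_nonneg_right (hrecn m hmM') hp.le
        rw [pow_succ] at a2
        rw [pow_succ]
        linarith
      refine ⟨fun _ => hb, hb.trans ?_⟩
      gcongr; exact hnr m
    · refine ⟨fun h => absurd h hdl, ?_⟩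
      have hdl0 : dl S = 0 := not_not.1 hdl
      by_cases hself : S.map flipI = S
      · have : ∀ s, GD (z s) D * (mon (z s) S).im = 0 := fun s => by
          rw [mon_im_eq_zero _ hself, mul_zero]
        simp only [this, intervalIntegral.integral_zero, abs_zero]
        exact mul_nonneg (mul_nonneg (hr0 _) hp.le) hQ
      rcases hlow S hch hmo hdl0 (by omega) hself with hadm | hhigh
      · have hD' : ∀ k ∈ S ::ₘ D, Adm z τ δ (2 * M) k := fun l hl => by
          rcases Multiset.mem_cons.1 hl with rfl | hl
          · exact hadm
          · exact hD _ hl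
        have h := F.resonant_step hδ hD' hdl0
          (c₁ := Cn (m + 1) * δ⁻¹ ^ (D.card + 1)) (c₂ := Cn (m + 2) * δ⁻¹ ^ (D.card + 2))
          (mul_nonneg (hn0 _) (by positivity)) (mul_nonneg (hn0 _) (by positivity))
          (fun i hi x hx1 hx2 s hs => by
            have := (ih (m + 1) (by omega) _ (by rw [card_kid hi, hS]; ring)
              (by rw [ch_kid hi, hch]) (by rw [mo_kid hi, hmo]) (S ::ₘ D) hD'
              (by rw [Multiset.card_cons]; omega) s hs).1 (dl_kid_ne hi hdl0 hx1 hx2)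
            rwa [Multiset.card_cons] at this)
          (fun k hk e j hj x hx1 hx2 R hR s hs => by
            obtain ⟨r1, r2, r3, r4⟩ := hRS R hR
            have hj' : j ∈ sq2 e + R := Multiset.mem_add.2 (Or.inl hj)
            have := (ih (m + 2) (by omega) (kid (sq2 e + R) j x)
              (by rw [card_kid hj', Multiset.card_add, card_sq2, r1]; ring)
              (by rw [ch_kid hj', ch_add, ch_sq2, r2]; rfl)
              (by rw [mo_kid hj', mo_add, mo_sq2, r3]; rfl) (k ::ₘ S ::ₘ D)
              (fun l hl => by
                rcases Multiset.mem_cons.1 hl with rfl | hl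
                · exact hD' _ hk
                · exact hD' _ hl)
              (by simp only [Multiset.card_cons]; omega) s hs).1
              (dl_kid_ne hj' (by rw [dl_add, dl_sq2, r4 hdl0]; rfl)
                (by rwa [mem_sq2_snd hj]) (by rwa [mem_sq2_snd hj]))
            simpa only [Multiset.card_cons] using this) ht
        refine h.trans (mul_le_mul_of_nonneg_right ?_ hQ)
        have a1 : S.card * κ * (Cn (m + 1) * δ⁻¹ ^ (D.card + 1)) ≤
            2 * M * κ * (Cn (m + 1) * δ⁻¹ ^ (D.card + 1)) := by
          have := hn0 (m + 1); gcongr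
        have a2 : (D.card + 1) * ((2 * M : ℕ) : ℝ) * (2 * κ * η) *
            (Cn (m + 2) * δ⁻¹ ^ (D.card + 2)) ≤
            (M + 1) * (2 * M) * (2 * κ * η) * (Cn (m + 2) * δ⁻¹ ^ (D.card + 2)) := by
          have := hn0 (m + 2); push_cast; gcongr
        have a3 := mul_le_mul_of_nonneg_right (hrecr m hmM') hp.le
        rw [pow_succ] at a1
        rw [pow_succ, pow_succ] at a2
        rw [pow_succ]
        simp only [pow_succ] at *
        linarith
      · have h := F.abs_integral_le_of_norm_mon_le hδ hD hT hhigh ht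
        have h1 : (1 : ℝ) ≤ Cr m := (hn m).trans (hnr m)
        refine h.trans ?_
        have := mul_le_mul_of_nonneg_right h1 (mul_nonneg hp.le hQ)
        linarith

/-- Variation of the actions. -/
theorem abs_norm_sq_sub_le (F : ModeFlow z τ y Q κ η) (hδ : 0 < δ) {M : ℕ} {T : ℝ}
    (hT : τ ≤ T) {Cn Cr : ℕ → ℝ}
    (hlow : ∀ S, ch S = 0 → mo S = 0 → dl S = 0 → S.card ≤ 2 * M → S.map flipI ≠ S →
      Adm z τ δ (2 * M) S ∨ ∀ t ∈ Set.Ioo (-τ) τ, T * ‖mon (z t) S‖ ≤ Q S)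
    (hn : ∀ m, 1 ≤ Cn m) (hnr : ∀ m, Cn m ≤ Cr m) (hleaf : ∀ m, M < m → T ≤ Cn m)
    (hrecn : ∀ m ≤ M, 2 + 2 * M * (κ + η) * Cr (m + 1) +
      M * (2 * M) * (2 * κ * η) * δ⁻¹ * Cr (m + 2) ≤ Cn m)
    (hrecr : ∀ m ≤ M, δ⁻¹ * (2 + 2 * M * κ * Cn (m + 1) +
      (M + 1) * (2 * M) * (2 * κ * η) * δ⁻¹ * Cn (m + 2)) ≤ Cr m)
    {t : ℝ} (ht : t ∈ Set.Ioo (-τ) τ) (a : ℤ) :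
    |‖z t a‖ ^ 2 - ‖z 0 a‖ ^ 2| ≤ 2 * κ * (2 + 4 * (κ + η) * Cr 3) * Q (sq2 a) := by
  have hκ := F.kap
  have hη := F.eta
  have hr0 : ∀ m, 0 ≤ Cr m := fun m => (zero_le_one.trans (hn m)).trans (hnr m)
  have main := F.abs_integral_mon_le hδ hT hlow hn hnr hleaf hrecn hrecr (M + 1) 3 (by omega)
  have hc : 0 ≤ 2 + 4 * (κ + η) * Cr 3 := by have := hr0 3; positivity
  have kid_bd : ∀ i ∈ sq2 a, ∀ x : ℤ × ℤ, x.1 ≠ i.2 → x.2 ≠ i.2 → ∀ t ∈ Set.Ioo (-τ) τ,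
      |∫ s in (0 : ℝ)..t, GD (z s) 0 * (mon (z s) (kid (sq2 a) i x)).im| ≤
        (2 + 4 * (κ + η) * Cr 3) * Q (kid (sq2 a) i x) := by
    intro i hi x hx1 hx2 t ht
    have c4 : (kid (sq2 a) i x).card = 4 := by rw [card_kid hi, card_sq2]
    have := F.nonresonant_step (n := 2 * M) hδ (D := 0) (by simp)
      (dl_kid_ne hi (dl_sq2 a) hx1 hx2) (c₁ := Cr 3) (c₂ := 0) (hr0 3) le_rfl
      (fun k hk w s hs => by
        simpa using (main (kid (kid (sq2 a) i x) k w) (by rw [card_kid hk, c4])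
          (by rw [ch_kid hk, ch_kid hi, ch_sq2]) (by rw [mo_kid hk, mo_kid hi, mo_sq2]) 0
          (by simp) (by simp) s hs).2)
      (fun e s hs => by
        simpa using (main (sq2 e + kid (sq2 a) i x) (by rw [Multiset.card_add, card_sq2, c4])
          (by rw [ch_add, ch_kid hi, ch_sq2, ch_sq2]; rfl)
          (by rw [mo_add, mo_kid hi, mo_sq2, mo_sq2]; rfl) 0
          (by simp) (by simp) s hs).2)
      (by simp) ht
    rw [c4] at this
    simpa using this
  have hR := F.tame_RR (g := fun t => GD (z t) 0) (S := sq2 a) (R := 0) (u := 1)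
    zero_le_one hc (fun i hi x hx1 hx2 => by
      rw [add_zero]
      have := F.tame_GD_mon (n := 2 * M) hδ (D := 0) (by simp) _ (kid_bd i hi x hx1 hx2)
      simpa using this)
  have hsub := uIcc_subset_Ioo_symm ht
  have ftc := intervalIntegral.integral_eq_sub_of_hasDerivAt
    (f := fun s => ‖z s a‖ ^ 2) (fun s hs => F.hasDerivAt_norm_sq (hsub hs) a)
    ((F.tame_RR_one (sq2 a)).cont.intervalIntegrable_Ioo_symm ht).neg
  have h1 := hR.int t ht
  simp only [GD, Multiset.map_zero, Multiset.prod_zero, one_mul, add_zero, card_sq2] at h1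
  rw [← ftc, intervalIntegral.integral_neg, abs_neg]
  refine h1.trans (le_of_eq ?_)
  push_cast
  ring

end ModeFlow

/-! ### The weights on multi-indices -/

/-- Nonnegative sequences of mass at most `2ρ` stable under the cubic convolution. -/
structure ConvStable (Y : ℤ → ℝ) (ρ : ℝ) : Prop where
  nonneg : ∀ a, 0 ≤ Y a
  summable : Summable Y
  tsum_le : ∑' a, Y a ≤ 2 * ρ
  triple : ∀ a, Summable fun x : ℤ × ℤ => Y x.1 * Y (x.1 + x.2 - a) * Y x.2
  conv : ∀ a, conv3 Y a ≤ 8 * ρ ^ 2 * Y a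

/-- The product of a sequence over a multi-index. -/
def seqProd (Y : ℤ → ℝ) (S : Multiset (Bool × ℤ)) : ℝ := (S.map fun i => Y i.2).prod

theorem seqProd_add (Y : ℤ → ℝ) (S R : Multiset (Bool × ℤ)) :
    seqProd Y (S + R) = seqProd Y S * seqProd Y R := by simp [seqProd]

theorem seqProd_nonneg {Y : ℤ → ℝ} (hY : ∀ a, 0 ≤ Y a) (S : Multiset (Bool × ℤ)) :
    0 ≤ seqProd Y S := by
  apply Multiset.prod_nonneg
  intro x hx
  obtain ⟨i, -, rfl⟩ := Multiset.mem_map.1 hx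
  exact hY _

theorem seqProd_le {y Y : ℤ → ℝ} (hy : ∀ a, 0 ≤ y a) (h : ∀ a, y a ≤ Y a)
    (S : Multiset (Bool × ℤ)) : seqProd y S ≤ seqProd Y S := by
  induction S using Multiset.induction_on with
  | empty => simp [seqProd]
  | cons i S ih =>
    have h1 := seqProd_nonneg hy S
    simp only [seqProd, Multiset.map_cons, Multiset.prod_cons] at *
    exact mul_le_mul (h _) ih h1 ((hy _).trans (h _))

theorem seqProd_kid (Y : ℤ → ℝ) (S : Multiset (Bool × ℤ)) (i : Bool × ℤ) (x : ℤ × ℤ) :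
    seqProd Y (kid S i x)
      = Y x.1 * Y (x.1 + x.2 - i.2) * Y x.2 * seqProd Y (S.erase i) := by
  simp only [kid, seqProd_add]
  simp [seqProd, trip, mul_assoc]

theorem seqProd_erase (Y : ℤ → ℝ) {S : Multiset (Bool × ℤ)} {i : Bool × ℤ} (hi : i ∈ S) :
    Y i.2 * seqProd Y (S.erase i) = seqProd Y S := by
  conv_rhs => rw [← Multiset.cons_erase hi]
  simp [seqProd]

theorem seqProd_sq2 (Y : ℤ → ℝ) (e : ℤ) (S : Multiset (Bool × ℤ)) :
    seqProd Y (sq2 e + S) = Y e ^ 2 * seqProd Y S := by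
  rw [seqProd_add]; simp [seqProd, sq2, sq]

theorem seqProd_flip (Y : ℤ → ℝ) (S : Multiset (Bool × ℤ)) :
    seqProd Y (S.map flipI) = seqProd Y S := by
  simp only [seqProd, Multiset.map_map]; rfl

namespace ConvStable

variable {Y V : ℤ → ℝ} {ρ : ℝ}

theorem of_weight {ν : ℤ → ℝ} (hν : ∀ a, 1 ≤ ν a) (h0 : ∀ a, 0 ≤ Y a)
    (hs : Summable fun a => ν a * Y a) (hle : ∑' a, ν a * Y a ≤ 2 * ρ)
    (ht : ∀ a, Summable fun x : ℤ × ℤ => Y x.1 * Y (x.1 + x.2 - a) * Y x.2)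
    (hc : ∀ a, conv3 Y a ≤ 8 * ρ ^ 2 * Y a) : ConvStable Y ρ := by
  have h1 : ∀ a, Y a ≤ ν a * Y a := fun a => le_mul_of_one_le_left (h0 a) (hν a)
  have h2 : Summable Y := Summable.of_nonneg_of_le h0 h1 hs
  exact ⟨h0, h2, (h2.tsum_le_tsum h1 hs).trans hle, ht, hc⟩

theorem summable_kid (h : ConvStable Y ρ) (S : Multiset (Bool × ℤ)) (i : Bool × ℤ) :
    Summable fun x => seqProd Y (kid S i x) := by
  simp only [seqProd_kid]
  exact (h.triple i.2).mul_right _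

theorem tsum_kid_le (h : ConvStable Y ρ) {S : Multiset (Bool × ℤ)} {i : Bool × ℤ} (hi : i ∈ S) :
    ∑' x, seqProd Y (kid S i x) ≤ 8 * ρ ^ 2 * seqProd Y S := by
  simp only [seqProd_kid]
  rw [tsum_mul_right, ← seqProd_erase Y hi, ← mul_assoc]
  exact mul_le_mul_of_nonneg_right (h.conv i.2) (seqProd_nonneg h.nonneg _)

theorem le_tsum (h : ConvStable Y ρ) (a : ℤ) : Y a ≤ 2 * ρ :=
  (h.summable.le_tsum a fun j _ => h.nonneg j).trans h.tsum_le

theorem summable_sq (h : ConvStable Y ρ) : Summable fun a => Y a ^ 2 := by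
  refine Summable.of_nonneg_of_le (fun a => sq_nonneg _) (fun a => ?_) (h.summable.mul_left (2 * ρ))
  rw [sq]
  exact mul_le_mul_of_nonneg_right (h.le_tsum a) (h.nonneg a)

theorem tsum_sq_le (h : ConvStable Y ρ) : ∑' a, Y a ^ 2 ≤ 4 * ρ ^ 2 := by
  have h0 : 0 ≤ 2 * ρ := (h.nonneg 0).trans (h.le_tsum 0)
  have h1 : ∑' a, Y a ^ 2 ≤ ∑' a, 2 * ρ * Y a := by
    refine h.summable_sq.tsum_le_tsum (fun a => ?_) (h.summable.mul_left _)
    rw [sq]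
    exact mul_le_mul_of_nonneg_right (h.le_tsum a) (h.nonneg a)
  rw [tsum_mul_left] at h1
  have h2 := mul_le_mul_of_nonneg_left h.tsum_le h0
  linarith

/-- The standard weight on multi-indices turns a bounded flow into a `ModeFlow`. -/
theorem modeFlow {z : ℝ → ℤ → ℂ} {τ μ : ℝ} {y : ℤ → ℝ} (hY : ConvStable Y ρ)
    (hV : ConvStable V ρ) (hτ : 0 < τ) (hμ : 0 ≤ μ)
    (ode : ∀ t ∈ Set.Ioo (-τ) τ, ∀ a, HasDerivAt (fun s => z s a) (vf (z t) a) t)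
    (bd : ∀ t ∈ Set.Ioo (-τ) τ, ∀ a, ‖z t a‖ ≤ y a) (hy : ∀ a, y a ≤ Y a) :
    ModeFlow z τ y (fun S => seqProd Y S + μ * seqProd V S) (8 * ρ ^ 2) (4 * ρ ^ 2) where
  pos := hτ
  kap := by positivity
  eta := by positivity
  ode := ode
  bd := bd
  nonneg S := add_nonneg (seqProd_nonneg hY.nonneg S) (mul_nonneg hμ (seqProd_nonneg hV.nonneg S))
  sum_kid S i _ := (hY.summable_kid S i).add ((hV.summable_kid S i).mul_left μ)
  tsum_kid S i hi := by
    rw [(hY.summable_kid S i).tsum_add ((hV.summable_kid S i).mul_left μ), tsum_mul_left]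
    have := mul_le_mul_of_nonneg_left (hV.tsum_kid_le hi) hμ
    have := hY.tsum_kid_le hi
    linarith
  sum_sq2 S := by
    simp only [seqProd_sq2]
    exact (hY.summable_sq.mul_right _).add ((hV.summable_sq.mul_right _).mul_left μ)
  tsum_sq2 S := by
    simp only [seqProd_sq2]
    rw [(hY.summable_sq.mul_right _).tsum_add ((hV.summable_sq.mul_right _).mul_left μ),
      tsum_mul_left, tsum_mul_right, tsum_mul_right]
    have h1 := mul_le_mul_of_nonneg_right hY.tsum_sq_le (seqProd_nonneg hY.nonneg S)
    have h2 := mul_le_mul_of_nonneg_left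
      (mul_le_mul_of_nonneg_right hV.tsum_sq_le (seqProd_nonneg hV.nonneg S)) hμ
    linarith
  dom S := by
    have h0 : ∀ a, 0 ≤ y a := fun a =>
      (norm_nonneg _).trans (bd 0 ⟨by linarith, hτ⟩ a)
    have h1 := seqProd_le h0 hy S
    have h2 := mul_nonneg hμ (seqProd_nonneg hV.nonneg S)
    simp only [seqProd] at *
    linarith
  flip S R := by simp only [seqProd_add, seqProd_flip]

end ConvStable

/-- The sequence `y` with its modes beyond `N` amplified by `l`. -/
def amp (N l : ℝ) (y : ℤ → ℝ) (a : ℤ) : ℝ := if N < |(a : ℝ)| then l * y a else y a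

theorem seqProd_mul_pow_le {N l : ℝ} {y : ℤ → ℝ} (hl : 1 ≤ l) (hy : ∀ a, 0 ≤ y a) (k : ℕ)
    (S : Multiset (Bool × ℤ)) (hk : k ≤ (S.filter fun i => N < |(i.2 : ℝ)|).card) :
    l ^ k * seqProd y S ≤ seqProd (amp N l y) S := by
  have h : l ^ (S.filter fun i => N < |(i.2 : ℝ)|).card * seqProd y S = seqProd (amp N l y) S := by
    clear hk
    induction S using Multiset.induction_on with
    | empty => simp [seqProd]
    | cons i S ih =>
      simp only [seqProd, Multiset.map_cons, Multiset.prod_cons] at ih ⊢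
      rw [← ih]
      by_cases hi : N < |(i.2 : ℝ)|
      · rw [Multiset.filter_cons_of_pos S hi]
        simp only [amp, if_pos hi, Multiset.card_cons, pow_succ]; ring
      · rw [Multiset.filter_cons_of_neg S hi]
        simp only [amp, if_neg hi]; ring
  rw [← h]
  exact mul_le_mul_of_nonneg_right (pow_le_pow_right₀ hl hk) (seqProd_nonneg hy S)

theorem lowWt_mul_amp_le {σ θ N : ℝ} (hσ : 0 < σ) (h1 : θ < 1) (hN : 0 < N) {y : ℤ → ℝ}
    (hy : ∀ a, 0 ≤ y a) (a : ℤ) :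
    lowWt σ θ N a * amp N (Real.exp (σ * (1 - θ) * N ^ θ)) y a ≤ wt σ θ a * y a := by
  unfold amp
  split_ifs with h
  · rw [← mul_assoc, lowWt_mul_le_wt h]
  · exact mul_le_mul_of_nonneg_right (lowWt_le_wt hσ h1 hN a) (hy a)

/-! ### Solving the recursion for the constants -/

set_option maxHeartbeats 1000000 in
theorem exists_recursion_constants {s A T ρ : ℝ} {M : ℕ} (hs : 0 < s) (hs1 : s ≤ 1 / 16)
    (hA : 128 * ((M : ℝ) + 1) ^ 2 ≤ A) (hAs : 2 * A * s ≤ 1) (hT : 0 ≤ T)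
    (hTM : T * (2 * A * s) ^ M ≤ 1) (hρ : 0 ≤ ρ) (hρs : ρ ≤ s ^ 8) :
    ∃ Cn Cr : ℕ → ℝ, (∀ m, 1 ≤ Cn m) ∧ (∀ m, Cn m ≤ Cr m) ∧ (∀ m, M < m → T ≤ Cn m) ∧
      (∀ m ≤ M, 2 + 2 * M * (8 * ρ ^ 2 + 4 * ρ ^ 2) * Cr (m + 1)
        + M * (2 * M) * (2 * (8 * ρ ^ 2) * (4 * ρ ^ 2)) * (s ^ 20)⁻¹ * Cr (m + 2) ≤ Cn m) ∧
      (∀ m ≤ M, (s ^ 20)⁻¹ * (2 + 2 * M * (8 * ρ ^ 2) * Cn (m + 1)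
        + (M + 1) * (2 * M) * (2 * (8 * ρ ^ 2) * (4 * ρ ^ 2)) * (s ^ 20)⁻¹ * Cn (m + 2))
          ≤ Cr m) ∧
      256 * ρ * (2 + 4 * (8 * ρ ^ 2 + 4 * ρ ^ 2) * Cr 3) ≤ 1 := by
  have hA1 : 128 ≤ A := by
    have : (0 : ℝ) ≤ M := Nat.cast_nonneg _
    nlinarith
  have hA0 : 0 < A := by linarith
  obtain ⟨γ, hγ⟩ : ∃ γ : ℝ, γ = 2 * A * s := ⟨_, rfl⟩
  have hγ0 : 0 < γ := by rw [hγ]; positivity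
  have hγ1 : γ ≤ 1 := hγ ▸ hAs
  obtain ⟨g, hg⟩ : ∃ g : ℕ → ℝ, g = fun m : ℕ => T * γ ^ ((M : ℤ) + 1 - (m : ℤ)) := ⟨_, rfl⟩
  have hg0 : ∀ m, 0 ≤ g m := fun m => by rw [hg]; positivity
  have hgs : ∀ m, g (m + 1) = g m / γ := fun m => by
    simp only [hg]
    rw [show (M : ℤ) + 1 - ((m + 1 : ℕ) : ℤ) = (M + 1 - m) - 1 by push_cast; ring,
      zpow_sub_one₀ hγ0.ne']
    field_simp
  have hg1 : ∀ m, g (m + 1) = g m / (2 * A * s) := hγ ▸ hgs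
  have hg2 : ∀ m, g (m + 2) = g m / (2 * A * s) ^ 2 := fun m => by
    rw [show m + 2 = (m + 1) + 1 from rfl, hgs, hgs, div_div, ← sq, hγ]
  have hgle : ∀ m, M < m → T ≤ g m := fun m hm => by
    simp only [hg]
    apply le_mul_of_one_le_right hT
    have : (M : ℤ) + 1 - m = -((m - (M + 1) : ℕ) : ℤ) := by omega
    rw [this, zpow_neg, zpow_natCast]
    exact (one_le_inv₀ (by positivity)).2 (pow_le_one₀ hγ0.le hγ1)
  have hg3 : g 3 ≤ (4 * A ^ 2 * s ^ 2)⁻¹ := by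
    have e : g 3 = T * γ ^ M * (4 * A ^ 2 * s ^ 2)⁻¹ := by
      simp only [hg]
      rw [show (M : ℤ) + 1 - ((3 : ℕ) : ℤ) = M - 2 by push_cast; ring, zpow_sub₀ hγ0.ne',
        zpow_natCast, show (2 : ℤ) = ((2 : ℕ) : ℤ) from rfl, zpow_natCast,
        show γ ^ 2 = 4 * A ^ 2 * s ^ 2 by rw [hγ]; ring]
      ring
    rw [e]
    exact mul_le_of_le_one_left (by positivity) (hγ ▸ hTM)
  have hs2 : 16 * A ^ 2 * s ^ 4 ≤ 1 / 64 := by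
    have h1 : (2 * A * s) ^ 2 ≤ 1 := pow_le_one₀ (by positivity) hAs
    have h2 : s ^ 2 ≤ 1 / 256 := by nlinarith
    calc 16 * A ^ 2 * s ^ 4 = 4 * s ^ 2 * (2 * A * s) ^ 2 := by ring
      _ ≤ 4 * s ^ 2 * 1 := by gcongr
      _ ≤ _ := by linarith
  have hs4 : s ^ 4 ≤ 1 / 65536 := by
    calc s ^ 4 ≤ (1 / 16) ^ 4 := by gcongr
      _ = _ := by norm_num
  have hle1 : s ≤ 1 := by linarith
  have hρ2 : ρ ^ 2 ≤ s ^ 16 := by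
    calc ρ ^ 2 ≤ (s ^ 8) ^ 2 := by gcongr
      _ = _ := by ring
  have hρ4 : ρ ^ 2 * ρ ^ 2 ≤ s ^ 32 := by
    calc ρ ^ 2 * ρ ^ 2 ≤ s ^ 16 * s ^ 16 := by gcongr
      _ = _ := by ring
  have hM0 : (0 : ℝ) ≤ M := Nat.cast_nonneg _
  have hMA1 : 24 * (M : ℝ) ≤ A := by nlinarith
  have hMA2 : 128 * ((M : ℝ) * (M + 1)) ≤ A := by nlinarith
  have hMA3 : 128 * ((M : ℝ) * M) ≤ A := by nlinarith
  have hCr0 : ∀ m, 0 ≤ 3 * (s ^ 20)⁻¹ + (2 * A * s ^ 10)⁻¹ * g m := fun m => by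
    have := hg0 m; positivity
  have hCn0 : ∀ m, 0 ≤ 8 * A * (s ^ 8)⁻¹ + g m := fun m => by
    have := hg0 m; positivity
  refine ⟨fun m => 8 * A * (s ^ 8)⁻¹ + g m, fun m => 3 * (s ^ 20)⁻¹ + (2 * A * s ^ 10)⁻¹ * g m,
    fun m => ?_, fun m => ?_, fun m hm => ?_, fun m _ => ?_, fun m _ => ?_, ?_⟩
  · have h1 : 1 ≤ (s ^ 8)⁻¹ := (one_le_inv₀ (by positivity)).2 (pow_le_one₀ hs.le hle1)
    have := hg0 m
    nlinarith
  · have h1 : 8 * A * (s ^ 8)⁻¹ ≤ 3 * (s ^ 20)⁻¹ := by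
      have e : 3 * (s ^ 20)⁻¹ - 8 * A * (s ^ 8)⁻¹ = (s ^ 20)⁻¹ * (3 - 8 * A * s ^ 12) := by
        field_simp
      have h2 : 8 * A * s ^ 12 ≤ 3 := by
        calc 8 * A * s ^ 12 = 4 * (2 * A * s) * s ^ 11 := by ring
          _ ≤ 4 * 1 * (1 / 16) ^ 11 := by gcongr
          _ ≤ 3 := by norm_num
      have h3 : 0 ≤ (s ^ 20)⁻¹ * (3 - 8 * A * s ^ 12) :=
        mul_nonneg (by positivity) (by linarith)
      linarith
    have h4 : 1 ≤ (2 * A * s ^ 10)⁻¹ := by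
      refine (one_le_inv₀ (by positivity)).2 ?_
      calc 2 * A * s ^ 10 = (2 * A * s) * s ^ 9 := by ring
        _ ≤ 1 * 1 := by gcongr; exact pow_le_one₀ hs.le hle1
        _ = 1 := by ring
    have := mul_le_mul_of_nonneg_right h4 (hg0 m)
    linarith
  · have h0 : 0 ≤ 8 * A * (s ^ 8)⁻¹ := by positivity
    have := hgle m hm
    linarith
  · have h1 : 2 * M * (8 * ρ ^ 2 + 4 * ρ ^ 2) ≤ A * s ^ 16 := by
      calc 2 * M * (8 * ρ ^ 2 + 4 * ρ ^ 2) = (24 * M) * ρ ^ 2 := by ring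
        _ ≤ A * s ^ 16 := by gcongr
    have h2 : M * (2 * M) * (2 * (8 * ρ ^ 2) * (4 * ρ ^ 2)) * (s ^ 20)⁻¹ ≤ A * s ^ 12 := by
      calc M * (2 * M) * (2 * (8 * ρ ^ 2) * (4 * ρ ^ 2)) * (s ^ 20)⁻¹
          = (128 * (M * M)) * (ρ ^ 2 * ρ ^ 2) * (s ^ 20)⁻¹ := by ring
        _ ≤ A * s ^ 32 * (s ^ 20)⁻¹ := by gcongr
        _ = A * s ^ 12 := by field_simp
    have h3 := mul_le_mul_of_nonneg_right h1 (hCr0 (m + 1))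
    have h4 := mul_le_mul_of_nonneg_right h2 (hCr0 (m + 2))
    refine (add_le_add (add_le_add le_rfl h3) h4).trans ?_
    rw [hg1, hg2]
    have e : 2 + A * s ^ 16 * (3 * (s ^ 20)⁻¹ + (2 * A * s ^ 10)⁻¹ * (g m / (2 * A * s))) +
        A * s ^ 12 * (3 * (s ^ 20)⁻¹ + (2 * A * s ^ 10)⁻¹ * (g m / (2 * A * s) ^ 2))
        = 2 + 3 * A * (s ^ 8)⁻¹ * s ^ 4 + 3 * A * (s ^ 8)⁻¹
          + (s ^ 5 / (4 * A) + 1 / (8 * A ^ 2)) * g m := by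
      field_simp
      ring
    rw [e]
    have h5 : 1 ≤ (s ^ 8)⁻¹ := (one_le_inv₀ (by positivity)).2 (pow_le_one₀ hs.le hle1)
    have h6 : 3 * A * (s ^ 8)⁻¹ * s ^ 4 ≤ 3 * A * (s ^ 8)⁻¹ * 1 := by gcongr; linarith
    have h7 : s ^ 5 / (4 * A) + 1 / (8 * A ^ 2) ≤ 1 := by
      have a1 : s ^ 5 / (4 * A) ≤ 1 / 2 := by
        rw [div_le_iff₀ (by positivity)]
        have : s ^ 5 ≤ 1 := pow_le_one₀ hs.le hle1
        linarith
      have a2 : 1 / (8 * A ^ 2) ≤ 1 / 2 := by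
        rw [div_le_iff₀ (by positivity)]
        nlinarith
      linarith
    have h8 := mul_le_mul_of_nonneg_right h7 (hg0 m)
    have h9 : 128 * 1 ≤ A * (s ^ 8)⁻¹ := by gcongr
    nlinarith
  · have h1 : 2 * M * (8 * ρ ^ 2) ≤ A * s ^ 16 := by
      calc 2 * M * (8 * ρ ^ 2) = (16 * M) * ρ ^ 2 := by ring
        _ ≤ A * s ^ 16 := by gcongr; linarith
    have h2 : (M + 1) * (2 * M) * (2 * (8 * ρ ^ 2) * (4 * ρ ^ 2)) * (s ^ 20)⁻¹
        ≤ A * s ^ 12 := by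
      calc (M + 1) * (2 * M) * (2 * (8 * ρ ^ 2) * (4 * ρ ^ 2)) * (s ^ 20)⁻¹
          = (128 * ((M : ℝ) * (M + 1))) * (ρ ^ 2 * ρ ^ 2) * (s ^ 20)⁻¹ := by ring
        _ ≤ A * s ^ 32 * (s ^ 20)⁻¹ := by gcongr
        _ = A * s ^ 12 := by field_simp
    have h3 := mul_le_mul_of_nonneg_right h1 (hCn0 (m + 1))
    have h4 := mul_le_mul_of_nonneg_right h2 (hCn0 (m + 2))
    refine (mul_le_mul_of_nonneg_left (add_le_add (add_le_add le_rfl h3) h4)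
      (by positivity)).trans ?_
    rw [hg1, hg2]
    have e : (s ^ 20)⁻¹ * (2 + A * s ^ 16 * (8 * A * (s ^ 8)⁻¹ + g m / (2 * A * s)) +
        A * s ^ 12 * (8 * A * (s ^ 8)⁻¹ + g m / (2 * A * s) ^ 2))
        = (s ^ 20)⁻¹ * (2 + 8 * A ^ 2 * s ^ 8 + 8 * A ^ 2 * s ^ 4)
          + (2 * A * s ^ 10)⁻¹ * ((A * s ^ 5 + 1 / 2) * g m) := by
      field_simp
      ring
    rw [e]
    have h5 : s ^ 8 ≤ s ^ 4 := pow_le_pow_of_le_one hs.le hle1 (by norm_num)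
    have h6 : 2 + 8 * A ^ 2 * s ^ 8 + 8 * A ^ 2 * s ^ 4 ≤ 3 := by
      have : 8 * A ^ 2 * s ^ 8 ≤ 8 * A ^ 2 * s ^ 4 := by gcongr
      linarith
    have h7 : A * s ^ 5 + 1 / 2 ≤ 1 := by
      have : A * s ^ 5 ≤ 1 / 2 := by
        calc A * s ^ 5 = (2 * A * s) * s ^ 4 / 2 := by ring
          _ ≤ 1 * 1 / 2 := by gcongr; linarith
          _ = 1 / 2 := by ring
      linarith
    have h8 := mul_le_mul_of_nonneg_right h7 (hg0 m)
    have h9 := mul_le_mul_of_nonneg_left h6 (show 0 ≤ (s ^ 20)⁻¹ by positivity)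
    have h10 := mul_le_mul_of_nonneg_left h8 (show 0 ≤ (2 * A * s ^ 10)⁻¹ by positivity)
    linarith
  · have h1 := mul_le_mul_of_nonneg_left hg3 (show 0 ≤ (2 * A * s ^ 10)⁻¹ by positivity)
    have h2 : 4 * (8 * ρ ^ 2 + 4 * ρ ^ 2) * (3 * (s ^ 20)⁻¹ + (2 * A * s ^ 10)⁻¹ * g 3)
        ≤ 48 * s ^ 16 * (3 * (s ^ 20)⁻¹ + (2 * A * s ^ 10)⁻¹ * (4 * A ^ 2 * s ^ 2)⁻¹) := by
      have := hCr0 3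
      calc _ = 48 * ρ ^ 2 * (3 * (s ^ 20)⁻¹ + (2 * A * s ^ 10)⁻¹ * g 3) := by ring
        _ ≤ _ := by gcongr
    have h3 : 0 ≤ 2 + 4 * (8 * ρ ^ 2 + 4 * ρ ^ 2) * (3 * (s ^ 20)⁻¹ + (2 * A * s ^ 10)⁻¹ * g 3) := by
      have := hCr0 3
      positivity
    calc _ ≤ 256 * s ^ 8 * (2 + 48 * s ^ 16 * (3 * (s ^ 20)⁻¹
            + (2 * A * s ^ 10)⁻¹ * (4 * A ^ 2 * s ^ 2)⁻¹)) := by gcongr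
      _ = 512 * s ^ 8 + 256 * 144 * s ^ 4 + 1536 / A ^ 3 * s ^ 12 := by field_simp; ring
      _ ≤ 1 := by
        have a1 : s ^ 8 ≤ s ^ 4 * (1 / 65536) := by
          calc s ^ 8 = s ^ 4 * s ^ 4 := by ring
            _ ≤ _ := by gcongr
        have a2 : s ^ 12 ≤ 1 / 65536 := by
          calc s ^ 12 ≤ s ^ 4 := pow_le_pow_of_le_one hs.le hle1 (by norm_num)
            _ ≤ _ := hs4
        have a3 : 1536 / A ^ 3 ≤ 1 := by
          rw [div_le_one (by positivity)]
          calc (1536 : ℝ) ≤ 128 ^ 3 := by norm_num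
            _ ≤ A ^ 3 := by gcongr
        have a4 : 1536 / A ^ 3 * s ^ 12 ≤ 1 * (1 / 65536) := by gcongr
        linarith

/-! ### Variation of the actions along a flow -/

theorem exists_action_variation_bound {σ θ N T s A ρ τ : ℝ} {M : ℕ} {z : ℝ → ℤ → ℂ} {y : ℤ → ℝ}
    (hσ : 0 < σ) (h0 : 0 < θ) (h1 : θ < 1) (hN : 0 < N)
    (hs : 0 < s) (hs1 : s ≤ 1 / 16) (hA : 128 * ((M : ℝ) + 1) ^ 2 ≤ A) (hAs : 2 * A * s ≤ 1)
    (hM : 2 ≤ M) (hTM : T * (2 * A * s) ^ M ≤ 1) (hρ : 0 < ρ) (hρs : ρ ≤ s ^ 8)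
    (hTl : T ≤ Real.exp (σ * (1 - θ) * N ^ θ)) (hτ : 0 < τ) (hτT : τ ≤ T)
    (hys : Summable fun a => wt σ θ a * y a) (hyρ : ∑' a, wt σ θ a * y a ≤ ρ)
    (ode : ∀ t ∈ Set.Ioo (-τ) τ, ∀ a, HasDerivAt (fun s => z s a) (vf (z t) a) t)
    (bd : ∀ t ∈ Set.Ioo (-τ) τ, ∀ a, ‖z t a‖ ≤ y a)
    (hfr : ∀ S : Multiset (Bool × ℤ), ch S = 0 → mo S = 0 → dl S = 0 → S.card ≤ 2 * M →
      S.map flipI ≠ S → (S.filter fun i => N < |(i.2 : ℝ)|).card ≤ 2 →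
      ∀ t ∈ Set.Ioo (-τ) τ, s ^ 20 ≤ |fr (z t) S|) :
    ∃ d : ℤ → ℝ, (∀ a, 0 ≤ d a) ∧ (Summable fun a => wt σ θ a * d a) ∧
      ∑' a, wt σ θ a * d a ≤ ρ ^ ((3 : ℝ) / 2) ∧
      ∀ t ∈ Set.Ioo (-τ) τ, ∀ a, |‖z t a‖ ^ 2 - ‖z 0 a‖ ^ 2| ≤ d a ^ 2 := by
  obtain ⟨l, hl⟩ : ∃ l, l = Real.exp (σ * (1 - θ) * N ^ θ) := ⟨_, rfl⟩
  have hT : 0 < T := hτ.trans_le hτT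
  have hl1 : 1 ≤ l := by
    rw [hl]; apply Real.one_le_exp
    have : 0 ≤ 1 - θ := by linarith
    positivity
  have hl0 : 0 < l := by linarith
  rw [← hl] at hTl
  have hy0 : ∀ a, 0 ≤ y a := fun a => (norm_nonneg _).trans (bd 0 ⟨by linarith, hτ⟩ a)
  have hw1 : ∀ a, 1 ≤ wt σ θ a := one_le_wt hσ
  have hv1 : ∀ a, 1 ≤ lowWt σ θ N a := one_le_lowWt hσ h0 hN
  have hw0 : ∀ a, 0 ≤ wt σ θ a := fun a => zero_le_one.trans (hw1 a)
  have hv0 : ∀ a, 0 ≤ lowWt σ θ N a := fun a => zero_le_one.trans (hv1 a)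
  obtain ⟨Y, hyY, hYs, hYρ, hYt, hYc⟩ :=
    exists_conv_majorant hρ hw1 (wt_submul hσ h0 h1) hy0 hys hyρ
  have ha0 : ∀ a, 0 ≤ amp N l y a := fun a => by
    unfold amp; split_ifs
    · exact mul_nonneg hl0.le (hy0 a)
    · exact hy0 a
  have hale : ∀ a, lowWt σ θ N a * amp N l y a ≤ wt σ θ a * y a := fun a => by
    rw [hl]; exact lowWt_mul_amp_le hσ h1 hN hy0 a
  have has : Summable fun a => lowWt σ θ N a * amp N l y a :=
    Summable.of_nonneg_of_le (fun a => mul_nonneg (hv0 a) (ha0 a)) hale hys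
  obtain ⟨V, haV, hVs, hVρ, hVt, hVc⟩ :=
    exists_conv_majorant hρ hv1 (lowWt_submul hσ h0 h1 hN) ha0 has
      ((has.tsum_le_tsum hale hys).trans hyρ)
  have hY0 : ∀ a, 0 ≤ Y a := fun a => (hy0 a).trans (hyY a)
  have hV0 : ∀ a, 0 ≤ V a := fun a => (ha0 a).trans (haV a)
  have cY : ConvStable Y ρ := .of_weight hw1 hY0 hYs hYρ hYt hYc
  have cV : ConvStable V ρ := .of_weight hv1 hV0 hVs hVρ hVt hVc
  obtain ⟨μ, hμ⟩ : ∃ μ, μ = T / l ^ 3 := ⟨_, rfl⟩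
  have hμ0 : 0 ≤ μ := by rw [hμ]; positivity
  have F := cY.modeFlow cV hτ hμ0 ode bd hyY
  obtain ⟨Cn, Cr, hn, hnr, hleaf, hrecn, hrecr, hC⟩ :=
    exists_recursion_constants hs hs1 hA hAs hT.le hTM hρ.le hρs
  have hδ : 0 < s ^ 20 := by positivity
  have main := fun {t : ℝ} (ht : t ∈ Set.Ioo (-τ) τ) (a : ℤ) =>
    F.abs_norm_sq_sub_le hδ hτT (fun S hc hm hd hcard hne => by
      by_cases hi : (S.filter fun i => N < |(i.2 : ℝ)|).card ≤ 2
      · exact Or.inl ⟨hcard, hfr S hc hm hd hcard hne hi⟩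
      · right
        intro t ht
        have e1 : ‖mon (z t) S‖ ≤ seqProd y S := norm_mon_le (bd t ht) S
        have e2 := seqProd_mul_pow_le (N := N) hl1 hy0 3 S (by omega)
        have e3 := e2.trans (seqProd_le ha0 haV S)
        have e4 := mul_le_mul_of_nonneg_left e3 hμ0
        have e5 := seqProd_nonneg hY0 S
        have e6 : T * seqProd y S = μ * (l ^ 3 * seqProd y S) := by
          rw [hμ]; field_simp
        have e7 := mul_le_mul_of_nonneg_left e1 hT.le
        linarith) hn hnr hleaf hrecn hrecr ht a
  have hCr3 : 0 ≤ Cr 3 := by linarith [hn 3, hnr 3]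
  obtain ⟨C, hCd⟩ : ∃ C, C = 2 + 4 * (8 * ρ ^ 2 + 4 * ρ ^ 2) * Cr 3 := ⟨_, rfl⟩
  rw [← hCd] at hC
  have hC0 : 0 ≤ C := by rw [hCd]; positivity
  obtain ⟨q, hq⟩ : ∃ q, q = Real.sqrt (2 * (8 * ρ ^ 2) * C) := ⟨_, rfl⟩
  have hq0 : 0 ≤ q := hq ▸ Real.sqrt_nonneg _
  have hq2 : q ^ 2 = 2 * (8 * ρ ^ 2) * C := by rw [hq]; exact Real.sq_sqrt (by positivity)
  obtain ⟨m, hm⟩ : ∃ m, m = Real.sqrt μ := ⟨_, rfl⟩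
  have hm0 : 0 ≤ m := hm ▸ Real.sqrt_nonneg _
  have hm2 : m ^ 2 = μ := by rw [hm]; exact Real.sq_sqrt hμ0
  have hml : m * l ≤ 1 := by
    have : (m * l) ^ 2 ≤ 1 := by
      rw [mul_pow, hm2, hμ]
      have : T / l ^ 3 * l ^ 2 = T / l := by field_simp
      rw [this]; exact (div_le_one hl0).2 hTl
    nlinarith [mul_nonneg hm0 hl0.le]
  have hVw : ∀ a, wt σ θ a * V a ≤ l * (lowWt σ θ N a * V a) := fun a => by
    rw [← mul_assoc]
    refine mul_le_mul_of_nonneg_right ?_ (hV0 a)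
    rw [hl]; exact wt_le_mul_lowWt hσ h0 h1 hN a
  have hVws : Summable fun a => wt σ θ a * V a :=
    Summable.of_nonneg_of_le (fun a => mul_nonneg (hw0 a) (hV0 a)) hVw (hVs.mul_left l)
  have hVwle : ∑' a, wt σ θ a * V a ≤ l * (2 * ρ) := by
    refine (hVws.tsum_le_tsum hVw (hVs.mul_left l)).trans ?_
    rw [tsum_mul_left]
    exact mul_le_mul_of_nonneg_left hVρ hl0.le
  have hd : ∀ a, wt σ θ a * (q * (Y a + m * V a))
      = q * (wt σ θ a * Y a + m * (wt σ θ a * V a)) := fun a => by ring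
  have hsum : Summable fun a => wt σ θ a * Y a + m * (wt σ θ a * V a) :=
    hYs.add (hVws.mul_left m)
  refine ⟨fun a => q * (Y a + m * V a), fun a =>
    mul_nonneg hq0 (add_nonneg (hY0 a) (mul_nonneg hm0 (hV0 a))), ?_, ?_, fun t ht a => ?_⟩
  · simp only [hd]; exact hsum.mul_left q
  · simp only [hd]
    rw [tsum_mul_left, hYs.tsum_add (hVws.mul_left m), tsum_mul_left]
    have e1 : ∑' a, wt σ θ a * Y a + m * ∑' a, wt σ θ a * V a ≤ 4 * ρ := by
      have h2 := mul_le_mul_of_nonneg_left hVwle hm0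
      have h3 := mul_le_mul_of_nonneg_right hml (show 0 ≤ 2 * ρ by linarith)
      linarith
    refine (mul_le_mul_of_nonneg_left e1 hq0).trans ?_
    have e2 : (ρ ^ ((3 : ℝ) / 2)) ^ 2 = ρ ^ 3 := by
      rw [← Real.rpow_natCast, ← Real.rpow_mul hρ.le, ← Real.rpow_natCast]
      norm_num
    apply le_of_sq_le_sq ?_ (by positivity)
    rw [e2, mul_pow, hq2]
    have := mul_le_mul_of_nonneg_right hC (show 0 ≤ ρ ^ 3 by positivity)
    linarith
  · refine (main ht a).trans ?_
    have hYa := hY0 a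
    have hVa := hV0 a
    simp only [sq2, seqProd, Multiset.insert_eq_cons, Multiset.map_cons, Multiset.map_singleton,
      Multiset.prod_cons, Multiset.prod_singleton]
    rw [mul_pow, hq2, ← hCd, ← hm2]
    refine mul_le_mul_of_nonneg_left ?_ (by positivity)
    nlinarith [mul_nonneg hm0 (mul_nonneg hYa hVa)]

/-! ### Lower bounds for the modulated frequencies -/

theorem sg_eq (b : Bool) : sg b = 1 ∨ sg b = -1 := by cases b <;> simp [sg]

theorem sg_injective {b c : Bool} (h : sg b = sg c) : b = c := by
  cases b <;> cases c <;> simp_all [sg]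

theorem flipI_flipI (i : Bool × ℤ) : flipI (flipI i) = i := by simp [flipI]

theorem abs_Om_sub_le {u w : ℤ → ℂ} {g : ℤ → ℝ} (hu : Summable fun a => ‖u a‖ ^ 2)
    (hg : Summable g) (h : ∀ a, |‖w a‖ ^ 2 - ‖u a‖ ^ 2| ≤ g a) (a : ℤ) :
    |Om w a - Om u a| ≤ ∑' e, g e := by
  have hg0 : ∀ a, 0 ≤ g a := fun a => (abs_nonneg _).trans (h a)
  have hw : Summable fun a => ‖w a‖ ^ 2 := by
    refine Summable.of_nonneg_of_le (fun a => sq_nonneg _) (fun a => ?_) (hu.add hg)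
    have := (abs_le.1 (h a)).2
    linarith
  have hq : ∀ {v : ℤ → ℂ}, (Summable fun a => ‖v a‖ ^ 2) →
      Summable fun e => qk a e * ‖v e‖ ^ 2 := fun hv =>
    Summable.of_nonneg_of_le (fun e => mul_nonneg (qk_nonneg a e) (sq_nonneg _))
      (fun e => mul_le_of_le_one_left (sq_nonneg _) (qk_le_one a e)) hv
  unfold Om
  rw [← (hq hw).tsum_sub (hq hu)]
  refine tsum_of_norm_bounded (f := fun e => qk a e * ‖w e‖ ^ 2 - qk a e * ‖u e‖ ^ 2)
    hg.hasSum fun e => ?_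
  rw [← mul_sub, Real.norm_eq_abs, abs_mul, abs_of_nonneg (qk_nonneg a e)]
  exact (mul_le_of_le_one_left (abs_nonneg _) (qk_le_one a e)).trans (h e)

theorem abs_fr_sub_le {u w : ℤ → ℂ} {c : ℝ} (h : ∀ a, |Om w a - Om u a| ≤ c)
    (S : Multiset (Bool × ℤ)) : |fr w S - fr u S| ≤ S.card * c := by
  induction S using Multiset.induction_on with
  | empty => simp [fr]
  | cons i S ih =>
    have e : fr w (i ::ₘ S) - fr u (i ::ₘ S)
        = sg i.1 * (Om w i.2 - Om u i.2) + (fr w S - fr u S) := by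
      simp [fr]; ring
    rw [e, Multiset.card_cons]
    refine (abs_add_le _ _).trans ?_
    have h1 : |(sg i.1 : ℝ) * (Om w i.2 - Om u i.2)| ≤ c := by
      rw [abs_mul]
      have : |(sg i.1 : ℝ)| = 1 := by rcases sg_eq i.1 with h | h <;> simp [h]
      rw [this, one_mul]; exact h _
    push_cast
    linarith

theorem even_card_of_ch_eq_zero {S : Multiset (Bool × ℤ)} (h : ch S = 0) : Even S.card := by
  have key : ∀ S : Multiset (Bool × ℤ), Even (ch S + S.card) := by
    intro S
    induction S using Multiset.induction_on with
    | empty => simp [ch]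
    | cons i S ih =>
      have e : ch (i ::ₘ S) = sg i.1 + ch S := by simp [ch]
      rw [e, Multiset.card_cons]
      push_cast
      rcases sg_eq i.1 with h | h <;> rw [h]
      · obtain ⟨k, hk⟩ := ih; exact ⟨k + 1, by omega⟩
      · obtain ⟨k, hk⟩ := ih; exact ⟨k, by omega⟩
  have := key S
  rw [h, zero_add] at this
  exact_mod_cast this

theorem exists_fin_eq (S : Multiset (Bool × ℤ)) :
    ∃ f : Fin S.card → Bool × ℤ, (Finset.univ : Finset (Fin S.card)).val.map f = S := by
  induction S using Quotient.inductionOn with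
  | h l =>
    refine ⟨fun i => l.get i, ?_⟩
    rw [Fin.univ_val_map]
    simp

theorem omegaM_PiM_eq {n : ℕ} (f : Fin n → Bool × ℤ) (L : ℝ) (z : ℤ → ℂ) :
    omegaM L (fun α => (sg (f α).1, (f α).2)) (PiM L z)
      = fr (PiM L z) ((Finset.univ : Finset (Fin n)).val.map f) := by
  unfold omegaM fr
  rw [Multiset.map_map]
  refine Finset.sum_congr rfl fun β _ => ?_
  simp only [Function.comp, Om]
  congr 1
  refine tsum_congr fun a => ?_
  simp only [PiM]
  by_cases h1 : a = (f β).2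
  · simp [h1, qk_self]
  · by_cases h2 : |(a : ℝ)| ≤ L
    · simp only [h1, h2, ne_eq, not_false_eq_true, and_self, if_true, qk, div_eq_inv_mul]
      congr 2; ring
    · simp [h2]

/-- The small divisor estimate for resonant multi-indices with small entries. -/
theorem lt_abs_fr_PiM {δ L : ℝ} {M : ℕ} {z : ℤ → ℂ} (hL : 1 ≤ L)
    (hV : inV δ (2 * M) L (PiM L z)) {S : Multiset (Bool × ℤ)} (hc : ch S = 0) (hm : mo S = 0)
    (hd : dl S = 0) (hcard : S.card ≤ 2 * M) (hne : S.map flipI ≠ S)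
    (hS : ∀ i ∈ S, |(i.2 : ℝ)| ≤ L) : δ < |fr (PiM L z) S| := by
  obtain ⟨m, hmm⟩ := (even_iff_two_dvd.1 (even_card_of_ch_eq_zero hc))
  obtain ⟨f, hf⟩ := exists_fin_eq S
  rw [hmm] at hcard
  generalize S.card = n at *
  subst hmm
  have hm1 : 1 ≤ m := by
    rcases Nat.eq_zero_or_pos m with h | h
    · subst h
      exfalso; apply hne
      rw [← hf]; simp
    · exact h
  rw [← hf, ← omegaM_PiM_eq]
  have hsum : ∀ g : Bool × ℤ → ℤ, (S.map g).sum = ∑ α, g (f α) := fun g => by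
    rw [← hf, Multiset.map_map]; rfl
  refine hV m hm1 _ ⟨⟨fun α => sg_eq _, ?_, ?_⟩, ?_⟩ ?_ ?_ ?_
  · rw [← hc]; exact (hsum fun i => sg i.1).symm
  · rw [← hm]; exact (hsum fun i => sg i.1 * i.2).symm
  · rw [← hd]; exact (hsum fun i => sg i.1 * i.2 ^ 2).symm
  · rintro ⟨φ, hφ⟩
    apply hne
    have h1 : ∀ α, f (φ α) = flipI (f α) := fun α => by
      have h2 := hφ α
      simp only [Prod.mk.injEq] at h2
      rw [← sg_not] at h2
      exact Prod.ext (sg_injective h2.1) h2.2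
    have h3 : (Finset.univ : Finset (Fin (2 * m))).val.map φ = Finset.univ.val := by
      simp
    conv_rhs => rw [← hf, ← h3, Multiset.map_map]
    rw [← hf, Multiset.map_map]
    exact Multiset.map_congr rfl fun α _ => (h1 α).symm
  · exact_mod_cast hcard
  · intro β
    have h1 := hS (f β) (by rw [← hf]; exact Multiset.mem_map_of_mem f (Finset.mem_univ_val β))
    simp only [brk]
    push_cast
    refine max_le hL ?_
    rw [Nat.cast_natAbs]
    exact_mod_cast h1

theorem abs_mo_le {N : ℝ} {S : Multiset (Bool × ℤ)} (h : ∀ i ∈ S, |(i.2 : ℝ)| ≤ N) :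
    |(mo S : ℝ)| ≤ S.card * N ∧ |(dl S : ℝ)| ≤ S.card * N ^ 2 := by
  induction S using Multiset.induction_on with
  | empty => simp [mo, dl]
  | cons i S ih =>
    obtain ⟨h1, h2⟩ := ih fun j hj => h j (Multiset.mem_cons_of_mem hj)
    have hi := h i (Multiset.mem_cons_self i S)
    have e1 : mo (i ::ₘ S) = sg i.1 * i.2 + mo S := by simp [mo]
    have e2 : dl (i ::ₘ S) = sg i.1 * i.2 ^ 2 + dl S := by simp [dl]
    have hs : |(sg i.1 : ℝ)| = 1 := by rcases sg_eq i.1 with h | h <;> simp [h]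
    rw [e1, e2, Multiset.card_cons]
    push_cast
    constructor
    · refine (abs_add_le _ _).trans ?_
      rw [abs_mul, hs]; linarith
    · refine (abs_add_le _ _).trans ?_
      rw [abs_mul, hs, abs_pow]
      have : |(i.2 : ℝ)| ^ 2 ≤ N ^ 2 := by gcongr
      linarith

/-- A resonant multi-index with at most two entries beyond `N` and one beyond `L` contains a
resonant pair. -/
theorem exists_cons_flip {N L : ℝ} {M : ℕ} (hN : 1 ≤ N) (hL : 2 * M * N ^ 2 ≤ L)
    {S : Multiset (Bool × ℤ)} (hm : mo S = 0) (hd : dl S = 0) (hcard : S.card ≤ 2 * M)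
    (hhigh : (S.filter fun i => N < |(i.2 : ℝ)|).card ≤ 2) {i : Bool × ℤ} (hi : i ∈ S)
    (hiL : L < |(i.2 : ℝ)|) :
    ∃ R, S = i ::ₘ flipI i ::ₘ R ∧ ∀ j ∈ R, |(j.2 : ℝ)| ≤ N := by
  have hcard' : (S.card : ℝ) ≤ 2 * M := by exact_mod_cast hcard
  have hpos : (1 : ℝ) ≤ S.card := by exact_mod_cast Multiset.card_pos_iff_exists_mem.2 ⟨i, hi⟩
  have hNN : N ≤ N ^ 2 := by nlinarith
  have hNL : N < |(i.2 : ℝ)| := by nlinarith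
  have hSL : (S.card : ℝ) * N ^ 2 < |(i.2 : ℝ)| := by nlinarith
  obtain ⟨S', rfl⟩ := Multiset.exists_cons_of_mem hi
  rw [Multiset.filter_cons_of_pos S' hNL, Multiset.card_cons] at hhigh
  have em : mo (i ::ₘ S') = sg i.1 * i.2 + mo S' := by simp [mo]
  have ed : dl (i ::ₘ S') = sg i.1 * i.2 ^ 2 + dl S' := by simp [dl]
  rw [em] at hm
  rw [ed] at hd
  have hs : |(sg i.1 : ℝ)| = 1 := by rcases sg_eq i.1 with h | h <;> simp [h]
  by_cases hall : ∀ j ∈ S', |(j.2 : ℝ)| ≤ N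
  · exfalso
    have h1 := (abs_mo_le hall).1
    have h2 : ((mo S' : ℤ) : ℝ) = -(sg i.1 * i.2) := by
      have : mo S' = -(sg i.1 * i.2) := by omega
      rw [this]; push_cast; ring
    rw [h2, abs_neg, abs_mul, hs, one_mul] at h1
    rw [Multiset.card_cons] at hSL
    push_cast at hSL
    have : (S'.card : ℝ) * N ≤ S'.card * N ^ 2 := by gcongr
    nlinarith
  · push Not at hall
    obtain ⟨j, hj, hjN⟩ := hall
    obtain ⟨R, rfl⟩ := Multiset.exists_cons_of_mem hj
    rw [Multiset.filter_cons_of_pos R hjN, Multiset.card_cons] at hhigh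
    have hR : ∀ k ∈ R, |(k.2 : ℝ)| ≤ N := by
      have h0 : R.filter (fun i => N < |(i.2 : ℝ)|) = 0 := Multiset.card_eq_zero.1 (by omega)
      intro k hk
      by_contra hcon
      have : k ∈ R.filter (fun i => N < |(i.2 : ℝ)|) :=
        Multiset.mem_filter.2 ⟨hk, not_le.1 hcon⟩
      rw [h0] at this
      simp at this
    refine ⟨R, ?_, hR⟩
    obtain ⟨h1, h2⟩ := abs_mo_le hR
    have em : mo (j ::ₘ R) = sg j.1 * j.2 + mo R := by simp [mo]
    have ed : dl (j ::ₘ R) = sg j.1 * j.2 ^ 2 + dl R := by simp [dl]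
    rw [em] at hm
    rw [ed] at hd
    rw [Multiset.card_cons, Multiset.card_cons] at hSL
    push_cast at hSL
    have hRc : (R.card : ℝ) * N ≤ R.card * N ^ 2 := by gcongr
    have hb1 : |(mo R : ℝ)| < |(i.2 : ℝ)| := by nlinarith
    have hb2 : |(dl R : ℝ)| < |(i.2 : ℝ)| := by nlinarith
    have hb1' : |mo R| < |i.2| := by exact_mod_cast hb1
    have hb2' : |dl R| < |i.2| := by exact_mod_cast hb2
    clear hb1 hb2 h1 h2
    obtain ⟨bi, a⟩ := i
    obtain ⟨bj, b⟩ := j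
    simp only at *
    have ha0 : 0 < |a| := lt_of_le_of_lt (abs_nonneg _) hb1'
    have habs : |a| ^ 2 = a ^ 2 := sq_abs a
    have hbbs : |b| ^ 2 = b ^ 2 := sq_abs b
    have hb0 : 0 ≤ |b| := abs_nonneg b
    have goal : bj = (!bi) ∧ b = a := by
      by_cases hbb : bj = bi
      · exfalso
        subst hbb
        have : |dl R| = a ^ 2 + b ^ 2 := by
          have e : dl R = -(sg bj * (a ^ 2 + b ^ 2)) := by linarith
          rw [e, abs_neg, abs_mul, abs_of_nonneg (by positivity : 0 ≤ a ^ 2 + b ^ 2)]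
          rcases sg_eq bj with h | h <;> simp [h]
        nlinarith
      · have hbj : bj = (!bi) := by cases bj <;> cases bi <;> simp_all
        refine ⟨hbj, ?_⟩
        rw [hbj, sg_not] at hm hd
        have e1 : |mo R| = |a - b| := by
          have e : mo R = -(sg bi * (a - b)) := by linarith
          rw [e, abs_neg, abs_mul]
          rcases sg_eq bi with h | h <;> simp [h]
        have e2 : |dl R| = |a ^ 2 - b ^ 2| := by
          have e : dl R = -(sg bi * (a ^ 2 - b ^ 2)) := by linarith
          rw [e, abs_neg, abs_mul]
          rcases sg_eq bi with h | h <;> simp [h]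
        rw [e1] at hb1'
        rw [e2, ← habs, ← hbbs] at hb2'
        have hab : |a| = |b| := by
          by_contra hne
          rcases lt_or_gt_of_ne hne with h | h
          · rw [abs_of_nonpos (by nlinarith)] at hb2'
            nlinarith
          · rw [abs_of_nonneg (by nlinarith)] at hb2'
            nlinarith
        rcases abs_eq_abs.1 hab with h | h
        · exact h.symm
        · exfalso
          have : b = -a := by omega
          rw [this] at hb1'
          have e : |a - -a| = 2 * |a| := by
            rw [show a - -a = 2 * a by ring, abs_mul]; simp
          omega
    obtain ⟨g1, g2⟩ := goal
    simp only [flipI, g1, g2]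

/-- The small divisor estimate along a slowly varying trajectory. -/
theorem le_abs_fr {δ N L : ℝ} {M : ℕ} {z w : ℤ → ℂ} {g : ℤ → ℝ} (hN : 1 ≤ N)
    (hM : 1 ≤ M) (hL : 2 * M * N ^ 2 ≤ L) (hV : inV (10 * δ) (2 * M) L (PiM L z))
    (hz : Summable fun a => ‖PiM L z a‖ ^ 2) (hg : Summable g)
    (hgw : ∀ a, |‖w a‖ ^ 2 - ‖PiM L z a‖ ^ 2| ≤ g a) (hgδ : 2 * M * ∑' a, g a ≤ 9 * δ)
    {S : Multiset (Bool × ℤ)} (hc : ch S = 0) (hm : mo S = 0)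
    (hd : dl S = 0) (hcard : S.card ≤ 2 * M) (hne : S.map flipI ≠ S)
    (hhigh : (S.filter fun i => N < |(i.2 : ℝ)|).card ≤ 2) : δ ≤ |fr w S| := by
  have hNN : N ≤ N ^ 2 := by nlinarith
  have hM' : (1 : ℝ) ≤ M := by exact_mod_cast hM
  have hNL : N ≤ L := by nlinarith
  have hL1 : 1 ≤ L := hN.trans hNL
  have key : ∀ S : Multiset (Bool × ℤ), ch S = 0 → mo S = 0 → dl S = 0 → S.card ≤ 2 * M →
      S.map flipI ≠ S → (∀ i ∈ S, |(i.2 : ℝ)| ≤ L) → δ ≤ |fr w S| := by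
    intro S hc hm hd hcard hne hS
    have h1 := lt_abs_fr_PiM hL1 hV hc hm hd hcard hne hS
    have h2 := abs_fr_sub_le (abs_Om_sub_le hz hg hgw) S
    have h3 : 0 ≤ ∑' a, g a := tsum_nonneg fun a => (abs_nonneg _).trans (hgw a)
    have h4 : (S.card : ℝ) * ∑' a, g a ≤ 2 * M * ∑' a, g a := by
      gcongr; exact_mod_cast hcard
    have h5 := abs_sub_abs_le_abs_sub (fr (PiM L z) S) (fr w S)
    rw [abs_sub_comm] at h5
    linarith
  by_cases hS : ∀ i ∈ S, |(i.2 : ℝ)| ≤ L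
  · exact key S hc hm hd hcard hne hS
  · push Not at hS
    obtain ⟨i, hi, hiL⟩ := hS
    obtain ⟨R, rfl, hR⟩ := exists_cons_flip hN hL hm hd hcard hhigh hi hiL
    have e1 : fr w (i ::ₘ flipI i ::ₘ R) = fr w R := by
      simp [fr, flipI, sg_not]
    have e2 : ch (i ::ₘ flipI i ::ₘ R) = ch R := by simp [ch, flipI, sg_not]
    have e3 : mo (i ::ₘ flipI i ::ₘ R) = mo R := by simp [mo, flipI, sg_not]
    have e4 : dl (i ::ₘ flipI i ::ₘ R) = dl R := by simp [dl, flipI, sg_not]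
    rw [e1]
    refine key R (e2 ▸ hc) (e3 ▸ hm) (e4 ▸ hd) ?_ ?_ fun j hj => (hR j hj).trans hNL
    · simp only [Multiset.card_cons] at hcard; omega
    · intro h
      apply hne
      rw [Multiset.map_cons, Multiset.map_cons, h, flipI_flipI, Multiset.cons_swap]

/-! ### A truncated cubic flow on `ℓ¹` -/

/-- The space `ℓ¹(ℤ; ℂ)`. -/
abbrev EllOne : Type := lp (fun _ : ℤ => ℂ) 1

theorem EllOne.summable_norm (v : EllOne) : Summable fun a => ‖v a‖ := by
  simpa using (lp.memℓp v).summable (by simp)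

theorem EllOne.norm_eq (v : EllOne) : ‖v‖ = ∑' a, ‖v a‖ := by
  simpa using lp.norm_eq_tsum_rpow (p := 1) (by simp) v

/-- The terms of the trilinear form with coefficients `c`. -/
def triTerm (c : ℤ × ℤ × ℤ → ℂ) (u v w : EllOne) (p : ℤ × ℤ × ℤ) : EllOne :=
  lp.single 1 p.1 (c p * (u p.2.1 * (starRingEnd ℂ) (v (p.2.1 + p.2.2 - p.1)) * w p.2.2))

/-- The trilinear form with coefficients `c`. -/
def tri (c : ℤ × ℤ × ℤ → ℂ) (u v w : EllOne) : EllOne := ∑' p, triTerm c u v w p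

section tri

variable {c : ℤ × ℤ × ℤ → ℂ}

theorem norm_triTerm_le (hc : ∀ p, ‖c p‖ ≤ 1) (u v w : EllOne) (p : ℤ × ℤ × ℤ) :
    ‖triTerm c u v w p‖ ≤ ‖u p.2.1‖ * ‖v (p.2.1 + p.2.2 - p.1)‖ * ‖w p.2.2‖ := by
  rw [triTerm, lp.norm_single (by simp), norm_mul, norm_mul, norm_mul, RCLike.norm_conj]
  exact mul_le_of_le_one_left (by positivity) (hc p)

theorem summable_tri_bound (u v w : EllOne) :
    (Summable fun p : ℤ × ℤ × ℤ => ‖u p.2.1‖ * ‖v (p.2.1 + p.2.2 - p.1)‖ * ‖w p.2.2‖) ∧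
      ∑' p : ℤ × ℤ × ℤ, ‖u p.2.1‖ * ‖v (p.2.1 + p.2.2 - p.1)‖ * ‖w p.2.2‖
        ≤ ‖u‖ * ‖v‖ * ‖w‖ := by
  have h := conv_summable_of_weight (ν := fun _ => 1) (f := fun a => ‖u a‖)
    (g := fun a => ‖v a‖) (h := fun a => ‖w a‖) (fun _ => zero_le_one) (fun _ _ _ => by norm_num)
    (fun _ => norm_nonneg _) (fun _ => norm_nonneg _) (fun _ => norm_nonneg _)
    (by simpa using u.summable_norm) (by simpa using v.summable_norm)
    (by simpa using w.summable_norm)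
  simp only [one_mul] at h
  rw [u.norm_eq, v.norm_eq, w.norm_eq]
  exact h

theorem summable_triTerm (hc : ∀ p, ‖c p‖ ≤ 1) (u v w : EllOne) :
    Summable (triTerm c u v w) :=
  Summable.of_norm_bounded (summable_tri_bound u v w).1 (norm_triTerm_le hc u v w)

theorem norm_tri_le (hc : ∀ p, ‖c p‖ ≤ 1) (u v w : EllOne) :
    ‖tri c u v w‖ ≤ ‖u‖ * ‖v‖ * ‖w‖ :=
  (tsum_of_norm_bounded (summable_tri_bound u v w).1.hasSum (norm_triTerm_le hc u v w)).trans
    (summable_tri_bound u v w).2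

theorem tri_sub (hc : ∀ p, ‖c p‖ ≤ 1) (u v : EllOne) :
    tri c u u u - tri c v v v = tri c (u - v) u u + tri c v (u - v) u + tri c v v (u - v) := by
  unfold tri
  rw [← (summable_triTerm hc _ _ _).tsum_sub (summable_triTerm hc _ _ _),
    ← (summable_triTerm hc _ _ _).tsum_add (summable_triTerm hc _ _ _),
    ← ((summable_triTerm hc _ _ _).add (summable_triTerm hc _ _ _)).tsum_add
      (summable_triTerm hc _ _ _)]
  refine tsum_congr fun p => ?_
  simp only [triTerm]
  rw [← lp.single_sub, ← lp.single_add, ← lp.single_add]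
  congr 1
  simp only [lp.coeFn_sub, Pi.sub_apply, map_sub]
  ring

theorem norm_tri_sub_le (hc : ∀ p, ‖c p‖ ≤ 1) {u v : EllOne} {R : ℝ} (hu : ‖u‖ ≤ R)
    (hv : ‖v‖ ≤ R) : ‖tri c u u u - tri c v v v‖ ≤ 3 * R ^ 2 * ‖u - v‖ := by
  rw [tri_sub hc]
  have hR : 0 ≤ R := (norm_nonneg u).trans hu
  have h1 : ‖tri c (u - v) u u‖ ≤ ‖u - v‖ * R * R := (norm_tri_le hc _ _ _).trans (by gcongr)
  have h2 : ‖tri c v (u - v) u‖ ≤ R * ‖u - v‖ * R := (norm_tri_le hc _ _ _).trans (by gcongr)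
  have h3 : ‖tri c v v (u - v)‖ ≤ R * R * ‖u - v‖ := (norm_tri_le hc _ _ _).trans (by gcongr)
  have h4 := norm_add₃_le (a := tri c (u - v) u u) (b := tri c v (u - v) u)
    (c := tri c v v (u - v))
  linarith

theorem tri_apply (hc : ∀ p, ‖c p‖ ≤ 1) (u v w : EllOne) (a : ℤ) :
    tri c u v w a = ∑' x : ℤ × ℤ,
      c (a, x) * (u x.1 * (starRingEnd ℂ) (v (x.1 + x.2 - a)) * w x.2) := by
  have h0 := summable_triTerm hc u v w
  have h1 : tri c u v w a = ∑' p, triTerm c u v w p a :=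
    (lp.evalCLM ℂ (fun _ : ℤ => ℂ) 1 a).map_tsum h0
  have h2 : Summable fun p => triTerm c u v w p a :=
    h0.map (lp.evalCLM ℂ (fun _ : ℤ => ℂ) 1 a) (lp.evalCLM ℂ (fun _ : ℤ => ℂ) 1 a).continuous
  rw [h1, h2.tsum_prod, tsum_eq_single a]
  · refine tsum_congr fun x => ?_
    simp [triTerm]
  · intro b hb
    simp [triTerm, Pi.single_eq_of_ne hb.symm]

end tri

/-- The cut-off function. -/
def cutoff (R x : ℝ) : ℝ := max 0 (min 1 (2 - x / R))

theorem cutoff_nonneg (R x : ℝ) : 0 ≤ cutoff R x := le_max_left _ _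

theorem cutoff_le_one (R x : ℝ) : cutoff R x ≤ 1 :=
  max_le zero_le_one (min_le_left _ _)

theorem cutoff_eq_one {R x : ℝ} (hR : 0 < R) (hx : x ≤ R) : cutoff R x = 1 := by
  have : x / R ≤ 1 := (div_le_one hR).2 hx
  unfold cutoff
  rw [min_eq_left (by linarith), max_eq_right zero_le_one]

theorem cutoff_eq_zero {R x : ℝ} (hR : 0 < R) (hx : 2 * R ≤ x) : cutoff R x = 0 := by
  have : 2 ≤ x / R := (le_div_iff₀ hR).2 hx
  unfold cutoff
  exact max_eq_left ((min_le_right _ _).trans (by linarith))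

theorem abs_cutoff_sub_le {R : ℝ} (hR : 0 < R) (x y : ℝ) :
    |cutoff R x - cutoff R y| ≤ |x - y| / R := by
  unfold cutoff
  refine (abs_max_sub_max_le_max _ _ _ _).trans ?_
  rw [sub_self, abs_zero]
  refine max_le (by positivity) ((abs_min_sub_min_le_max _ _ _ _).trans ?_)
  rw [sub_self, abs_zero]
  refine max_le (by positivity) ?_
  rw [show 2 - x / R - (2 - y / R) = -((x - y) / R) by ring, abs_neg, abs_div, abs_of_pos hR]

/-- Evaluation at `a` as a real continuous linear map. -/
def EllOne.eval (a : ℤ) : EllOne →L[ℝ] ℂ := (lp.evalCLM ℂ (fun _ : ℤ => ℂ) 1 a).restrictScalars ℝ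

theorem EllOne.hasDerivAt_apply {α : ℝ → EllOne} {v : EllOne} {t : ℝ} (h : HasDerivAt α v t)
    (a : ℤ) : HasDerivAt (fun s => α s a) (v a) t :=
  (EllOne.eval a).hasFDerivAt.comp_hasDerivAt t h

theorem exists_majorant_of_hasDerivAt {α f : ℝ → EllOne} {p q K : ℝ} (hpq : p ≤ q)
    (hfc : ContinuousOn f (Set.Icc p q)) (hf : ∀ t ∈ Set.Icc p q, ‖f t‖ ≤ K)
    (hα : ∀ t ∈ Set.Icc p q, HasDerivAt α (f t) t) :
    ∃ e : ℤ → ℝ, (∀ a, 0 ≤ e a) ∧ Summable e ∧ ∑' a, e a ≤ K * (q - p) ∧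
      ∀ s ∈ Set.Icc p q, ∀ t ∈ Set.Icc p q, ∀ a, ‖α t a - α s a‖ ≤ e a := by
  have hfa : ∀ a, ContinuousOn (fun t => f t a) (Set.Icc p q) := fun a =>
    (EllOne.eval a).continuous.comp_continuousOn hfc
  have hii : ∀ a, IntervalIntegrable (fun t => ‖f t a‖) MeasureTheory.volume p q := fun a =>
    ((hfa a).norm.mono (by rw [Set.uIcc_of_le hpq])).intervalIntegrable
  have he0 : ∀ a, 0 ≤ ∫ t in p..q, ‖f t a‖ := fun a =>
    intervalIntegral.integral_nonneg hpq fun _ _ => norm_nonneg _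
  have hbound : ∀ F : Finset ℤ, ∑ a ∈ F, ∫ t in p..q, ‖f t a‖ ≤ K * (q - p) := fun F => by
    rw [← intervalIntegral.integral_finsetSum fun a _ => hii a]
    have h1 : ∫ t in p..q, ∑ a ∈ F, ‖f t a‖ ≤ ∫ _ in p..q, K := by
      refine intervalIntegral.integral_mono_on hpq ?_ (by simp) fun t ht => ?_
      · refine (continuousOn_finsetSum F fun a _ => ?_).intervalIntegrable
        exact (hfa a).norm.mono (by rw [Set.uIcc_of_le hpq])
      refine le_trans ?_ (hf t ht)
      rw [EllOne.norm_eq]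
      exact (EllOne.summable_norm _).sum_le_tsum F fun _ _ => norm_nonneg _
    refine h1.trans (le_of_eq ?_)
    rw [intervalIntegral.integral_const, smul_eq_mul, mul_comm]
  refine ⟨fun a => ∫ t in p..q, ‖f t a‖, he0,
    summable_of_sum_le he0 hbound, Real.tsum_le_of_sum_le he0 hbound, ?_⟩
  have hder : ∀ a, ∀ t ∈ Set.Icc p q, HasDerivAt (fun s => α s a) (f t a) t := fun a t ht =>
    EllOne.hasDerivAt_apply (hα t ht) a
  have key : ∀ a, ∀ s ∈ Set.Icc p q, ∀ t ∈ Set.Icc p q, s ≤ t →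
      ‖α t a - α s a‖ ≤ ∫ t in p..q, ‖f t a‖ := by
    intro a s hs t ht hst
    have hsub2 : Set.Icc s t ⊆ Set.Icc p q := Set.Icc_subset_Icc hs.1 ht.2
    rw [← intervalIntegral.integral_eq_sub_of_hasDerivAt (f' := fun t => f t a)
      (fun r hr => hder a r (hsub2 (by rwa [Set.uIcc_of_le hst] at hr)))
      ((hfa a).mono (by rw [Set.uIcc_of_le hst]; exact hsub2)).intervalIntegrable]
    refine (intervalIntegral.norm_integral_le_integral_norm hst).trans ?_
    exact intervalIntegral.integral_mono_interval hs.1 hst ht.2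
      (Filter.Eventually.of_forall fun _ => norm_nonneg _) (hii a)
  intro s hs t ht a
  rcases le_total s t with h | h
  · exact key a s hs t ht h
  · rw [norm_sub_rev]; exact key a t ht s hs h

/-- The truncated cubic vector field. -/
def truncField (R : ℝ) (c : ℝ → ℤ × ℤ × ℤ → ℂ) (t : ℝ) (v : EllOne) : EllOne :=
  (cutoff R ‖v‖ : ℂ) • tri (c t) v v v

section truncField

variable {R : ℝ} {c : ℝ → ℤ × ℤ × ℤ → ℂ}

theorem norm_truncField_le (hR : 0 < R) (hc : ∀ t p, ‖c t p‖ ≤ 1) (t : ℝ) (v : EllOne) :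
    ‖truncField R c t v‖ ≤ 8 * R ^ 3 := by
  unfold truncField
  rw [norm_smul, Complex.norm_real, Real.norm_of_nonneg (cutoff_nonneg _ _)]
  rcases le_total (2 * R) ‖v‖ with h | h
  · rw [cutoff_eq_zero hR h, zero_mul]; positivity
  · calc cutoff R ‖v‖ * ‖tri (c t) v v v‖ ≤ 1 * (2 * R * (2 * R) * (2 * R)) := by
          have := cutoff_nonneg R ‖v‖
          gcongr
          · exact cutoff_le_one _ _
          · exact (norm_tri_le (hc t) v v v).trans (by gcongr)
      _ = _ := by ring

theorem norm_truncField_sub_le (hR : 0 < R) (hc : ∀ t p, ‖c t p‖ ≤ 1) (t : ℝ) (u v : EllOne) :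
    ‖truncField R c t u - truncField R c t v‖ ≤ 20 * R ^ 2 * ‖u - v‖ := by
  wlog huv : ‖u‖ ≤ ‖v‖ generalizing u v with H
  · rw [norm_sub_rev, norm_sub_rev u v]; exact H v u (le_of_not_ge huv)
  rcases le_total (2 * R) ‖u‖ with hu | hu
  · have e1 : truncField R c t u = 0 := by simp [truncField, cutoff_eq_zero hR hu]
    have e2 : truncField R c t v = 0 := by simp [truncField, cutoff_eq_zero hR (hu.trans huv)]
    rw [e1, e2]; simp only [sub_self, norm_zero]; positivity
  have hG : ‖tri (c t) u u u‖ ≤ 8 * R ^ 3 := by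
    refine (norm_tri_le (hc t) u u u).trans ?_
    calc ‖u‖ * ‖u‖ * ‖u‖ ≤ (2 * R) * (2 * R) * (2 * R) := by gcongr
      _ = _ := by ring
  have hχ : |cutoff R ‖u‖ - cutoff R ‖v‖| * ‖tri (c t) u u u‖ ≤ 8 * R ^ 2 * ‖u - v‖ := by
    calc _ ≤ (‖u - v‖ / R) * (8 * R ^ 3) := by
          gcongr
          exact (abs_cutoff_sub_le hR _ _).trans (by gcongr; exact abs_norm_sub_norm_le _ _)
      _ = _ := by field_simp
  have e : truncField R c t u - truncField R c t v
      = ((cutoff R ‖u‖ - cutoff R ‖v‖ : ℝ) : ℂ) • tri (c t) u u u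
        + (cutoff R ‖v‖ : ℂ) • (tri (c t) u u u - tri (c t) v v v) := by
    unfold truncField; push_cast; module
  have h2 : ‖(cutoff R ‖v‖ : ℂ) • (tri (c t) u u u - tri (c t) v v v)‖
      ≤ 12 * R ^ 2 * ‖u - v‖ := by
    rw [norm_smul, Complex.norm_real, Real.norm_of_nonneg (cutoff_nonneg _ _)]
    rcases le_total (2 * R) ‖v‖ with hv | hv
    · rw [cutoff_eq_zero hR hv, zero_mul]; positivity
    · calc _ ≤ 1 * (3 * (2 * R) ^ 2 * ‖u - v‖) := by
            have := cutoff_nonneg R ‖v‖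
            gcongr
            · exact cutoff_le_one _ _
            · exact norm_tri_sub_le (hc t) hu hv
        _ = _ := by ring
  rw [e]
  refine (norm_add_le _ _).trans ?_
  rw [norm_smul, Complex.norm_real, Real.norm_eq_abs]
  linarith

theorem continuous_truncField (hR : 0 < R) (hc : ∀ t p, ‖c t p‖ ≤ 1)
    (hcc : ∀ p, Continuous fun t => c t p) :
    Continuous fun q : ℝ × EllOne => truncField R c q.1 q.2 := by
  refine continuous_prod_of_continuous_lipschitzWith'
    (fun q : ℝ × EllOne => truncField R c q.1 q.2) (20 * R ^ 2).toNNReal (fun t => ?_)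
    fun v => ?_
  · refine LipschitzWith.of_dist_le_mul fun u v => ?_
    rw [dist_eq_norm, dist_eq_norm, Real.coe_toNNReal _ (by positivity)]
    exact norm_truncField_sub_le hR hc t u v
  · have h : Continuous fun t => tri (c t) v v v := by
      refine continuous_tsum (fun p => ?_) (summable_tri_bound v v v).1
        fun p t => norm_triTerm_le (hc t) v v v p
      exact (lp.isometry_single (E := fun _ : ℤ => ℂ) (p := 1) p.1).continuous.comp
        ((hcc p).mul continuous_const)
    exact h.const_smul (cutoff R ‖v‖ : ℂ)

theorem exists_truncField_flow (hR : 0 < R) (hc : ∀ t p, ‖c t p‖ ≤ 1)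
    (hcc : ∀ p, Continuous fun t => c t p) {T : ℝ} (hT : 0 < T) (x₀ : EllOne) :
    ∃ α : ℝ → EllOne, α 0 = x₀ ∧ ∀ t ∈ Set.Icc (-T) T,
      HasDerivWithinAt α (truncField R c t (α t)) (Set.Icc (-T) T) t := by
  have hcont := continuous_truncField hR hc hcc
  have hP : IsPicardLindelof (truncField R c) (tmin := -T) (tmax := T)
      ⟨0, by constructor <;> linarith⟩ x₀ ((8 * R ^ 3).toNNReal * T.toNNReal) 0
      (8 * R ^ 3).toNNReal (20 * R ^ 2).toNNReal := by
    refine ⟨fun t _ => ?_, fun v _ => ?_, fun t _ v _ => ?_, ?_⟩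
    · refine (LipschitzWith.of_dist_le_mul fun u v => ?_).lipschitzOnWith
      rw [dist_eq_norm, dist_eq_norm, Real.coe_toNNReal _ (by positivity)]
      exact norm_truncField_sub_le hR hc t u v
    · exact (hcont.comp (continuous_id.prodMk continuous_const)).continuousOn
    · rw [Real.coe_toNNReal _ (by positivity)]
      exact norm_truncField_le hR hc t v
    · simp [hT.le]
  exact hP.exists_eq_forall_mem_Icc_hasDerivWithinAt₀

theorem exists_increment_majorant (hR : 0 < R) (hc : ∀ t p, ‖c t p‖ ≤ 1)
    (hcc : ∀ p, Continuous fun t => c t p) {T : ℝ} {α : ℝ → EllOne}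
    (hα : ∀ t ∈ Set.Icc (-T) T,
      HasDerivWithinAt α (truncField R c t (α t)) (Set.Icc (-T) T) t)
    {p q : ℝ} (hp : -T < p) (hpq : p ≤ q) (hq : q < T) :
    ∃ e : ℤ → ℝ, (∀ a, 0 ≤ e a) ∧ Summable e ∧ ∑' a, e a ≤ 8 * R ^ 3 * (q - p) ∧
      ∀ s ∈ Set.Icc p q, ∀ t ∈ Set.Icc p q, ∀ a, ‖α t a - α s a‖ ≤ e a := by
  have hsub : Set.Icc p q ⊆ Set.Icc (-T) T := Set.Icc_subset_Icc hp.le hq.le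
  have hαc : ContinuousOn α (Set.Icc p q) :=
    (HasDerivWithinAt.continuousOn hα).mono hsub
  have hfc : ContinuousOn (fun t => truncField R c t (α t)) (Set.Icc p q) :=
    (continuous_truncField hR hc hcc).comp_continuousOn
      (f := fun t => (t, α t)) (continuousOn_id.prodMk hαc)
  have hd : ∀ t ∈ Set.Icc p q, HasDerivAt α (truncField R c t (α t)) t := fun t ht =>
    (hα t (hsub ht)).hasDerivAt
      (Icc_mem_nhds (lt_of_lt_of_le hp ht.1) (lt_of_le_of_lt ht.2 hq))
  exact exists_majorant_of_hasDerivAt hpq hfc (fun t _ => norm_truncField_le hR hc t (α t)) hd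

end truncField

/-! ### The truncated Schrödinger–Poisson flow -/

/-- The terms of the full cubic nonlinearity. -/
def cubic (z : ℤ → ℂ) (a : ℤ) (x : ℤ × ℤ) : ℂ :=
  (qk a x.2 : ℂ) * (z x.1 * (starRingEnd ℂ) (z (x.1 + x.2 - a)) * z x.2)

section cubic

variable {z : ℤ → ℂ}

theorem summable_cubic (hz : Summable fun a => ‖z a‖) (a : ℤ) :
    Summable (cubic z a) := by
  have h := (conv_summable_of_weight (ν := fun _ => 1) (f := fun a => ‖z a‖)
    (g := fun a => ‖z a‖) (h := fun a => ‖z a‖) (fun _ => zero_le_one) (fun _ _ _ => by norm_num)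
    (fun _ => norm_nonneg _) (fun _ => norm_nonneg _) (fun _ => norm_nonneg _)
    (by simpa using hz) (by simpa using hz) (by simpa using hz)).1.comp_injective
      (i := fun x : ℤ × ℤ => (a, x)) fun x y hxy => by simpa using hxy
  refine Summable.of_norm_bounded h fun x => ?_
  simp only [cubic, Function.comp, one_mul, norm_mul, RCLike.norm_conj, Complex.norm_real]
  rw [Real.norm_of_nonneg (qk_nonneg _ _)]
  exact mul_le_of_le_one_left (by positivity) (qk_le_one _ _)

theorem vf_eq_tsum_cubic (hz : Summable fun a => ‖z a‖) (a : ℤ) :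
    vf z a = Complex.I * ((a : ℂ) ^ 2 * z a + ∑' x, cubic z a x) := by
  have hs := summable_cubic hz a
  have h1 : ∀ x : ℤ × ℤ, cubic z a x = (if x.1 = a then cubic z a x else 0) +
      (cf a x : ℂ) * (z x.1 * (starRingEnd ℂ) (z (x.1 + x.2 - a)) * z x.2) := fun x => by
    by_cases h : x.1 = a <;> simp [cf, h, cubic]
  have hsd : Summable fun x : ℤ × ℤ => if x.1 = a then cubic z a x else 0 :=
    Summable.of_norm_bounded hs.norm fun x => by split_ifs <;> simp
  have hsn : Summable fun x : ℤ × ℤ =>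
      (cf a x : ℂ) * (z x.1 * (starRingEnd ℂ) (z (x.1 + x.2 - a)) * z x.2) :=
    Summable.of_norm_bounded hs.norm fun x => by
      by_cases h : x.1 = a
      · simp [cf, h]
      · simp [cf, h, cubic]
  have h2 : ∑' x : ℤ × ℤ, (if x.1 = a then cubic z a x else 0) = Om z a * z a := by
    rw [hsd.tsum_prod, tsum_eq_single a]
    · simp only [if_true, cubic]
      rw [Om, Complex.ofReal_tsum, ← tsum_mul_right]
      refine tsum_congr fun e => ?_
      have := Complex.mul_conj (z e)
      rw [Complex.normSq_eq_norm_sq] at this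
      push_cast at this ⊢
      rw [← this, add_sub_cancel_left]
      ring
    · intro b hb; simp [hb]
  rw [tsum_congr h1, hsd.tsum_add hsn, h2, vf, Nn]
  ring

theorem tsum_poisson_eq (hz : Summable fun a => ‖z a‖) (a : ℤ) :
    ∑' k : ℤ, (if k ≠ 0 then
      ((k : ℂ) ^ 2)⁻¹ * (∑' b : ℤ, z b * (starRingEnd ℂ) (z (b - k))) * z (a - k) else 0)
      = ∑' x, cubic z a x := by
  have hs := summable_cubic hz a
  have hs' : Summable fun y : ℤ × ℤ => cubic z a (Equiv.prodComm ℤ ℤ y) :=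
    (Equiv.prodComm ℤ ℤ).summable_iff.2 hs
  rw [← (Equiv.prodComm ℤ ℤ).tsum_eq (cubic z a), hs'.tsum_prod, 
    ← (Equiv.subLeft a).tsum_eq (fun d => ∑' b, cubic z a (Equiv.prodComm ℤ ℤ (d, b)))]
  refine tsum_congr fun k => ?_
  simp only [Equiv.prodComm_apply, Prod.swap, Equiv.subLeft_apply, cubic]
  by_cases hk : k = 0
  · simp [hk, qk_self]
  · rw [if_pos hk, ← tsum_mul_left, ← tsum_mul_right]
    refine tsum_congr fun b => ?_
    rw [show b + (a - k) - a = b - k by ring, qk]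
    push_cast
    rw [show ((a : ℂ) - (a - k)) = k by ring]
    ring

theorem I_mul_vf (hz : Summable fun a => ‖z a‖) (a : ℤ) :
    Complex.I * vf z a = -(a : ℂ) ^ 2 * z a -
    ∑' k : ℤ, (if k ≠ 0 then
      ((k : ℂ) ^ 2)⁻¹ * (∑' b : ℤ, z b * (starRingEnd ℂ) (z (b - k))) * z (a - k) else 0) := by
  rw [tsum_poisson_eq hz, vf_eq_tsum_cubic hz, ← mul_assoc, Complex.I_mul_I]
  ring

end cubic

/-- The factor `e^{i a² t}` of the free flow. -/
def freePhase (a : ℤ) (t : ℝ) : ℂ := Complex.exp (((a : ℝ) ^ 2 * t : ℝ) * Complex.I)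

theorem norm_freePhase (a : ℤ) (t : ℝ) : ‖freePhase a t‖ = 1 := Complex.norm_exp_ofReal_mul_I _

theorem continuous_freePhase (a : ℤ) : Continuous (freePhase a) := by
  unfold freePhase; fun_prop

theorem hasDerivAt_freePhase (a : ℤ) (t : ℝ) :
    HasDerivAt (freePhase a) (Complex.I * (a : ℂ) ^ 2 * freePhase a t) t := by
  have h : HasDerivAt (fun t : ℝ => ((((a : ℝ) ^ 2 * t : ℝ)) : ℂ) * Complex.I)
      (((((a : ℝ) ^ 2 * 1 : ℝ)) : ℂ) * Complex.I) t :=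
    ((hasDerivAt_id t).const_mul ((a : ℝ) ^ 2)).ofReal_comp.mul_const _
  refine h.cexp.congr_deriv ?_
  rw [freePhase]
  push_cast
  ring

theorem wt_pos (σ θ : ℝ) (a : ℤ) : 0 < wt σ θ a := Real.exp_pos _

/-- The change of unknown to weighted profile variables. -/
def profFac (σ θ : ℝ) (a : ℤ) (t : ℝ) : ℂ := ((wt σ θ a)⁻¹ : ℝ) * freePhase a t

/-- The interaction coefficients in weighted profile variables. -/
def profCoef (σ θ : ℝ) (t : ℝ) (p : ℤ × ℤ × ℤ) : ℂ :=
  Complex.I * qk p.1 p.2.2 * ((profFac σ θ p.1 t)⁻¹ * profFac σ θ p.2.1 t *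
    (starRingEnd ℂ) (profFac σ θ (p.2.1 + p.2.2 - p.1) t) * profFac σ θ p.2.2 t)

theorem norm_profFac (σ θ : ℝ) (a : ℤ) (t : ℝ) : ‖profFac σ θ a t‖ = (wt σ θ a)⁻¹ := by
  rw [profFac, norm_mul, norm_freePhase, Complex.norm_real,
    Real.norm_of_nonneg (inv_nonneg.2 (wt_pos _ _ _).le), mul_one]

theorem profFac_ne_zero (σ θ : ℝ) (a : ℤ) (t : ℝ) : profFac σ θ a t ≠ 0 := by
  rw [← norm_pos_iff, norm_profFac]
  exact inv_pos.2 (wt_pos _ _ _)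

theorem continuous_profFac (σ θ : ℝ) (a : ℤ) : Continuous (profFac σ θ a) :=
  continuous_const.mul (continuous_freePhase a)

theorem norm_profCoef_le {σ θ : ℝ} (hσ : 0 < σ) (h0 : 0 < θ) (h1 : θ < 1) (t : ℝ)
    (p : ℤ × ℤ × ℤ) : ‖profCoef σ θ t p‖ ≤ 1 := by
  obtain ⟨a, b, d⟩ := p
  simp only [profCoef, norm_mul, norm_inv, RCLike.norm_conj, norm_profFac, Complex.norm_I,
    Complex.norm_real, inv_inv, one_mul]
  rw [Real.norm_of_nonneg (qk_nonneg _ _)]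
  have hw : ∀ a, 0 ≤ wt σ θ a := fun a => (wt_pos σ θ a).le
  refine mul_le_one₀ (qk_le_one _ _) (mul_nonneg (mul_nonneg (mul_nonneg (hw _)
    (inv_nonneg.2 (hw _))) (inv_nonneg.2 (hw _))) (inv_nonneg.2 (hw _))) ?_
  have h := wt_submul hσ h0 h1 a b d
  have hb := wt_pos σ θ b
  have hc := wt_pos σ θ (b + d - a)
  have hd := wt_pos σ θ d
  calc _ = wt σ θ a / (wt σ θ b * wt σ θ (b + d - a) * wt σ θ d) := by field_simp
    _ ≤ 1 := (div_le_one (by positivity)).2 h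

theorem continuous_profCoef (σ θ : ℝ) (p : ℤ × ℤ × ℤ) :
    Continuous fun t => profCoef σ θ t p := by
  unfold profCoef
  exact continuous_const.mul (((((continuous_profFac σ θ _).inv₀ (profFac_ne_zero σ θ _)).mul
    (continuous_profFac σ θ _)).mul (Complex.continuous_conj.comp (continuous_profFac σ θ _))).mul
    (continuous_profFac σ θ _))

theorem hasDerivAt_profFac_mul {σ θ : ℝ} (hσ : 0 < σ) (h0 : 0 < θ) (h1 : θ < 1)
    {α : ℝ → EllOne} {t : ℝ} (hz : Summable fun a => ‖profFac σ θ a t * α t a‖)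
    (h : HasDerivAt α (tri (profCoef σ θ t) (α t) (α t) (α t)) t) (a : ℤ) :
    HasDerivAt (fun s => profFac σ θ a s * α s a) (vf (fun b => profFac σ θ b t * α t b) a) t := by
  have hE : HasDerivAt (profFac σ θ a)
      (((wt σ θ a)⁻¹ : ℝ) * (Complex.I * (a : ℂ) ^ 2 * freePhase a t)) t :=
    (hasDerivAt_freePhase a t).const_mul _
  have hα := EllOne.hasDerivAt_apply h a
  rw [tri_apply (norm_profCoef_le hσ h0 h1 t)] at hα
  have hm := hE.mul hα
  rw [vf_eq_tsum_cubic hz]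
  refine hm.congr_deriv ?_
  rw [mul_add, ← tsum_mul_left, ← tsum_mul_left]
  congr 1
  · rw [profFac]; ring
  · refine tsum_congr fun x => ?_
    have := profFac_ne_zero σ θ a t
    simp only [profCoef, cubic, map_mul]
    field_simp

theorem wt_mul_norm_profFac_mul (σ θ : ℝ) (a : ℤ) (t : ℝ) (w : ℂ) :
    wt σ θ a * ‖profFac σ θ a t * w‖ = ‖w‖ := by
  rw [norm_mul, norm_profFac, mul_inv_cancel_left₀ (wt_pos _ _ _).ne']

theorem tendsto_gNorm_profFac (σ θ : ℝ) {α : ℝ → EllOne} {S : Set ℝ} {t₀ : ℝ}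
    (hα : ContinuousWithinAt α S t₀) :
    Filter.Tendsto (fun t => gNorm σ θ fun a => profFac σ θ a t * α t a - profFac σ θ a t₀ * α t₀ a)
      (nhdsWithin t₀ S) (nhds 0) := by
  have h1 : Filter.Tendsto (fun t => ‖α t - α t₀‖) (nhdsWithin t₀ S) (nhds 0) :=
    tendsto_iff_norm_sub_tendsto_zero.1 hα
  have h2 : Filter.Tendsto
      (fun t => ∑' a, ‖freePhase a t - freePhase a t₀‖ * ‖α t₀ a‖) (nhdsWithin t₀ S)
      (nhds (∑' _ : ℤ, (0 : ℝ))) := by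
    refine tendsto_tsum_of_dominated_convergence (bound := fun a => 2 * ‖α t₀ a‖)
      ((α t₀).summable_norm.mul_left 2) (fun a => ?_) (Filter.Eventually.of_forall fun t a => ?_)
    · have : Filter.Tendsto (freePhase a) (nhdsWithin t₀ S) (nhds (freePhase a t₀)) :=
        ((continuous_freePhase a).tendsto t₀).mono_left nhdsWithin_le_nhds
      simpa using (tendsto_iff_norm_sub_tendsto_zero.1 this).mul_const ‖α t₀ a‖
    · rw [Real.norm_of_nonneg (by positivity)]
      gcongr
      refine (norm_sub_le _ _).trans ?_
      rw [norm_freePhase, norm_freePhase]; norm_num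
  rw [tsum_zero] at h2
  have h3 := (h1.add h2).const_mul 2
  rw [add_zero, mul_zero] at h3
  have hb : ∀ t a, wt σ θ a * ‖profFac σ θ a t * α t a - profFac σ θ a t₀ * α t₀ a‖
      ≤ ‖(α t - α t₀) a‖ + ‖freePhase a t - freePhase a t₀‖ * ‖α t₀ a‖ := fun t a => by
    have e : profFac σ θ a t * α t a - profFac σ θ a t₀ * α t₀ a
        = profFac σ θ a t * (α t - α t₀) a
          + ((wt σ θ a)⁻¹ : ℝ) * ((freePhase a t - freePhase a t₀) * α t₀ a) := by
      rw [lp.coeFn_sub, Pi.sub_apply, profFac, profFac]; ring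
    have hw := wt_pos σ θ a
    rw [e]
    refine (mul_le_mul_of_nonneg_left (norm_add_le _ _) hw.le).trans ?_
    rw [mul_add, wt_mul_norm_profFac_mul, norm_mul _ (_ * _), Complex.norm_real,
      Real.norm_of_nonneg (inv_pos.2 hw).le, mul_inv_cancel_left₀ hw.ne', norm_mul]
  have hs : ∀ t, Summable fun a => ‖freePhase a t - freePhase a t₀‖ * ‖α t₀ a‖ := fun t => by
    refine Summable.of_nonneg_of_le (fun a => by positivity) (fun a => ?_)
      ((α t₀).summable_norm.mul_left 2)
    gcongr
    refine (norm_sub_le _ _).trans ?_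
    rw [norm_freePhase, norm_freePhase]; norm_num
  have hs' : ∀ t, Summable fun a =>
      ‖(α t - α t₀) a‖ + ‖freePhase a t - freePhase a t₀‖ * ‖α t₀ a‖ := fun t =>
    (EllOne.summable_norm _).add (hs t)
  refine squeeze_zero (fun t => ?_) (fun t => ?_) h3
  · exact mul_nonneg zero_le_two (tsum_nonneg fun a =>
      mul_nonneg (wt_pos _ _ _).le (norm_nonneg _))
  · unfold gNorm
    rw [EllOne.norm_eq, ← (EllOne.summable_norm _).tsum_add (hs t)]
    refine mul_le_mul_of_nonneg_left ?_ zero_le_two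
    exact Summable.tsum_le_tsum (hb t) (Summable.of_nonneg_of_le
      (fun a => mul_nonneg (wt_pos _ _ _).le (norm_nonneg _)) (hb t) (hs' t)) (hs' t)

theorem exists_truncated_flow {σ θ R T : ℝ} (hσ : 0 < σ) (h0 : 0 < θ) (h1 : θ < 1) (hR : 0 < R)
    (hT : 0 < T) {z0 : ℤ → ℂ} (hz0 : inG σ θ z0) :
    ∃ z : ℝ → ℤ → ℂ, z 0 = z0 ∧ (∀ t, inG σ θ (z t)) ∧
      (∀ t₀ ∈ Set.Icc (-T) T, Filter.Tendsto (fun t => gNorm σ θ fun a => z t a - z t₀ a)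
        (nhdsWithin t₀ (Set.Icc (-T) T)) (nhds 0)) ∧
      (∀ t ∈ Set.Ioo (-T) T, ∑' a, wt σ θ a * ‖z t a‖ ≤ R →
        ∀ a, HasDerivAt (fun s => z s a) (vf (z t) a) t) ∧
      ∀ p q, -T < p → p ≤ q → q < T → ∃ e : ℤ → ℝ, (∀ a, 0 ≤ e a) ∧
        (Summable fun a => wt σ θ a * e a) ∧ ∑' a, wt σ θ a * e a ≤ 8 * R ^ 3 * (q - p) ∧
        ∀ s ∈ Set.Icc p q, ∀ t ∈ Set.Icc p q, ∀ a, |‖z t a‖ - ‖z s a‖| ≤ e a := by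
  have hc := norm_profCoef_le hσ h0 h1
  have hcc := continuous_profCoef σ θ
  have hmem : Memℓp (fun a => (profFac σ θ a 0)⁻¹ * z0 a) 1 := by
    refine memℓp_gen ?_
    simpa [norm_profFac, inG] using hz0
  obtain ⟨α, hα0, hα⟩ := exists_truncField_flow hR hc hcc hT (⟨_, hmem⟩ : EllOne)
  have hnorm : ∀ t a, wt σ θ a * ‖profFac σ θ a t * α t a‖ = ‖α t a‖ := fun t a =>
    wt_mul_norm_profFac_mul σ θ a t _
  refine ⟨fun t a => profFac σ θ a t * α t a, ?_, fun t => ?_, fun t₀ ht₀ => ?_,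
    fun t ht hle => ?_, fun p q hp hpq hq => ?_⟩
  · funext a
    have h : α 0 a = (profFac σ θ a 0)⁻¹ * z0 a := by rw [hα0]
    simp only [h]
    exact mul_inv_cancel_left₀ (profFac_ne_zero σ θ a 0) _
  · simpa only [inG, hnorm] using (α t).summable_norm
  · exact tendsto_gNorm_profFac σ θ (hα t₀ ht₀).continuousWithinAt
  · simp only [hnorm] at hle
    have hd := (hα t ⟨ht.1.le, ht.2.le⟩).hasDerivAt (Icc_mem_nhds ht.1 ht.2)
    have he : truncField R (profCoef σ θ) t (α t)
        = tri (profCoef σ θ t) (α t) (α t) (α t) := by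
      rw [truncField, cutoff_eq_one hR (by rwa [EllOne.norm_eq]), Complex.ofReal_one, one_smul]
    rw [he] at hd
    refine hasDerivAt_profFac_mul hσ h0 h1 (Summable.of_nonneg_of_le (fun _ => norm_nonneg _)
      (fun a => ?_) (α t).summable_norm) hd
    rw [← hnorm t a]
    exact le_mul_of_one_le_left (norm_nonneg _) (one_le_wt hσ a)
  · obtain ⟨e, he0, hes, hele, hed⟩ := exists_increment_majorant hR hc hcc hα hp hpq hq
    have hw : ∀ a, wt σ θ a * ((wt σ θ a)⁻¹ * e a) = e a := fun a =>
      mul_inv_cancel_left₀ (wt_pos σ θ a).ne' _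
    refine ⟨fun a => (wt σ θ a)⁻¹ * e a,
      fun a => mul_nonneg (inv_pos.2 (wt_pos σ θ a)).le (he0 a), ?_, ?_, fun s hs t ht a => ?_⟩
    · simpa only [hw] using hes
    · simpa only [hw] using hele
    · have hi := (inv_pos.2 (wt_pos σ θ a)).le
      rw [norm_mul, norm_mul, norm_profFac, norm_profFac, ← mul_sub, abs_mul, abs_of_nonneg hi]
      exact mul_le_mul_of_nonneg_left ((abs_norm_sub_norm_le _ _).trans (hed s hs t ht a)) hi

/-! ### The bootstrap argument -/

/-- The actions of `z` vary by at most `ρ^{3/2}` (in the weighted sense) on `[-τ, τ]`. -/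
def ActionsStable (σ θ ρ τ : ℝ) (z : ℝ → ℤ → ℂ) : Prop :=
  ∃ d : ℤ → ℝ, (∀ a, 0 ≤ d a) ∧ (Summable fun a => wt σ θ a * d a) ∧
    ∑' a, wt σ θ a * d a ≤ ρ ^ ((3 : ℝ) / 2) ∧
    ∀ t ∈ Set.Icc (-τ) τ, ∀ a, |‖z t a‖ ^ 2 - ‖z 0 a‖ ^ 2| ≤ d a ^ 2

theorem le_add_of_abs_sq_sub_le {x y d : ℝ} (hy : 0 ≤ y) (hd : 0 ≤ d)
    (h : |x ^ 2 - y ^ 2| ≤ d ^ 2) : x ≤ y + d := by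
  have := (abs_le.1 h).2
  nlinarith [mul_nonneg hy hd]

theorem summable_sq_of_nonneg {f : ℤ → ℝ} (h0 : ∀ a, 0 ≤ f a) (hf : Summable f) :
    Summable fun a => f a ^ 2 := by
  refine Summable.of_nonneg_of_le (fun a => sq_nonneg _) (fun a => ?_) (hf.mul_left (∑' a, f a))
  rw [sq]
  exact mul_le_mul_of_nonneg_right (hf.le_tsum a fun b _ => h0 b) (h0 a)

theorem one_le_wt_mul_exp {σ θ N L : ℝ} (hσ : 0 < σ) (h0 : 0 < θ) (hN : 0 ≤ N) (hNL : N ≤ L)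
    {a : ℤ} (ha : ¬ |(a : ℝ)| ≤ L) : 1 ≤ wt σ θ a * Real.exp (-(σ * N ^ θ)) := by
  rw [wt, ← Real.exp_add]
  refine Real.one_le_exp ?_
  have : N ^ θ ≤ |(a : ℝ)| ^ θ := Real.rpow_le_rpow hN (hNL.trans (not_le.1 ha).le) h0.le
  nlinarith

set_option maxHeartbeats 1000000 in
theorem ActionsStable.step {σ θ N L T s A ρ τ : ℝ} {M : ℕ} {z : ℝ → ℤ → ℂ}
    (hσ : 0 < σ) (h0 : 0 < θ) (h1 : θ < 1) (hN : 1 ≤ N) (hs : 0 < s) (hs1 : s ≤ 1 / 16)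
    (hA : 128 * ((M : ℝ) + 1) ^ 2 ≤ A) (hAs : 2 * A * s ≤ 1) (hM : 2 ≤ M)
    (hTM : T * (2 * A * s) ^ M ≤ 1) (hρ : 0 < ρ) (hρs : ρ ≤ s ^ 8)
    (hTl : T ≤ Real.exp (σ * (1 - θ) * N ^ θ)) (hNs : Real.exp (-(σ * N ^ θ)) ≤ s ^ 5)
    (hL : 2 * M * N ^ 2 ≤ L) (hV : inV (10 * s ^ 20) (2 * M) L (PiM L (z 0)))
    (hz0 : inG σ θ (z 0)) (hz0ρ : gNorm σ θ (z 0) = ρ)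
    (hode : ∀ t ∈ Set.Ioo (-(T + 1)) (T + 1), ∑' a, wt σ θ a * ‖z t a‖ ≤ ρ →
      ∀ a, HasDerivAt (fun s => z s a) (vf (z t) a) t)
    (hinc : ∀ p q, -(T + 1) < p → p ≤ q → q < T + 1 → ∃ e : ℤ → ℝ, (∀ a, 0 ≤ e a) ∧
      (Summable fun a => wt σ θ a * e a) ∧ ∑' a, wt σ θ a * e a ≤ 8 * ρ ^ 3 * (q - p) ∧
      ∀ s ∈ Set.Icc p q, ∀ t ∈ Set.Icc p q, ∀ a, |‖z t a‖ - ‖z s a‖| ≤ e a)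
    (hτ : 0 ≤ τ) (hτT : τ + 1 / 64 ≤ T) (h : ActionsStable σ θ ρ τ z) :
    ActionsStable σ θ ρ (τ + 1 / 128) z := by
  obtain ⟨d, hd0, hds, hdρ, hd⟩ := h
  obtain ⟨e₁, he₁0, he₁s, he₁ρ, he₁⟩ := hinc τ (τ + 1 / 64) (by linarith) (by linarith)
    (by linarith)
  obtain ⟨e₂, he₂0, he₂s, he₂ρ, he₂⟩ := hinc (-(τ + 1 / 64)) (-τ) (by linarith) (by linarith)
    (by linarith)
  have hw : ∀ a, 1 ≤ wt σ θ a := one_le_wt hσ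
  have hw0 : ∀ a, 0 ≤ wt σ θ a := fun a => zero_le_one.trans (hw a)
  have hρ1 : ρ ≤ 1 / 16 := hρs.trans (by
    calc s ^ 8 ≤ (1 / 16) ^ 8 := by gcongr
      _ ≤ 1 / 16 := by norm_num)
  obtain ⟨e, he⟩ : ∃ e : ℤ → ℝ, e = fun a => e₁ a + e₂ a := ⟨_, rfl⟩
  have he0 : ∀ a, 0 ≤ e a := fun a => by rw [he]; exact add_nonneg (he₁0 a) (he₂0 a)
  have hewt : (fun a => wt σ θ a * e a) = fun a => wt σ θ a * e₁ a + wt σ θ a * e₂ a := by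
    funext a; rw [he]; ring
  have hes : Summable fun a => wt σ θ a * e a := by rw [hewt]; exact he₁s.add he₂s
  have heρ : ∑' a, wt σ θ a * e a ≤ ρ ^ 3 / 4 := by
    rw [hewt, he₁s.tsum_add he₂s]
    linarith
  obtain ⟨y, hy⟩ : ∃ y : ℤ → ℝ, y = fun a => ‖z 0 a‖ + d a + e a := ⟨_, rfl⟩
  have hywt : (fun a => wt σ θ a * y a) =
      fun a => wt σ θ a * ‖z 0 a‖ + wt σ θ a * d a + wt σ θ a * e a := by
    funext a; rw [hy]; ring
  have hz0' : Summable fun a => wt σ θ a * ‖z 0 a‖ := hz0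
  have hzρ : ∑' a, wt σ θ a * ‖z 0 a‖ = ρ / 2 := by rw [← hz0ρ, gNorm]; ring
  have hys : Summable fun a => wt σ θ a * y a := by rw [hywt]; exact (hz0'.add hds).add hes
  have hq0 : 0 ≤ ρ ^ ((3 : ℝ) / 2) := Real.rpow_nonneg hρ.le _
  have hq2 : (ρ ^ ((3 : ℝ) / 2)) ^ 2 = ρ ^ 3 := by
    rw [← Real.rpow_natCast, ← Real.rpow_mul hρ.le, ← Real.rpow_natCast]; norm_num
  have hqρ : ρ ^ ((3 : ℝ) / 2) ≤ ρ / 4 := by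
    refine le_of_sq_le_sq ?_ (by linarith)
    rw [hq2]
    nlinarith [sq_nonneg ρ]
  have hyρ : ∑' a, wt σ θ a * y a ≤ ρ := by
    rw [hywt, (hz0'.add hds).tsum_add hes, hz0'.tsum_add hds]
    have : ρ ^ 3 ≤ ρ := by nlinarith [mul_nonneg hρ.le hρ.le]
    linarith
  have hy0 : ∀ a, 0 ≤ y a := fun a => by
    rw [hy]; exact add_nonneg (add_nonneg (norm_nonneg _) (hd0 a)) (he0 a)
  have hin : ∀ t ∈ Set.Icc (-τ) τ, ∀ a, ‖z t a‖ ≤ ‖z 0 a‖ + d a := fun t ht a =>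
    le_add_of_abs_sq_sub_le (norm_nonneg _) (hd0 a) (hd t ht a)
  have hclose : ∀ t ∈ Set.Ioo (-(τ + 1 / 64)) (τ + 1 / 64), ∃ t' ∈ Set.Icc (-τ) τ,
      ∀ a, |‖z t a‖ - ‖z t' a‖| ≤ e a := fun t ht => by
    rcases le_total τ t with h | h
    · refine ⟨τ, ⟨by linarith, le_rfl⟩, fun a => ?_⟩
      rw [he]
      linarith [he₁ τ ⟨le_rfl, by linarith⟩ t ⟨h, ht.2.le⟩ a, he₂0 a]
    rcases le_total t (-τ) with h' | h'
    · refine ⟨-τ, ⟨le_rfl, by linarith⟩, fun a => ?_⟩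
      rw [he]
      linarith [he₂ (-τ) ⟨by linarith, le_rfl⟩ t ⟨ht.1.le, h'⟩ a, he₁0 a]
    · refine ⟨t, ⟨h', h⟩, fun a => ?_⟩
      rw [sub_self, abs_zero]; exact he0 a
  have hbd : ∀ t ∈ Set.Ioo (-(τ + 1 / 64)) (τ + 1 / 64), ∀ a, ‖z t a‖ ≤ y a := fun t ht a => by
    obtain ⟨t', ht', H⟩ := hclose t ht
    have := (abs_le.1 (H a)).2
    rw [hy]
    linarith [hin t' ht' a]
  obtain ⟨g, hg⟩ : ∃ g : ℤ → ℝ, g = fun a => ρ ^ ((3 : ℝ) / 2) * (wt σ θ a * d a)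
    + 2 * ρ * (wt σ θ a * e a) + s ^ 5 * ρ * (wt σ θ a * ‖z 0 a‖) := ⟨_, rfl⟩
  have hgs : Summable g := by
    rw [hg]; exact ((hds.mul_left _).add (hes.mul_left _)).add (hz0'.mul_left _)
  have hgρ : ∑' a, g a ≤ 2 * s ^ 24 + s ^ 21 := by
    rw [hg, ((hds.mul_left _).add (hes.mul_left _)).tsum_add (hz0'.mul_left _),
      (hds.mul_left _).tsum_add (hes.mul_left _), tsum_mul_left, tsum_mul_left, tsum_mul_left, hzρ]
    have a1 : ρ ^ ((3 : ℝ) / 2) * ∑' a, wt σ θ a * d a ≤ ρ ^ 3 := by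
      rw [← hq2, sq]; gcongr
    have a2 : 2 * ρ * ∑' a, wt σ θ a * e a ≤ ρ ^ 3 := by
      calc _ ≤ 2 * ρ * (ρ ^ 3 / 4) := by gcongr
        _ ≤ ρ ^ 3 := by nlinarith [pow_pos hρ 3]
    have a3 : ρ ^ 3 ≤ s ^ 24 := by
      calc ρ ^ 3 ≤ (s ^ 8) ^ 3 := by gcongr
        _ = s ^ 24 := by ring
    have a4 : s ^ 5 * ρ * (ρ / 2) ≤ s ^ 21 := by
      calc s ^ 5 * ρ * (ρ / 2) ≤ s ^ 5 * s ^ 8 * (s ^ 8 / 2) := by gcongr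
        _ ≤ s ^ 21 := by nlinarith [pow_pos hs 21]
    linarith
  have hM2 : (2 : ℝ) ≤ M := by exact_mod_cast hM
  have hMs : M * s ≤ 1 / 256 := by nlinarith
  have hgδ : 2 * M * ∑' a, g a ≤ 9 * s ^ 20 := by
    have h20 := pow_pos hs 20
    calc 2 * M * ∑' a, g a ≤ 2 * M * (2 * s ^ 24 + s ^ 21) := by gcongr
      _ = (M * s) * (4 * s ^ 3 + 2) * s ^ 20 := by ring
      _ ≤ 1 / 256 * (4 * (1 / 16) ^ 3 + 2) * s ^ 20 := by gcongr
      _ ≤ 9 * s ^ 20 := by nlinarith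
  have hNL : N ≤ L := by nlinarith
  have hgw : ∀ t ∈ Set.Ioo (-(τ + 1 / 64)) (τ + 1 / 64), ∀ a,
      |‖z t a‖ ^ 2 - ‖PiM L (z 0) a‖ ^ 2| ≤ g a := fun t ht a => by
    obtain ⟨t', ht', H⟩ := hclose t ht
    have b1 : |‖z t' a‖ ^ 2 - ‖z 0 a‖ ^ 2| ≤ ρ ^ ((3 : ℝ) / 2) * (wt σ θ a * d a) := by
      refine (hd t' ht' a).trans ?_
      have c1 : d a ≤ wt σ θ a * d a := le_mul_of_one_le_left (hd0 a) (hw a)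
      have c2 : wt σ θ a * d a ≤ ρ ^ ((3 : ℝ) / 2) :=
        (hds.le_tsum a fun b _ => mul_nonneg (hw0 b) (hd0 b)).trans hdρ
      rw [sq]
      exact mul_le_mul (c1.trans c2) c1 (hd0 a) hq0
    have b2 : |‖z t a‖ ^ 2 - ‖z t' a‖ ^ 2| ≤ 2 * ρ * (wt σ θ a * e a) := by
      have c1 : y a ≤ ρ := (le_mul_of_one_le_left (hy0 a) (hw a)).trans
        ((hys.le_tsum a fun b _ => mul_nonneg (hw0 b) (hy0 b)).trans hyρ)
      have c2 := hbd t ht a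
      have c3 : ‖z t' a‖ ≤ y a := by rw [hy]; linarith [hin t' ht' a, he0 a]
      have c4 : e a ≤ wt σ θ a * e a := le_mul_of_one_le_left (he0 a) (hw a)
      rw [sq_sub_sq, abs_mul, abs_of_nonneg (by positivity)]
      exact mul_le_mul (by linarith) ((H a).trans c4) (abs_nonneg _) (by linarith)
    have b3 : |‖z 0 a‖ ^ 2 - ‖PiM L (z 0) a‖ ^ 2| ≤ s ^ 5 * ρ * (wt σ θ a * ‖z 0 a‖) := by
      have hx0 := mul_nonneg (hw0 a) (norm_nonneg (z 0 a))
      by_cases hL' : |(a : ℝ)| ≤ L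
      · rw [PiM, if_pos hL', sub_self, abs_zero]; positivity
      · rw [PiM, if_neg hL', norm_zero, zero_pow two_ne_zero, sub_zero, abs_of_nonneg (sq_nonneg _)]
        have c1 := one_le_wt_mul_exp hσ h0 (zero_le_one.trans hN) hNL hL'
        have c2 : ‖z 0 a‖ ≤ s ^ 5 * (wt σ θ a * ‖z 0 a‖) := by
          calc ‖z 0 a‖ ≤ (wt σ θ a * Real.exp (-(σ * N ^ θ))) * ‖z 0 a‖ :=
                le_mul_of_one_le_left (norm_nonneg _) c1
            _ ≤ (wt σ θ a * s ^ 5) * ‖z 0 a‖ := by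
                have := hw0 a
                gcongr
            _ = _ := by ring
        have c3 : ‖z 0 a‖ ≤ ρ := by
          have c4 := hz0'.le_tsum a fun b _ => mul_nonneg (hw0 b) (norm_nonneg _)
          have c5 := le_mul_of_one_le_left (norm_nonneg (z 0 a)) (hw a)
          linarith
        calc ‖z 0 a‖ ^ 2 = ‖z 0 a‖ * ‖z 0 a‖ := sq _
          _ ≤ (s ^ 5 * (wt σ θ a * ‖z 0 a‖)) * ρ := by gcongr
          _ = _ := by ring
    have e1 : ‖z t a‖ ^ 2 - ‖PiM L (z 0) a‖ ^ 2 = (‖z t' a‖ ^ 2 - ‖z 0 a‖ ^ 2)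
      + (‖z t a‖ ^ 2 - ‖z t' a‖ ^ 2) + (‖z 0 a‖ ^ 2 - ‖PiM L (z 0) a‖ ^ 2) := by ring
    rw [e1, hg]
    exact (abs_add_three _ _ _).trans (add_le_add (add_le_add b1 b2) b3)
  have hPz : Summable fun a => ‖PiM L (z 0) a‖ ^ 2 := by
    refine Summable.of_nonneg_of_le (fun a => sq_nonneg _) (fun a => ?_)
      (summable_sq_of_nonneg (fun a => mul_nonneg (hw0 a) (norm_nonneg _)) hz0')
    have : ‖PiM L (z 0) a‖ ≤ ‖z 0 a‖ := by unfold PiM; split_ifs <;> simp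
    have := this.trans (le_mul_of_one_le_left (norm_nonneg (z 0 a)) (hw a))
    gcongr
  have hsub : ∀ t ∈ Set.Ioo (-(τ + 1 / 64)) (τ + 1 / 64), t ∈ Set.Ioo (-(T + 1)) (T + 1) :=
    fun t ht => ⟨by linarith [ht.1], by linarith [ht.2]⟩
  have hsum : ∀ t ∈ Set.Ioo (-(τ + 1 / 64)) (τ + 1 / 64), ∑' a, wt σ θ a * ‖z t a‖ ≤ ρ :=
    fun t ht => by
      have hle : ∀ a, wt σ θ a * ‖z t a‖ ≤ wt σ θ a * y a := fun a =>
        mul_le_mul_of_nonneg_left (hbd t ht a) (hw0 a)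
      exact (Summable.tsum_le_tsum hle (Summable.of_nonneg_of_le
        (fun a => mul_nonneg (hw0 a) (norm_nonneg _)) hle hys) hys).trans hyρ
  obtain ⟨d', hd'0, hd's, hd'ρ, hd'⟩ := exists_action_variation_bound (z := z) (y := y)
    (τ := τ + 1 / 64) hσ h0 h1 (zero_lt_one.trans_le hN) hs hs1 hA hAs hM hTM hρ hρs hTl
    (by linarith) hτT hys hyρ (fun t ht => hode t (hsub t ht) (hsum t ht)) hbd
    fun S hc hm hdl hcard hne hhigh t ht => le_abs_fr hN (one_le_two.trans hM) hL hV hPz hgs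
      (hgw t ht) hgδ hc hm hdl hcard hne hhigh
  exact ⟨d', hd'0, hd's, hd'ρ, fun t ht => hd' t ⟨by linarith [ht.1], by linarith [ht.2]⟩⟩

theorem ActionsStable.zero {σ θ ρ : ℝ} (hρ : 0 ≤ ρ) (z : ℝ → ℤ → ℂ) :
    ActionsStable σ θ ρ 0 z := by
  refine ⟨fun _ => 0, fun _ => le_rfl, by simp,
    by simpa using Real.rpow_nonneg hρ _, fun t ht a => ?_⟩
  obtain rfl : t = 0 := le_antisymm ht.2 (by simpa using ht.1)
  simp

theorem ActionsStable.mono {σ θ ρ τ τ' : ℝ} {z : ℝ → ℤ → ℂ} (h : ActionsStable σ θ ρ τ z)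
    (hτ : τ' ≤ τ) : ActionsStable σ θ ρ τ' z := by
  obtain ⟨d, hd0, hds, hdρ, hd⟩ := h
  exact ⟨d, hd0, hds, hdρ, fun t ht => hd t ⟨by linarith [ht.1], by linarith [ht.2]⟩⟩

theorem ActionsStable.estimates {σ θ ρ τ : ℝ} {z : ℝ → ℤ → ℂ} (h : ActionsStable σ θ ρ τ z)
    (hρ : 0 ≤ ρ) (hρ1 : ρ ≤ 1 / 16) (hz : ∀ t, inG σ θ (z t)) (hz0 : gNorm σ θ (z 0) = ρ) {t : ℝ}
    (ht : t ∈ Set.Icc (-τ) τ) :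
    ∑' a, wt σ θ a * ‖z t a‖ ≤ ρ ∧
      Summable (fun a : ℤ => wt σ θ a * Real.sqrt |‖z t a‖ ^ 2 - ‖z 0 a‖ ^ 2|) ∧
      ∑' a : ℤ, wt σ θ a * Real.sqrt |‖z t a‖ ^ 2 - ‖z 0 a‖ ^ 2| ≤ ρ ^ ((3 : ℝ) / 2) := by
  obtain ⟨d, hd0, hds, hdρ, hd⟩ := h
  have hw0 : ∀ a, 0 ≤ wt σ θ a := fun a => (wt_pos σ θ a).le
  have h1 : ∀ a, wt σ θ a * ‖z t a‖ ≤ wt σ θ a * ‖z 0 a‖ + wt σ θ a * d a := fun a => by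
    rw [← mul_add]
    exact mul_le_mul_of_nonneg_left
      (le_add_of_abs_sq_sub_le (norm_nonneg _) (hd0 a) (hd t ht a)) (hw0 a)
  have h2 : ∀ a, wt σ θ a * Real.sqrt |‖z t a‖ ^ 2 - ‖z 0 a‖ ^ 2| ≤ wt σ θ a * d a := fun a =>
    mul_le_mul_of_nonneg_left (Real.sqrt_le_iff.2 ⟨hd0 a, hd t ht a⟩) (hw0 a)
  have h3 : Summable fun a : ℤ => wt σ θ a * Real.sqrt |‖z t a‖ ^ 2 - ‖z 0 a‖ ^ 2| :=
    Summable.of_nonneg_of_le (fun a => mul_nonneg (hw0 a) (Real.sqrt_nonneg _)) h2 hds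
  refine ⟨?_, h3, (Summable.tsum_le_tsum h2 h3 hds).trans hdρ⟩
  have hz0' : Summable fun a => wt σ θ a * ‖z 0 a‖ := hz 0
  refine (Summable.tsum_le_tsum h1 (hz t) (hz0'.add hds)).trans ?_
  rw [hz0'.tsum_add hds]
  have e0 : ∑' a, wt σ θ a * ‖z 0 a‖ = ρ / 2 := by rw [← hz0, gNorm]; ring
  have e1 : ρ ^ ((3 : ℝ) / 2) ≤ ρ / 4 := by
    refine le_of_sq_le_sq ?_ (by linarith)
    rw [← Real.rpow_natCast, ← Real.rpow_mul hρ]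
    norm_num
    have h3 : ρ ^ (3 : ℝ) = ρ ^ 3 := by rw [← Real.rpow_natCast]; norm_num
    nlinarith [sq_nonneg ρ]
  linarith

theorem exists_stable_solution {σ θ N L T s A ρ : ℝ} {M : ℕ} {z0 : ℤ → ℂ}
    (hσ : 0 < σ) (h0 : 0 < θ) (h1 : θ < 1) (hN : 1 ≤ N) (hs : 0 < s) (hs1 : s ≤ 1 / 16)
    (hA : 128 * ((M : ℝ) + 1) ^ 2 ≤ A) (hAs : 2 * A * s ≤ 1) (hM : 2 ≤ M) (hT : 0 < T)
    (hTM : (T + 1) * (2 * A * s) ^ M ≤ 1) (hρ : 0 < ρ) (hρs : ρ ≤ s ^ 8)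
    (hTl : T + 1 ≤ Real.exp (σ * (1 - θ) * N ^ θ)) (hNs : Real.exp (-(σ * N ^ θ)) ≤ s ^ 5)
    (hL : 2 * M * N ^ 2 ≤ L) (hV : inV (10 * s ^ 20) (2 * M) L (PiM L z0))
    (hz0 : inG σ θ z0) (hz0ρ : gNorm σ θ z0 = ρ) :
    ∃ z : ℝ → ℤ → ℂ, z 0 = z0 ∧ (∀ t, inG σ θ (z t)) ∧
      (∀ t₀ ∈ Set.Icc (-T) T, Filter.Tendsto (fun t => gNorm σ θ fun a => z t a - z t₀ a)
        (nhdsWithin t₀ (Set.Icc (-T) T)) (nhds 0)) ∧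
      (∀ a, ∀ t ∈ Set.Icc (-T) T, HasDerivAt (fun s => z s a) (vf (z t) a) t) ∧
      ∀ t ∈ Set.Icc (-T) T, gNorm σ θ (z t) ≤ 2 * gNorm σ θ z0 ∧
        Summable (fun a : ℤ => wt σ θ a * Real.sqrt |‖z t a‖ ^ 2 - ‖z0 a‖ ^ 2|) ∧
        (∑' a : ℤ, wt σ θ a * Real.sqrt |‖z t a‖ ^ 2 - ‖z0 a‖ ^ 2|) ≤
          gNorm σ θ z0 ^ ((3 : ℝ) / 2) := by
  obtain ⟨z, rfl, hzG, hzc, hode, hinc⟩ :=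
    exists_truncated_flow hσ h0 h1 hρ (T := T + 1 + 1) (by linarith) hz0
  have hstep : ∀ n : ℕ, (n : ℝ) / 128 ≤ T + 1 / 64 → ActionsStable σ θ ρ (n / 128) z := by
    intro n
    induction n with
    | zero => intro _; simpa using ActionsStable.zero hρ.le z
    | succ n ih =>
      intro hn
      push_cast at hn ⊢
      have := ActionsStable.step hσ h0 h1 hN hs hs1 hA hAs hM hTM hρ hρs hTl hNs hL hV hz0 hz0ρ
        hode hinc (τ := n / 128) (by positivity) (by linarith) (ih (by linarith))
      convert this using 1
      ring
  have hst : ActionsStable σ θ ρ T z := by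
    have hlt := Nat.ceil_lt_add_one (a := 128 * T) (by positivity)
    have hle := Nat.le_ceil (128 * T)
    exact (hstep ⌈128 * T⌉₊ (by linarith)).mono (by linarith)
  have hρ1 : ρ ≤ 1 / 16 := hρs.trans (by
    calc s ^ 8 ≤ (1 / 16) ^ 8 := by gcongr
      _ ≤ 1 / 16 := by norm_num)
  have hest := fun t (ht : t ∈ Set.Icc (-T) T) => hst.estimates hρ.le hρ1 hzG hz0ρ ht
  have hsub : Set.Icc (-T) T ⊆ Set.Icc (-(T + 1 + 1)) (T + 1 + 1) :=
    Set.Icc_subset_Icc (by linarith) (by linarith)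
  refine ⟨z, rfl, hzG, fun t₀ ht₀ => (hzc t₀ (hsub ht₀)).mono_left (nhdsWithin_mono _ hsub),
    fun a t ht => hode t ⟨by linarith [ht.1], by linarith [ht.2]⟩ (hest t ht).1 a,
    fun t ht => ?_⟩
  obtain ⟨e1, e2, e3⟩ := hest t ht
  rw [hz0ρ]
  refine ⟨?_, e2, e3⟩
  rw [gNorm]
  linarith

/-! ### Choice of the parameters -/

theorem exists_parameter_threshold {σ c : ℝ} (hσ : 0 < σ) (hc : 0 < c) :
    ∃ X₀ : ℝ, ∀ X, X₀ ≤ X → 24 ≤ X ∧ 1 ≤ Real.log X ∧ Real.log X ≤ c * X ∧ 1 ≤ σ * X ∧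
      2 * (256 * (3 * X + 1) ^ 2) ^ 3 ≤ Real.exp (X / 24) := by
  have hlog : ∀ᶠ X in Filter.atTop, Real.log X ≤ c * X := by
    filter_upwards [Real.isLittleO_log_id_atTop.bound hc, Filter.eventually_ge_atTop 0]
      with X hX hX0
    have := (le_abs_self _).trans hX
    rwa [id, Real.norm_of_nonneg hX0] at this
  have h1 : ∀ᶠ X in Filter.atTop, 1 ≤ Real.log X :=
    Real.tendsto_log_atTop.eventually_ge_atTop 1
  have h2 : ∀ᶠ X in Filter.atTop, 1 ≤ σ * X :=
    (Filter.tendsto_id.const_mul_atTop hσ).eventually_ge_atTop 1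
  obtain ⟨X₀, hX₀⟩ := Filter.eventually_atTop.1 (((hlog.and h1).and h2).and
    (Filter.eventually_ge_atTop ((2 * 4096 ^ 3) * (24 ^ 7 * 5040))))
  refine ⟨X₀, fun X hX => ?_⟩
  obtain ⟨⟨⟨a1, a2⟩, a3⟩, a4⟩ := hX₀ X hX
  have hX1 : 24 ≤ X := le_trans (by norm_num) a4
  refine ⟨hX1, a2, a1, a3, ?_⟩
  calc 2 * (256 * (3 * X + 1) ^ 2) ^ 3 ≤ 2 * (256 * (4 * X) ^ 2) ^ 3 := by gcongr; linarith
    _ = (2 * 4096 ^ 3) * (24 ^ 7 * 5040) * X ^ 6 / (24 ^ 7 * 5040) := by ring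
    _ ≤ X * X ^ 6 / (24 ^ 7 * 5040) := by gcongr
    _ = (X / 24) ^ 7 / (Nat.factorial 7 : ℕ) := by simp [Nat.factorial]; ring
    _ ≤ Real.exp (X / 24) := Real.pow_div_factorial_le_exp _ (by linarith) 7

theorem two_mul_exp_mul_pow_le_one {X : ℝ} {r : ℕ} (hX : 0 ≤ X) (hr : 1 ≤ r) (hrX : (r : ℝ) ≤ X)
    (hexp : 2 * (256 * (3 * X + 1) ^ 2) ^ 3 ≤ Real.exp (X / 24)) :
    2 * Real.exp (X * r / 3) *
      (2 * (128 * (((3 * r : ℕ) : ℝ) + 1) ^ 2) * Real.exp (-(X / 8))) ^ (3 * r) ≤ 1 := by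
  have h2 : (2 : ℝ) ≤ 2 ^ r := by
    calc (2 : ℝ) = 2 ^ 1 := by norm_num
      _ ≤ 2 ^ r := pow_le_pow_right₀ one_le_two hr
  have hB : 2 * (128 * (((3 * r : ℕ) : ℝ) + 1) ^ 2) ≤ 256 * (3 * X + 1) ^ 2 := by
    push_cast
    calc 2 * (128 * (3 * (r : ℝ) + 1) ^ 2) = 256 * (3 * (r : ℝ) + 1) ^ 2 := by ring
      _ ≤ _ := by gcongr
  calc _ ≤ 2 ^ r * Real.exp (X * r / 3) *
        ((256 * (3 * X + 1) ^ 2) * Real.exp (-(X / 8))) ^ (3 * r) := by gcongr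
    _ = (2 * (256 * (3 * X + 1) ^ 2) ^ 3 * (Real.exp (X / 3) * Real.exp (-(X / 8)) ^ 3)) ^ r := by
        rw [show X * r / 3 = r * (X / 3) by ring, Real.exp_nat_mul, pow_mul, ← mul_pow, ← mul_pow]
        ring
    _ ≤ (Real.exp (X / 24) * (Real.exp (X / 3) * Real.exp (-(X / 8)) ^ 3)) ^ r := by gcongr
    _ = 1 := by
        rw [← Real.exp_nat_mul, ← Real.exp_add, ← Real.exp_add]
        rw [show X / 24 + (X / 3 + ((3 : ℕ) : ℝ) * -(X / 8)) = 0 by push_cast; ring]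
        simp

theorem exists_trivial_solution {σ θ : ℝ} {z0 : ℤ → ℂ} (hz0 : inG σ θ z0)
    (h : gNorm σ θ z0 = 0) (T : ℝ) :
    ∃ z : ℝ → ℤ → ℂ, z 0 = z0 ∧ (∀ t ∈ Set.Icc (-T) T, inG σ θ (z t)) ∧
      (∀ t₀ ∈ Set.Icc (-T) T, Filter.Tendsto (fun t => gNorm σ θ (fun a => z t a - z t₀ a))
        (nhdsWithin t₀ (Set.Icc (-T) T)) (nhds 0)) ∧
      (∀ a : ℤ, ∀ t ∈ Set.Icc (-T) T, ∃ d : ℂ,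
        HasDerivWithinAt (fun s => z s a) d (Set.Icc (-T) T) t ∧
        Complex.I * d = -(a : ℂ) ^ 2 * z t a - ∑' k : ℤ, (if k ≠ 0 then
          ((k : ℂ) ^ 2)⁻¹ * (∑' b : ℤ, z t b * (starRingEnd ℂ) (z t (b - k))) * z t (a - k)
          else 0)) ∧
      (∀ t ∈ Set.Icc (-T) T, gNorm σ θ (z t) ≤ 2 * gNorm σ θ z0 ∧
        Summable (fun a : ℤ => wt σ θ a * Real.sqrt |‖z t a‖ ^ 2 - ‖z0 a‖ ^ 2|) ∧
        (∑' a : ℤ, wt σ θ a * Real.sqrt |‖z t a‖ ^ 2 - ‖z0 a‖ ^ 2|) ≤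
          gNorm σ θ z0 ^ ((3 : ℝ) / 2)) := by
  have hz : z0 = 0 := by
    have hs : ∑' a, wt σ θ a * ‖z0 a‖ = 0 := by simpa [gNorm] using h
    have h0 : ∀ a, 0 ≤ wt σ θ a * ‖z0 a‖ := fun a =>
      mul_nonneg (wt_pos σ θ a).le (norm_nonneg _)
    have hf := (hasSum_zero_iff_of_nonneg h0).1 (hs ▸ Summable.hasSum hz0)
    funext a
    simpa [(wt_pos σ θ a).ne'] using congrFun hf a
  subst hz
  refine ⟨fun _ => 0, rfl, fun _ _ => hz0, fun _ _ => ?_, fun a t _ => ⟨0, ?_, by simp⟩,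
    fun t _ => ?_⟩
  · simpa [gNorm] using tendsto_const_nhds
  · exact hasDerivWithinAt_const _ _ _
  · rw [h]; simp

/-- Long-time stability for the Schrödinger–Poisson equation: there is
`ε* > 0` (depending only on `σ, θ`) such that for all `ε ∈ (0, ε*)` and every initial datum
`z⁰ ∈ Θ_ε` with `‖z⁰‖_σ ≤ ε`, there is a solution `z ∈ C([-T_ε, T_ε]; 𝒢)` of (NLSP) with
`z(0) = z⁰` satisfying `‖z(t)‖_σ ≤ 2 ‖z(0)‖_σ` and
`∑_a e^{σ|a|^θ} ||z_a(t)|² - |z_a(0)|²|^{1/2} ≤ ‖z(0)‖_σ^{3/2}` for `|t| ≤ T_ε`. -/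
theorem stmt0 (σ θ : ℝ) (hσ : 0 < σ) (hθ : θ ∈ Set.Ioo (0 : ℝ) 1) :
    ∃ εs : ℝ, 0 < εs ∧ ∀ ε : ℝ, 0 < ε → ε < εs →
      ∀ z0 : ℤ → ℂ, inG σ θ z0 → inTheta σ θ ε z0 → gNorm σ θ z0 ≤ ε →
        ∃ z : ℝ → ℤ → ℂ,
          z 0 = z0 ∧
          (∀ t ∈ Set.Icc (-TEps σ θ ε) (TEps σ θ ε), inG σ θ (z t)) ∧
          -- continuity in time with values in `𝒢`
          (∀ t₀ ∈ Set.Icc (-TEps σ θ ε) (TEps σ θ ε),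
            Filter.Tendsto (fun t => gNorm σ θ (fun a => z t a - z t₀ a))
              (nhdsWithin t₀ (Set.Icc (-TEps σ θ ε) (TEps σ θ ε))) (nhds 0)) ∧
          -- `z` solves (NLSP) in Fourier variables:
          -- `i ż_a = -a² z_a - ∑_{k ≠ 0} k⁻² (∑_b z_b conj(z_{b-k})) z_{a-k}`
          (∀ a : ℤ, ∀ t ∈ Set.Icc (-TEps σ θ ε) (TEps σ θ ε), ∃ d : ℂ,
            HasDerivWithinAt (fun s => z s a) d
              (Set.Icc (-TEps σ θ ε) (TEps σ θ ε)) t ∧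
            Complex.I * d = -(a : ℂ) ^ 2 * z t a -
              ∑' k : ℤ, (if k ≠ 0 then
                ((k : ℂ) ^ 2)⁻¹ * (∑' b : ℤ, z t b * (starRingEnd ℂ) (z t (b - k))) * z t (a - k)
              else 0)) ∧
          -- the stability estimates
          (∀ t ∈ Set.Icc (-TEps σ θ ε) (TEps σ θ ε),
            gNorm σ θ (z t) ≤ 2 * gNorm σ θ z0 ∧
            Summable (fun a : ℤ => wt σ θ a * Real.sqrt |‖z t a‖ ^ 2 - ‖z0 a‖ ^ 2|) ∧
            (∑' a : ℤ, wt σ θ a * Real.sqrt |‖z t a‖ ^ 2 - ‖z0 a‖ ^ 2|) ≤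
              gNorm σ θ z0 ^ ((3 : ℝ) / 2)) := by
  obtain ⟨h0, h1⟩ := hθ
  have hθ1 : 0 < 1 - θ := sub_pos.2 h1
  obtain ⟨c, hc⟩ : ∃ c, c = min 1 σ * θ * (1 - θ) / 500 := ⟨_, rfl⟩
  have hm : 0 < min 1 σ := lt_min one_pos hσ
  have hc0 : 0 < c := by rw [hc]; positivity
  have hm1 : min 1 σ * θ ≤ 1 := mul_le_one₀ (min_le_left _ _) h0.le h1.le
  have hmσ : min 1 σ * θ ≤ σ := (mul_le_of_le_one_right hm.le h1.le).trans (min_le_right _ _)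
  have hc1 : c ≤ 1 := by rw [hc]; nlinarith
  have hcσ : c ≤ σ * (1 - θ) / 500 := by rw [hc]; gcongr
  obtain ⟨X₀, hX₀⟩ := exists_parameter_threshold (c := min c (σ * (1 - θ))) hσ
    (lt_min hc0 (by positivity))
  refine ⟨Real.exp (-X₀), Real.exp_pos _, fun ε hε hεs z0 hz0 hz0Θ hz0ε => ?_⟩
  obtain ⟨X, hX⟩ : ∃ X, X = Real.log ε⁻¹ := ⟨_, rfl⟩
  have hεX : ε = Real.exp (-X) := by rw [hX, Real.log_inv, neg_neg, Real.exp_log hε]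
  obtain ⟨hX24, hlog1, hlogc, hσX, hexp⟩ := hX₀ X (by
    rw [hεX, Real.exp_lt_exp] at hεs; linarith)
  have hX0 : 0 < X := by linarith
  obtain ⟨r, hr⟩ : ∃ r, r = rEps σ θ ε := ⟨_, rfl⟩
  have hrc : r = ⌊c * X / Real.log X⌋₊ := by rw [hr, rEps, hc, hX]
  have hr1 : 1 ≤ r := by
    rw [hrc, Nat.one_le_floor_iff, le_div_iff₀ (by linarith), one_mul]
    exact hlogc.trans (mul_le_mul_of_nonneg_right (min_le_left _ _) hX0.le)
  have hrcX : (r : ℝ) ≤ c * X := by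
    rw [hrc]
    exact (Nat.floor_le (by positivity)).trans (div_le_self (by positivity) hlog1)
  have hrX : (r : ℝ) ≤ X := hrcX.trans (mul_le_of_le_one_left hX0.le hc1)
  have hr1' : (1 : ℝ) ≤ r := by exact_mod_cast hr1
  have hTe : TEps σ θ ε = Real.exp (X * r / 3) := by
    rw [TEps, ← hr, hεX, ← Real.exp_mul]; congr 1; ring
  rw [hTe]
  have hT1 : 1 ≤ Real.exp (X * r / 3) := Real.one_le_exp (by positivity)
  rcases (mul_nonneg zero_le_two (tsum_nonneg fun a => mul_nonneg (wt_pos σ θ a).le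
    (norm_nonneg (z0 a))) : 0 ≤ gNorm σ θ z0).eq_or_lt with hρ | hρ
  · exact exists_trivial_solution hz0 hρ.symm _
  have hNθ : NEps θ ε ^ θ = X ^ 2 := by
    rw [NEps, ← hX, ← Real.rpow_mul hX0.le, div_mul_cancel₀ _ h0.ne']
    norm_num
  have hs16 : Real.exp (-(X / 8)) ≤ 1 / 16 := by
    rw [Real.exp_neg, one_div]
    refine inv_anti₀ (by norm_num) ?_
    have h2 : (2.7 : ℝ) ≤ Real.exp 1 := by linarith [Real.exp_one_gt_d9]
    calc (16 : ℝ) ≤ 2.7 ^ 3 := by norm_num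
      _ ≤ Real.exp 1 ^ 3 := by gcongr
      _ = Real.exp 3 := by rw [← Real.exp_nat_mul]; norm_num
      _ ≤ Real.exp (X / 8) := Real.exp_le_exp.2 (by linarith)
  have hσX2 : 24 ≤ σ * (1 - θ) * X * X := by
    have : 1 ≤ σ * (1 - θ) * X :=
      hlog1.trans (hlogc.trans (mul_le_mul_of_nonneg_right (min_le_right _ _) hX0.le))
    nlinarith
  refine Exists.elim (exists_stable_solution (N := NEps θ ε)
    (L := LEps σ θ ε) (T := Real.exp (X * r / 3)) (s := Real.exp (-(X / 8)))
    (A := 128 * (((3 * r : ℕ) : ℝ) + 1) ^ 2) (M := 3 * r) (z0 := z0) hσ h0 h1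
    (by rw [NEps, ← hX]; exact Real.one_le_rpow (by linarith) (by positivity))
    (Real.exp_pos _) hs16 le_rfl ?_ (by omega) (Real.exp_pos _) ?_ hρ ?_ ?_ ?_ ?_ ?_ hz0 rfl) ?_
  · rw [Real.exp_neg, ← div_eq_mul_inv, div_le_one (Real.exp_pos _)]
    have hB : (1 : ℝ) ≤ 256 * (3 * X + 1) ^ 2 := by nlinarith
    calc 2 * (128 * (((3 * r : ℕ) : ℝ) + 1) ^ 2) = 256 * (3 * (r : ℝ) + 1) ^ 2 := by
          push_cast; ring
      _ ≤ 256 * (3 * X + 1) ^ 2 := by gcongr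
      _ ≤ (256 * (3 * X + 1) ^ 2) ^ 3 := le_self_pow₀ hB (by norm_num)
      _ ≤ 2 * (256 * (3 * X + 1) ^ 2) ^ 3 := by linarith [pow_nonneg (zero_le_one.trans hB) 3]
      _ ≤ Real.exp (X / 24) := hexp
      _ ≤ Real.exp (X / 8) := Real.exp_le_exp.2 (by linarith)
  · refine le_trans ?_ (two_mul_exp_mul_pow_le_one hX0.le hr1 hrX hexp)
    gcongr
    linarith
  · rw [← Real.exp_nat_mul]
    refine hz0ε.trans (le_of_eq ?_)
    rw [hεX]; congr 1; push_cast; ring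
  · rw [hNθ]
    calc Real.exp (X * r / 3) + 1 ≤ Real.exp 1 * Real.exp (X * r / 3) := by
          nlinarith [Real.exp_one_gt_d9]
      _ = Real.exp (1 + X * r / 3) := (Real.exp_add _ _).symm
      _ ≤ _ := Real.exp_le_exp.2 ?_
    have : X * r ≤ X * (σ * (1 - θ) / 500 * X) := by
      gcongr
      exact hrcX.trans (by gcongr)
    have e1 : X * (σ * (1 - θ) / 500 * X) = σ * (1 - θ) * X * X / 500 := by ring
    have e2 : σ * (1 - θ) * X ^ 2 = σ * (1 - θ) * X * X := by ring
    linarith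
  · rw [hNθ, ← Real.exp_nat_mul]
    refine Real.exp_le_exp.2 ?_
    have e1 : X * 1 ≤ X * (σ * X) := mul_le_mul_of_nonneg_left hσX hX0.le
    have e2 : X * (σ * X) = σ * X ^ 2 := by ring
    push_cast
    linarith
  · rw [LEps, ← hr]; push_cast; exact le_of_eq (by ring)
  · have hd : dEps ε = Real.exp (-(X / 8)) ^ 20 := by
      rw [dEps, hεX, ← Real.exp_mul, ← Real.exp_nat_mul]; congr 1; push_cast; ring
    rw [inTheta, hd, ← hr] at hz0Θ
    convert hz0Θ using 1
    push_cast; ring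
  · rintro z ⟨hz, hzG, hzc, hode, hest⟩
    refine ⟨z, hz, fun t _ => hzG t, hzc, fun a t ht =>
      ⟨_, (hode a t ht).hasDerivWithinAt, I_mul_vf ?_ a⟩, hest⟩
    exact Summable.of_nonneg_of_le (fun _ => norm_nonneg _)
      (fun a => le_mul_of_one_le_left (norm_nonneg _) (one_le_wt hσ a)) (hzG t)
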